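/- There exist constants ᾱ ∈ (0,1) and C > 0 depending only on λ and Λ such that the following holds. Let u ∈ C²(B̄₁), with B₁ ⊂ ℝ² the unit disk, be a classical solution of F(D²u) = 0 in B₁ with u = g on ∂B₁, where F is of class C¹, uniformly elliptic with constants λ, Λ, F(0) = 0, and g ∈ C^{2,ᾱ}(∂B₁). Then u ∈ C^{2,ᾱ}(B̄₁) and ‖u‖_{C^{2,ᾱ}(B̄₁)} ≤ C‖g‖_{C^{2,ᾱ}(∂B₁)}. -/

import Mathlib

open Metric Set Real
open scoped Classical

noncomputable section

abbrev E2 : Type := EuclideanSpace ℝ (Fin 2)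
abbrev Mat2 : Type := Matrix (Fin 2) (Fin 2) ℝ

/-- `‖A⁺‖`: the sum of the positive parts of the eigenvalues of a symmetric matrix `A`. -/
noncomputable def posNorm (A : Mat2) : ℝ :=
  if h : A.IsHermitian then ∑ i, max (h.eigenvalues i) 0 else 0

/-- `‖A⁻‖`: the sum of the negative parts of the eigenvalues of a symmetric matrix `A`. -/
noncomputable def negNorm (A : Mat2) : ℝ :=
  if h : A.IsHermitian then ∑ i, max (-(h.eigenvalues i)) 0 else 0

/-- A norm on 2×2 matrices: sum of absolute values of entries. -/
noncomputable def matNorm (A : Mat2) : ℝ := ∑ i, ∑ j, |A i j|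

/-- `F` is uniformly elliptic with constants `0 < lam ≤ Lam`:
`F M - F N ≤ Lam ‖(M-N)⁺‖ - lam ‖(M-N)⁻‖` for all symmetric `M, N`. -/
def UniformlyElliptic (lam Lam : ℝ) (F : Mat2 → ℝ) : Prop :=
  ∀ M N : Mat2, M.IsHermitian → N.IsHermitian →
    F M - F N ≤ Lam * posNorm (M - N) - lam * negNorm (M - N)

/-- The Hessian matrix `D²u(x)` of `u : ℝ² → ℝ` at `x`. -/
noncomputable def hess (u : E2 → ℝ) (x : E2) : Mat2 :=
  Matrix.of fun i j =>
    fderiv ℝ (fun y => fderiv ℝ u y (EuclideanSpace.single j 1)) x (EuclideanSpace.single i 1)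

/-- `sup_s |u|`, the `L^∞` norm of `u` on `s`. -/
noncomputable def supAbs (u : E2 → ℝ) (s : Set E2) : ℝ := ⨆ x ∈ s, |u x|

/-- The point `(cos t, sin t)` on the unit circle `∂B₁`. -/
noncomputable def circPt (t : ℝ) : E2 :=
  (EuclideanSpace.equiv (Fin 2) ℝ).symm ![Real.cos t, Real.sin t]

/-- The trace of `g` on the unit circle, as a `2π`-periodic function on `ℝ`. -/
noncomputable def onCircle (g : E2 → ℝ) : ℝ → ℝ := fun t => g (circPt t)

/-- `g ∈ C^{2,α}(∂B₁)`, via the arclength parametrization `t ↦ (cos t, sin t)`. -/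
def MemHolderCircle (α : ℝ) (g : E2 → ℝ) : Prop :=
  ContDiff ℝ 2 (onCircle g) ∧
    ∃ H : ℝ, ∀ s t : ℝ,
      |deriv (deriv (onCircle g)) s - deriv (deriv (onCircle g)) t| ≤ H * |s - t| ^ α

/-- The `C^{2,α}` norm of `g` on the unit circle `∂B₁`. -/
noncomputable def holderNormCircle (α : ℝ) (g : E2 → ℝ) : ℝ :=
  (⨆ t : ℝ, |onCircle g t|) + (⨆ t : ℝ, |deriv (onCircle g) t|) +
    (⨆ t : ℝ, |deriv (deriv (onCircle g)) t|) +
    ⨆ p : ℝ × ℝ,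
      if p.1 ≠ p.2 then
        |deriv (deriv (onCircle g)) p.1 - deriv (deriv (onCircle g)) p.2| / |p.1 - p.2| ^ α
      else 0

lemma two_roots {l1 l2 m1 m2 : ℝ} (h1 : m1 + m2 = -(l1 + l2)) (h2 : m1 * m2 = l1 * l2) :
    (m1 = -l1 ∧ m2 = -l2) ∨ (m1 = -l2 ∧ m2 = -l1) := by
  have h : (m1 + l1) * (m1 + l2) = 0 := by
    have : m2 = -(l1 + l2) - m1 := by linarith
    subst this
    nlinarith
  rcases mul_eq_zero.mp h with h | h
  · left; constructor <;> linarith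
  · right; constructor <;> linarith

lemma posNorm_neg {X : Mat2} (hX : X.IsHermitian) : posNorm (-X) = negNorm X := by
  have hX' : (-X).IsHermitian := hX.neg
  unfold posNorm negNorm
  rw [dif_pos hX', dif_pos hX]
  have t1 := hX.trace_eq_sum_eigenvalues
  have t2 := hX'.trace_eq_sum_eigenvalues
  have d1 := hX.det_eq_prod_eigenvalues
  have d2 := hX'.det_eq_prod_eigenvalues
  simp only [Fin.sum_univ_two, Fin.prod_univ_two, Matrix.trace_neg, Matrix.det_fin_two, Matrix.trace_fin_two, RCLike.ofReal_real_eq_id, id, Matrix.neg_apply] at t1 t2 d1 d2 ⊢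
  rcases two_roots (l1 := hX.eigenvalues 0) (l2 := hX.eigenvalues 1) (m1 := hX'.eigenvalues 0) (m2 := hX'.eigenvalues 1) (by linarith) (by rw [← d1, ← d2]; ring) with ⟨a, b⟩ | ⟨a, b⟩
  · rw [a, b]
  · rw [a, b, add_comm]

lemma negNorm_neg {X : Mat2} (hX : X.IsHermitian) : negNorm (-X) = posNorm X := by
  have := posNorm_neg hX.neg
  rw [neg_neg] at this
  exact this.symm

lemma cone_real {lam Lam a b : ℝ} (hlam : 0 < lam) (hLam : lam ≤ Lam)
    (h1 : 0 ≤ Lam * (max a 0 + max b 0) - lam * (max (-a) 0 + max (-b) 0))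
    (h2 : 0 ≤ Lam * (max (-a) 0 + max (-b) 0) - lam * (max a 0 + max b 0)) :
    lam / (2 * Lam) * (a ^ 2 + b ^ 2) ≤ - (a * b) := by
  have hL : 0 < Lam := by linarith
  rw [div_mul_eq_mul_div, div_le_iff₀ (by positivity)]
  rcases le_total 0 a with ha | ha <;> rcases le_total 0 b with hb | hb
  · rw [max_eq_left ha, max_eq_left hb, max_eq_right (by linarith : -a ≤ 0), max_eq_right (by linarith : -b ≤ 0)] at h1 h2
    have : a + b ≤ 0 := by
      by_contra h
      push Not at h
      nlinarith
    have a0 : a = 0 := by linarith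
    have b0 : b = 0 := by linarith
    subst a0; subst b0; simp
  · rw [max_eq_left ha, max_eq_right hb, max_eq_right (by linarith : -a ≤ 0), max_eq_left (by linarith : 0 ≤ -b)] at h1 h2
    have e1 : 0 ≤ (-b) * (Lam * a - lam * (-b)) := mul_nonneg (by linarith) (by linarith)
    have e2 : 0 ≤ a * (Lam * (-b) - lam * a) := mul_nonneg (by linarith) (by linarith)
    nlinarith
  · rw [max_eq_left hb, max_eq_right ha, max_eq_right (by linarith : -b ≤ 0), max_eq_left (by linarith : 0 ≤ -a)] at h1 h2
    have e1 : 0 ≤ (-a) * (Lam * b - lam * (-a)) := mul_nonneg (by linarith) (by linarith)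
    have e2 : 0 ≤ b * (Lam * (-a) - lam * b) := mul_nonneg (by linarith) (by linarith)
    nlinarith
  · rw [max_eq_right ha, max_eq_right hb, max_eq_left (by linarith : 0 ≤ -a), max_eq_left (by linarith : 0 ≤ -b)] at h1 h2
    have : 0 ≤ a + b := by
      by_contra h
      push Not at h
      nlinarith
    have a0 : a = 0 := by linarith
    have b0 : b = 0 := by linarith
    subst a0; subst b0; simp

lemma cone_of_elliptic {lam Lam : ℝ} (hlam : 0 < lam) (hLam : lam ≤ Lam) {F : Mat2 → ℝ}
    (hF : UniformlyElliptic lam Lam F) {M N : Mat2} (hM : M.IsHermitian) (hN : N.IsHermitian)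
    (h : F M = F N) :
    lam / (2 * Lam) * ((M - N) 0 0 ^ 2 + (M - N) 0 1 ^ 2 + (M - N) 1 0 ^ 2 + (M - N) 1 1 ^ 2) ≤
      (M - N) 0 1 * (M - N) 1 0 - (M - N) 0 0 * (M - N) 1 1 := by
  have h1 := hF M N hM hN
  have h2 := hF N M hN hM
  have hX : (M - N).IsHermitian := hM.sub hN
  rw [show N - M = -(M - N) by abel, posNorm_neg hX, negNorm_neg hX] at h2
  generalize M - N = X at *
  rw [h, sub_self] at h1 h2
  have t1 := hX.trace_eq_sum_eigenvalues
  have d1 := hX.det_eq_prod_eigenvalues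
  unfold posNorm negNorm at h1 h2
  rw [dif_pos hX, dif_pos hX] at h1 h2
  have hs : X 1 0 = X 0 1 := by simpa using hX.apply 0 1
  simp only [Fin.sum_univ_two, Fin.prod_univ_two, Matrix.det_fin_two, Matrix.trace_fin_two, RCLike.ofReal_real_eq_id, id] at t1 d1 h1 h2
  have := cone_real hlam hLam h1 h2
  rw [← d1] at this
  have e : hX.eigenvalues 0 ^ 2 + hX.eigenvalues 1 ^ 2 = X 0 0 ^ 2 + X 0 1 ^ 2 + X 1 0 ^ 2 + X 1 1 ^ 2 := by
    have : hX.eigenvalues 0 ^ 2 + hX.eigenvalues 1 ^ 2 = (hX.eigenvalues 0 + hX.eigenvalues 1)^2 - 2 * (hX.eigenvalues 0 * hX.eigenvalues 1) := by ring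
    rw [this, ← t1, ← d1, hs]; ring
  rw [e] at this
  linarith

def ee0 : E2 := EuclideanSpace.single 0 1
def ee1 : E2 := EuclideanSpace.single 1 1

lemma E2_decomp (x : E2) : x = x 0 • ee0 + x 1 • ee1 := by
  ext i; fin_cases i <;> simp [ee0, ee1]

lemma clm_decomp (L : E2 →L[ℝ] ℝ) (x : E2) : L x = x 0 * L ee0 + x 1 * L ee1 := by
  conv_lhs => rw [E2_decomp x]
  simp

lemma circPt_eq (t : ℝ) : circPt t = cos t • ee0 + sin t • ee1 := by
  ext i; fin_cases i <;> simp [ee0, ee1, circPt]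

def tauPt (t : ℝ) : E2 := (-sin t) • ee0 + cos t • ee1

lemma E2_norm_sq (x : E2) : ‖x‖ ^ 2 = x 0 ^ 2 + x 1 ^ 2 := by
  rw [EuclideanSpace.norm_sq_eq]; simp

@[simp] lemma circPt_zero' (t : ℝ) : circPt t 0 = cos t := by simp [circPt]
@[simp] lemma circPt_one' (t : ℝ) : circPt t 1 = sin t := by simp [circPt]
@[simp] lemma tauPt_zero' (t : ℝ) : tauPt t 0 = -sin t := by simp [tauPt, ee0, ee1]
@[simp] lemma tauPt_one' (t : ℝ) : tauPt t 1 = cos t := by simp [tauPt, ee0, ee1]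
@[simp] lemma ee0_zero : ee0 0 = 1 := by simp [ee0]
@[simp] lemma ee0_one : ee0 1 = 0 := by simp [ee0]
@[simp] lemma ee1_zero : ee1 0 = 0 := by simp [ee1]
@[simp] lemma ee1_one : ee1 1 = 1 := by simp [ee1]

lemma norm_circPt (t : ℝ) : ‖circPt t‖ = 1 := by
  have h := E2_norm_sq (circPt t)
  simp only [circPt_zero', circPt_one'] at h
  nlinarith [norm_nonneg (circPt t), sin_sq_add_cos_sq t]

lemma norm_tauPt (t : ℝ) : ‖tauPt t‖ = 1 := by
  have h := E2_norm_sq (tauPt t)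
  simp only [tauPt_zero', tauPt_one'] at h
  nlinarith [norm_nonneg (tauPt t), sin_sq_add_cos_sq t]

lemma contDiff_circPt {n : WithTop ℕ∞} : ContDiff ℝ n circPt := by
  have : circPt = fun t => cos t • ee0 + sin t • ee1 := funext circPt_eq
  rw [this]
  fun_prop

lemma contDiff_tauPt {n : WithTop ℕ∞} : ContDiff ℝ n tauPt := by
  unfold tauPt
  fun_prop

lemma hasDerivAt_circPt (t : ℝ) : HasDerivAt circPt (tauPt t) t := by
  have : circPt = fun t => cos t • ee0 + sin t • ee1 := funext circPt_eq
  rw [this]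
  exact ((hasDerivAt_cos t).smul_const ee0).add ((hasDerivAt_sin t).smul_const ee1)

lemma hasDerivAt_tauPt (t : ℝ) : HasDerivAt tauPt (-circPt t) t := by
  rw [circPt_eq]
  have h := ((hasDerivAt_sin t).neg.smul_const ee0).add ((hasDerivAt_cos t).smul_const ee1)
  have e : -(cos t • ee0 + sin t • ee1) = -cos t • ee0 + -sin t • ee1 := by
    rw [neg_add, neg_smul, neg_smul]
  rw [e]
  exact h

lemma exists_circPt {x : E2} (hx : ‖x‖ = 1) : ∃ t, x = circPt t := by
  have h := E2_norm_sq x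
  rw [hx] at h
  refine ⟨Complex.arg ⟨x 0, x 1⟩, ?_⟩
  have hn : ‖(⟨x 0, x 1⟩ : ℂ)‖ = 1 := by
    rw [Complex.norm_def, Complex.normSq_apply]
    simp only
    rw [show x 0 * x 0 + x 1 * x 1 = 1 by nlinarith]
    simp
  have hz : (⟨x 0, x 1⟩ : ℂ) ≠ 0 := by
    intro h0; rw [h0] at hn; simp at hn
  ext i; fin_cases i
  · simp [Complex.cos_arg hz, hn]
  · simp [Complex.sin_arg, hn]

def pol (x : E2) (s t : ℝ) : E2 := x + s • circPt t

lemma hasDerivAt_pol_fst (x : E2) (s t : ℝ) : HasDerivAt (fun s => pol x s t) (circPt t) s := by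
  unfold pol
  simpa using ((hasDerivAt_id s).smul_const (circPt t)).const_add x

lemma hasDerivAt_pol_snd (x : E2) (s t : ℝ) : HasDerivAt (fun t => pol x s t) (s • tauPt t) t := by
  unfold pol
  simpa using ((hasDerivAt_circPt t).const_smul s).const_add x

lemma contDiff_pol (x : E2) {n : WithTop ℕ∞} : ContDiff ℝ n (fun z : ℝ × ℝ => pol x z.1 z.2) := by
  unfold pol
  have := contDiff_circPt (n := n)
  fun_prop

def jac (f q : E2 → ℝ) (y : E2) : ℝ :=
  fderiv ℝ f y ee0 * fderiv ℝ q y ee1 - fderiv ℝ f y ee1 * fderiv ℝ q y ee0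

lemma jac_polar (f q : E2 → ℝ) (y : E2) (t : ℝ) :
    fderiv ℝ f y (circPt t) * fderiv ℝ q y (tauPt t) - fderiv ℝ f y (tauPt t) * fderiv ℝ q y (circPt t)
      = jac f q y := by
  rw [clm_decomp (fderiv ℝ f y) (circPt t), clm_decomp (fderiv ℝ f y) (tauPt t),
    clm_decomp (fderiv ℝ q y) (circPt t), clm_decomp (fderiv ℝ q y) (tauPt t)]
  simp only [circPt_zero', circPt_one', tauPt_zero', tauPt_one', jac]
  have := sin_sq_add_cos_sq t
  linear_combination (fderiv ℝ f y ee0 * fderiv ℝ q y ee1 - fderiv ℝ f y ee1 * fderiv ℝ q y ee0) * this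

lemma continuous_jac {f q : E2 → ℝ} (hf : ContDiff ℝ 1 f) (hq : ContDiff ℝ 1 q) :
    Continuous (jac f q) := by
  unfold jac
  have h1 := hf.continuous_fderiv (by norm_num)
  have h2 := hq.continuous_fderiv (by norm_num)
  fun_prop

/-- Stokes formula in polar coordinates for twice differentiable `q`. -/
lemma stokes_C2 (f q : E2 → ℝ) (hf : ContDiff ℝ 1 f) (hq : ContDiff ℝ 2 q) (x : E2) (R : ℝ) :
    ∫ t in (0:ℝ)..(2 * π), f (pol x R t) * fderiv ℝ q (pol x R t) (R • tauPt t) =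
      ∫ s in (0:ℝ)..R, ∫ t in (0:ℝ)..(2 * π), s * jac f q (pol x s t) := by
  have hdq : ContDiff ℝ 1 (fderiv ℝ q) := hq.fderiv_right (by norm_num)
  have hpol := contDiff_pol x (n := 1)
  have hc := contDiff_circPt (n := 1)
  have htau := contDiff_tauPt (n := 1)
  set F : ℝ × ℝ → ℝ := fun z => f (pol x z.1 z.2) * fderiv ℝ q (pol x z.1 z.2) (z.1 • tauPt z.2) with hF
  set G : ℝ × ℝ → ℝ := fun z => -(f (pol x z.1 z.2) * fderiv ℝ q (pol x z.1 z.2) (circPt z.2)) with hG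
  have hFc : ContDiff ℝ 1 F := by
    have h1 : ContDiff ℝ 1 (fun z : ℝ × ℝ => f (pol x z.1 z.2)) := hf.comp hpol
    have h2 : ContDiff ℝ 1 (fun z : ℝ × ℝ => fderiv ℝ q (pol x z.1 z.2)) := hdq.comp hpol
    have h3 : ContDiff ℝ 1 (fun z : ℝ × ℝ => z.1 • tauPt z.2) := by fun_prop
    exact h1.mul (h2.clm_apply h3)
  have hGc : ContDiff ℝ 1 G := by
    have h1 : ContDiff ℝ 1 (fun z : ℝ × ℝ => f (pol x z.1 z.2)) := hf.comp hpol
    have h2 : ContDiff ℝ 1 (fun z : ℝ × ℝ => fderiv ℝ q (pol x z.1 z.2)) := hdq.comp hpol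
    have h3 : ContDiff ℝ 1 (fun z : ℝ × ℝ => circPt z.2) := by fun_prop
    exact (h1.mul (h2.clm_apply h3)).neg
  have key : ∀ s t : ℝ, fderiv ℝ F (s, t) (1, 0) + fderiv ℝ G (s, t) (0, 1) = s * jac f q (pol x s t) := by
    intro s t
    have hfd : ∀ y, HasFDerivAt f (fderiv ℝ f y) y := fun y => (hf.differentiable (by norm_num) y).hasFDerivAt
    have hqd : ∀ y, HasFDerivAt (fderiv ℝ q) (fderiv ℝ (fderiv ℝ q) y) y :=
      fun y => (hdq.differentiable (by norm_num) y).hasFDerivAt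
    have e1 : fderiv ℝ F (s, t) (1, 0) = fderiv ℝ f (pol x s t) (circPt t) * fderiv ℝ q (pol x s t) (s • tauPt t)
        + f (pol x s t) * (fderiv ℝ (fderiv ℝ q) (pol x s t) (circPt t) (s • tauPt t) + fderiv ℝ q (pol x s t) (tauPt t)) := by
      have hl : HasDerivAt (fun s => F (s, t)) (fderiv ℝ F (s, t) (1, 0)) s := by
        have h0 : HasDerivAt (fun s : ℝ => (s, t)) ((1:ℝ), (0:ℝ)) s := (hasDerivAt_id s).prodMk (hasDerivAt_const s t)
        exact ((hFc.differentiable (by norm_num) (s, t)).hasFDerivAt).comp_hasDerivAt s h0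
      refine hl.unique ?_
      have a1 := (hfd (pol x s t)).comp_hasDerivAt s (hasDerivAt_pol_fst x s t)
      have a2 := (hqd (pol x s t)).comp_hasDerivAt s (hasDerivAt_pol_fst x s t)
      have a3 : HasDerivAt (fun s : ℝ => s • tauPt t) (tauPt t) s := by
        simpa using (hasDerivAt_id s).smul_const (tauPt t)
      exact a1.mul (a2.clm_apply a3)
    have e2 : fderiv ℝ G (s, t) (0, 1) = -(fderiv ℝ f (pol x s t) (s • tauPt t) * fderiv ℝ q (pol x s t) (circPt t)
        + f (pol x s t) * (fderiv ℝ (fderiv ℝ q) (pol x s t) (s • tauPt t) (circPt t) + fderiv ℝ q (pol x s t) (tauPt t))) := by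
      have hl : HasDerivAt (fun t => G (s, t)) (fderiv ℝ G (s, t) (0, 1)) t := by
        have h0 : HasDerivAt (fun t : ℝ => (s, t)) ((0:ℝ), (1:ℝ)) t := (hasDerivAt_const t s).prodMk (hasDerivAt_id t)
        exact ((hGc.differentiable (by norm_num) (s, t)).hasFDerivAt).comp_hasDerivAt t h0
      refine hl.unique ?_
      have a1 := (hfd (pol x s t)).comp_hasDerivAt t (hasDerivAt_pol_snd x s t)
      have a2 := (hqd (pol x s t)).comp_hasDerivAt t (hasDerivAt_pol_snd x s t)
      exact (a1.mul (a2.clm_apply (hasDerivAt_circPt t))).neg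
    have hsymm : fderiv ℝ (fderiv ℝ q) (pol x s t) (circPt t) (tauPt t) = fderiv ℝ (fderiv ℝ q) (pol x s t) (tauPt t) (circPt t) := by
      have := (hq.contDiffAt (x := pol x s t)).isSymmSndFDerivAt (by simp)
      exact this _ _
    rw [e1, e2, ← jac_polar f q _ t]
    simp only [map_smul, smul_eq_mul, smul_apply]
    rw [hsymm]; ring
  have main := MeasureTheory.integral2_divergence_prod_of_hasFDerivAt F G (fderiv ℝ F) (fderiv ℝ G) 0 0 R (2 * π)
    hFc.continuous.continuousOn hGc.continuous.continuousOn
    (fun z _ => (hFc.differentiable (by norm_num) z).hasFDerivAt)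
    (fun z _ => (hGc.differentiable (by norm_num) z).hasFDerivAt)
    (by
      apply ContinuousOn.integrableOn_compact
      · exact isCompact_uIcc.prod isCompact_uIcc
      · have h1 := hFc.continuous_fderiv (by norm_num)
        have h2 := hGc.continuous_fderiv (by norm_num)
        fun_prop)
  simp only [key] at main
  rw [main]
  have hper : ∀ s, G (s, 2 * π) = G (s, 0) := by
    intro s
    have : circPt (2 * π) = circPt 0 := by simp [circPt_eq]
    simp [hG, pol, this]
  simp [hper, hF]

open MeasureTheory ContinuousLinearMap in
lemma approx_C1 {q : E2 → ℝ} (hq : ContDiff ℝ 1 q) (hc : HasCompactSupport q) {ε : ℝ} (hε : 0 < ε) :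
    ∃ q' : E2 → ℝ, ContDiff ℝ 2 q' ∧ ∀ y, ‖fderiv ℝ q' y - fderiv ℝ q y‖ ≤ ε := by
  have hcd : Continuous (fderiv ℝ q) := hq.continuous_fderiv (by norm_num)
  have hu : UniformContinuous (fderiv ℝ q) := (hc.fderiv ℝ).uniformContinuous_of_continuous hcd
  rcases Metric.uniformContinuous_iff.mp hu ε hε with ⟨δ, hδ, hfδ⟩
  set φ : ContDiffBump (0 : E2) := ⟨δ / 2, δ, half_pos hδ, half_lt_self hδ⟩ with hφ
  have hφc : Continuous (φ.normed volume) := φ.continuous_normed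
  refine ⟨convolution (φ.normed volume) q (lsmul ℝ ℝ) volume, ?_, ?_⟩
  · have : ContDiff ℝ (2 : ℕ∞) (convolution (φ.normed volume) q (lsmul ℝ ℝ) volume) :=
      φ.hasCompactSupport_normed.contDiff_convolution_left _ φ.contDiff_normed hq.continuous.locallyIntegrable
    exact_mod_cast this
  · intro y
    have h1 := hc.hasFDerivAt_convolution_right (μ := volume) (lsmul ℝ ℝ) (hφc.locallyIntegrable) hq y
    rw [h1.fderiv]
    have h2 : convolution (φ.normed volume) (fderiv ℝ q) ((lsmul ℝ ℝ).precompR E2) volume y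
      = convolution (φ.normed volume) (fderiv ℝ q) (lsmul ℝ ℝ) volume y := by
      unfold convolution
      congr 1
    rw [h2, ← dist_eq_norm]
    apply φ.dist_normed_convolution_le hcd.aestronglyMeasurable
    intro z hz
    exact (hfδ hz).le

lemma continuous_pol (x : E2) : Continuous (fun z : ℝ × ℝ => pol x z.1 z.2) := (contDiff_pol x (n := 0)).continuous
lemma continuous_pol_snd (x : E2) (s : ℝ) : Continuous (fun t : ℝ => pol x s t) :=
  (continuous_pol x).comp (by fun_prop : Continuous fun t : ℝ => (s, t))
lemma continuous_tauPt : Continuous tauPt := (contDiff_tauPt (n := 0)).continuous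
lemma continuous_circPt : Continuous circPt := (contDiff_circPt (n := 0)).continuous

lemma continuous_innerInt {g : E2 → ℝ} (hg : Continuous g) (x : E2) :
    Continuous (fun s : ℝ => ∫ t in (0:ℝ)..(2 * π), g (pol x s t)) := by
  apply intervalIntegral.continuous_parametric_intervalIntegral_of_continuous'
  exact hg.comp (continuous_pol x)

def stokesL (f q : E2 → ℝ) (x : E2) (R : ℝ) : ℝ :=
  ∫ t in (0:ℝ)..(2 * π), f (pol x R t) * fderiv ℝ q (pol x R t) (R • tauPt t)
def stokesR (f q : E2 → ℝ) (x : E2) (R : ℝ) : ℝ :=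
  ∫ s in (0:ℝ)..R, ∫ t in (0:ℝ)..(2 * π), s * jac f q (pol x s t)

lemma stokesL_integrand_cont {f q : E2 → ℝ} (hf : ContDiff ℝ 1 f) (hq : ContDiff ℝ 1 q) (x : E2) (R : ℝ) :
    Continuous fun t => f (pol x R t) * fderiv ℝ q (pol x R t) (R • tauPt t) := by
  have h1 := (hq.continuous_fderiv (by norm_num)).comp (continuous_pol_snd x R)
  have h2 := hf.continuous.comp (continuous_pol_snd x R)
  have := continuous_tauPt
  exact h2.mul (h1.clm_apply (by fun_prop))

lemma pol_mem {x : E2} {s t R : ℝ} (hs : 0 ≤ s) (hR : s ≤ R) : pol x s t ∈ closedBall x R := by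
  simp [pol, norm_smul, norm_circPt, abs_of_nonneg hs, hR]

lemma norm_ee0 : ‖ee0‖ = 1 := by simp [ee0]
lemma norm_ee1 : ‖ee1‖ = 1 := by simp [ee1]

lemma stokes_C1_cpt (f q : E2 → ℝ) (hf : ContDiff ℝ 1 f) (hq : ContDiff ℝ 1 q) (hc : HasCompactSupport q)
    (x : E2) {R : ℝ} (hR : 0 ≤ R) : stokesL f q x R = stokesR f q x R := by
  have hpi := Real.pi_pos
  obtain ⟨A, hA⟩ := (isCompact_closedBall x R).exists_bound_of_continuousOn hf.continuous.continuousOn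
  obtain ⟨B, hB⟩ := (isCompact_closedBall x R).exists_bound_of_continuousOn
    (hf.continuous_fderiv (by norm_num)).continuousOn
  have hA0 : 0 ≤ A := (norm_nonneg _).trans (hA x (mem_closedBall_self hR))
  have hB0 : 0 ≤ B := (norm_nonneg _).trans (hB x (mem_closedBall_self hR))
  have key : ∀ ε > 0, |stokesL f q x R - stokesR f q x R| ≤ (A * R * (2 * π) + R * (2 * B) * (2 * π) * R) * ε := by
    intro ε hε
    obtain ⟨q', hq', hd⟩ := approx_C1 hq hc hε
    have hq1 : ContDiff ℝ 1 q' := hq'.of_le (by norm_num)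
    have hst : stokesL f q' x R = stokesR f q' x R := stokes_C2 f q' hf hq' x R
    have l1 : |stokesL f q' x R - stokesL f q x R| ≤ (A * (ε * R)) * |2 * π - 0| := by
      unfold stokesL
      rw [← intervalIntegral.integral_sub ((stokesL_integrand_cont hf hq1 x R).intervalIntegrable _ _)
        ((stokesL_integrand_cont hf hq x R).intervalIntegrable _ _), ← Real.norm_eq_abs]
      apply intervalIntegral.norm_integral_le_of_norm_le_const
      intro t _
      rw [← mul_sub, norm_mul]
      have h1 := hA _ (pol_mem (x := x) (t := t) hR le_rfl)
      have h2 : ‖fderiv ℝ q' (pol x R t) (R • tauPt t) - fderiv ℝ q (pol x R t) (R • tauPt t)‖ ≤ ε * R := by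
        rw [← sub_apply]
        refine (ContinuousLinearMap.le_opNorm _ _).trans ?_
        have : ‖R • tauPt t‖ = R := by rw [norm_smul, norm_tauPt, mul_one, Real.norm_of_nonneg hR]
        rw [this]
        exact mul_le_mul_of_nonneg_right (hd _) hR
      exact mul_le_mul h1 h2 (norm_nonneg _) hA0
    have l2 : |stokesR f q' x R - stokesR f q x R| ≤ (R * (2 * B * ε) * |2 * π - 0|) * |R - 0| := by
      unfold stokesR
      have ci : ∀ g : E2 → ℝ, ContDiff ℝ 1 g → Continuous fun s : ℝ => ∫ t in (0:ℝ)..(2 * π), s * jac f g (pol x s t) := by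
        intro g hg
        simp only [intervalIntegral.integral_const_mul]
        exact continuous_id.mul (continuous_innerInt (continuous_jac hf hg) x)
      rw [← intervalIntegral.integral_sub ((ci q' hq1).intervalIntegrable _ _)
        ((ci q hq).intervalIntegrable _ _), ← Real.norm_eq_abs]
      apply intervalIntegral.norm_integral_le_of_norm_le_const
      intro s hs
      rw [uIoc_of_le hR] at hs
      have cj : ∀ g : E2 → ℝ, ContDiff ℝ 1 g → Continuous fun t : ℝ => s * jac f g (pol x s t) := by
        intro g hg
        exact continuous_const.mul ((continuous_jac hf hg).comp (continuous_pol_snd x s))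
      rw [← intervalIntegral.integral_sub ((cj q' hq1).intervalIntegrable _ _)
        ((cj q hq).intervalIntegrable _ _)]
      apply intervalIntegral.norm_integral_le_of_norm_le_const
      intro t _
      rw [← mul_sub, norm_mul, Real.norm_of_nonneg hs.1.le]
      have hb := hB _ (pol_mem (x := x) (t := t) hs.1.le hs.2)
      have b0 : |fderiv ℝ f (pol x s t) ee0| ≤ B :=
        ((fderiv ℝ f (pol x s t)).le_opNorm ee0).trans (by rw [norm_ee0, mul_one]; exact hb)
      have b1 : |fderiv ℝ f (pol x s t) ee1| ≤ B :=
        ((fderiv ℝ f (pol x s t)).le_opNorm ee1).trans (by rw [norm_ee1, mul_one]; exact hb)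
      have d0 : |fderiv ℝ q' (pol x s t) ee0 - fderiv ℝ q (pol x s t) ee0| ≤ ε := by
        rw [← sub_apply]
        exact (ContinuousLinearMap.le_opNorm _ ee0).trans (by simpa only [norm_ee0, mul_one] using hd (pol x s t))
      have d1 : |fderiv ℝ q' (pol x s t) ee1 - fderiv ℝ q (pol x s t) ee1| ≤ ε := by
        rw [← sub_apply]
        exact (ContinuousLinearMap.le_opNorm _ ee1).trans (by simpa only [norm_ee1, mul_one] using hd (pol x s t))
      have : |jac f q' (pol x s t) - jac f q (pol x s t)| ≤ 2 * B * ε := by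
        unfold jac
        have e : fderiv ℝ f (pol x s t) ee0 * fderiv ℝ q' (pol x s t) ee1 - fderiv ℝ f (pol x s t) ee1 * fderiv ℝ q' (pol x s t) ee0 -
          (fderiv ℝ f (pol x s t) ee0 * fderiv ℝ q (pol x s t) ee1 - fderiv ℝ f (pol x s t) ee1 * fderiv ℝ q (pol x s t) ee0)
          = fderiv ℝ f (pol x s t) ee0 * (fderiv ℝ q' (pol x s t) ee1 - fderiv ℝ q (pol x s t) ee1)
            - fderiv ℝ f (pol x s t) ee1 * (fderiv ℝ q' (pol x s t) ee0 - fderiv ℝ q (pol x s t) ee0) := by ring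
        rw [e]
        refine (abs_sub _ _).trans ?_
        rw [abs_mul, abs_mul]
        have m1 := mul_le_mul b0 d1 (abs_nonneg _) hB0
        have m2 := mul_le_mul b1 d0 (abs_nonneg _) hB0
        linarith
      exact mul_le_mul hs.2 this (abs_nonneg _) hR
    have e1 : |2 * π - 0| = 2 * π := by rw [sub_zero]; exact abs_of_pos (by positivity)
    have e2 : |R - 0| = R := by rw [sub_zero]; exact abs_of_nonneg hR
    rw [e1] at l1 l2
    rw [e2] at l2
    rw [hst] at l1
    have := abs_sub_le (stokesL f q x R) (stokesR f q' x R) (stokesR f q x R)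
    rw [abs_sub_comm (stokesL f q x R) (stokesR f q' x R)] at this
    linarith
  by_contra hne
  have hpos : 0 < |stokesL f q x R - stokesR f q x R| := abs_pos.mpr (sub_ne_zero.mpr hne)
  set D := A * R * (2 * π) + R * (2 * B) * (2 * π) * R with hD
  have hD0 : 0 ≤ D := by positivity
  have := key (|stokesL f q x R - stokesR f q x R| / (2 * (D + 1))) (by positivity)
  rw [mul_div_assoc', le_div_iff₀ (by positivity)] at this
  nlinarith

lemma stokes_C1 (f q : E2 → ℝ) (hf : ContDiff ℝ 1 f) (hq : ContDiff ℝ 1 q)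
    (x : E2) {R : ℝ} (hR : 0 ≤ R) : stokesL f q x R = stokesR f q x R := by
  set χ : ContDiffBump x := ⟨R + 1, R + 2, by linarith, by linarith⟩ with hχ
  have hq' : ContDiff ℝ 1 (fun y => χ y * q y) := χ.contDiff.mul hq
  have hc' : HasCompactSupport (fun y => χ y * q y) := χ.hasCompactSupport.mul_right
  have hfd : ∀ y ∈ closedBall x R, fderiv ℝ (fun y => χ y * q y) y = fderiv ℝ q y := by
    intro y hy
    apply Filter.EventuallyEq.fderiv_eq
    have : ball x (R + 1) ∈ nhds y := isOpen_ball.mem_nhds (by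
      rw [mem_closedBall] at hy; rw [mem_ball]; linarith)
    filter_upwards [this] with z hz
    rw [χ.one_of_mem_closedBall (ball_subset_closedBall hz), one_mul]
  have main := stokes_C1_cpt f _ hf hq' hc' x hR
  have e1 : stokesL f (fun y => χ y * q y) x R = stokesL f q x R := by
    unfold stokesL
    congr 1
    ext t
    rw [hfd _ (pol_mem hR le_rfl)]
  have e2 : stokesR f (fun y => χ y * q y) x R = stokesR f q x R := by
    unfold stokesR
    apply intervalIntegral.integral_congr
    intro s hs
    rw [uIcc_of_le hR] at hs
    simp only [jac]
    congr 1
    ext t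
    rw [hfd _ (pol_mem hs.1 hs.2)]
  rw [← e1, ← e2, main]

def en (p q : E2 → ℝ) (y : E2) : ℝ :=
  fderiv ℝ p y ee0 ^ 2 + fderiv ℝ p y ee1 ^ 2 + fderiv ℝ q y ee0 ^ 2 + fderiv ℝ q y ee1 ^ 2

lemma en_nonneg (p q : E2 → ℝ) (y : E2) : 0 ≤ en p q y := by unfold en; positivity

lemma continuous_en {p q : E2 → ℝ} (hp : ContDiff ℝ 1 p) (hq : ContDiff ℝ 1 q) : Continuous (en p q) := by
  unfold en
  have h1 := hp.continuous_fderiv (by norm_num)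
  have h2 := hq.continuous_fderiv (by norm_num)
  fun_prop

def sqp (s : ℝ) : ℝ := (max s 0) ^ 2

lemma hasDerivAt_sqp (s : ℝ) : HasDerivAt sqp (2 * max s 0) s := by
  rcases lt_trichotomy s 0 with h | h | h
  · rw [max_eq_right h.le, mul_zero]
    apply (hasDerivAt_const s (0:ℝ)).congr_of_eventuallyEq
    filter_upwards [Iio_mem_nhds h] with y hy
    simp [sqp, max_eq_right (le_of_lt (mem_Iio.mp hy))]
  · subst h
    simp only [max_self, mul_zero]
    rw [hasDerivAt_iff_isLittleO_nhds_zero]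
    simp only [sqp, zero_add, max_self, ne_eq, OfNat.ofNat_ne_zero, not_false_eq_true, zero_pow, sub_zero, smul_zero]
    apply Asymptotics.IsBigO.trans_isLittleO (g := fun h : ℝ => h ^ 2)
    · apply Asymptotics.IsBigO.of_bound 1
      filter_upwards with y
      simp only [norm_pow, Real.norm_eq_abs, one_mul]
      apply pow_le_pow_left₀ (abs_nonneg _)
      rw [abs_of_nonneg (le_max_right _ _)]
      exact max_le (le_abs_self y) (abs_nonneg y)
    · exact Asymptotics.isLittleO_pow_id one_lt_two
  · rw [max_eq_left h.le]
    have := hasDerivAt_pow 2 s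
    simp only [Nat.cast_ofNat, Nat.add_one_sub_one, pow_one] at this
    apply this.congr_of_eventuallyEq
    filter_upwards [Ioi_mem_nhds h] with y hy
    simp [sqp, max_eq_left (le_of_lt (mem_Ioi.mp hy))]

lemma contDiff_sqp : ContDiff ℝ 1 sqp := by
  rw [contDiff_one_iff_deriv]
  refine ⟨fun s => (hasDerivAt_sqp s).differentiableAt, ?_⟩
  have : deriv sqp = fun s => 2 * max s 0 := funext fun s => (hasDerivAt_sqp s).deriv
  rw [this]; fun_prop

lemma circPt_per (t : ℝ) : circPt (t + 2 * π) = circPt t := by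
  rw [circPt_eq, circPt_eq, cos_add_two_pi, sin_add_two_pi]

lemma exists_circPt_Icc {x : E2} (hx : ‖x‖ = 1) : ∃ t ∈ Icc 0 (2 * π), x = circPt t := by
  obtain ⟨t, rfl⟩ := exists_circPt hx
  have hper : Function.Periodic circPt (2 * π) := circPt_per
  obtain ⟨y, hy, h⟩ := hper.exists_mem_Ico₀ (by positivity) t
  exact ⟨y, ⟨hy.1, hy.2.le⟩, h⟩

lemma exists_pol {x y : E2} {ρ : ℝ} (hy : y ∈ closedBall x ρ) :
    ∃ s t, 0 ≤ s ∧ s ≤ ρ ∧ t ∈ Icc 0 (2 * π) ∧ y = pol x s t := by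
  rw [mem_closedBall, dist_eq_norm] at hy
  by_cases h : y - x = 0
  · refine ⟨0, 0, le_rfl, (norm_nonneg _).trans hy, ⟨le_rfl, by positivity⟩, ?_⟩
    simp [pol]; exact sub_eq_zero.mp h
  · have hn : ‖y - x‖ ≠ 0 := norm_ne_zero_iff.mpr h
    obtain ⟨t, ht, h1⟩ := exists_circPt_Icc (x := ‖y - x‖⁻¹ • (y - x)) (by
      rw [norm_smul, norm_inv, norm_norm, inv_mul_cancel₀ hn])
    refine ⟨‖y - x‖, t, norm_nonneg _, hy, ht, ?_⟩
    rw [pol, ← h1, smul_smul, mul_inv_cancel₀ hn, one_smul]; abel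

lemma maxprinc {p q : E2 → ℝ} (hp : ContDiff ℝ 1 p) (hq : ContDiff ℝ 1 q) {x : E2} {ρ c : ℝ} (hρ : 0 < ρ)
    (hc : 0 < c) (hJ : ∀ y ∈ closedBall x ρ, c * en p q y ≤ jac p q y) {M : ℝ}
    (hM : ∀ t ∈ Icc 0 (2 * π), p (pol x ρ t) ≤ M) {y : E2} (hy : y ∈ closedBall x ρ) : p y ≤ M := by
  set f : E2 → ℝ := fun y => sqp (p y - M) with hf
  have hfc : ContDiff ℝ 1 f := contDiff_sqp.comp (hp.sub contDiff_const)
  have hfd : ∀ y, fderiv ℝ f y = (2 * max (p y - M) 0) • fderiv ℝ p y := by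
    intro y
    have h1 : HasFDerivAt (fun y => p y - M) (fderiv ℝ p y) y :=
      ((hp.differentiable (by norm_num) y).hasFDerivAt).sub_const M
    exact ((hasDerivAt_sqp (p y - M)).comp_hasFDerivAt y h1).fderiv
  have hjac : ∀ y, jac f q y = (2 * max (p y - M) 0) * jac p q y := by
    intro y; simp only [jac, hfd, smul_apply, smul_eq_mul]; ring
  have hnn : ∀ y ∈ closedBall x ρ, 0 ≤ jac f q y := by
    intro y hy
    rw [hjac]
    have := hJ y hy
    have h2 := en_nonneg p q y
    have : 0 ≤ jac p q y := le_trans (by positivity) this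
    positivity
  have hL : stokesL f q x ρ = 0 := by
    unfold stokesL
    rw [intervalIntegral.integral_congr (g := fun _ => 0)]
    · simp
    · intro t ht
      rw [uIcc_of_le (by positivity)] at ht
      have := hM t ht
      simp only [hf, sqp]
      rw [max_eq_right (by linarith)]; simp
  rw [stokes_C1 f q hfc hq x hρ.le] at hL
  have hzero : ∀ s ∈ Icc 0 ρ, ∀ t ∈ Icc 0 (2 * π), s * jac f q (pol x s t) = 0 := by
    have ci : Continuous fun s : ℝ => ∫ t in (0:ℝ)..(2 * π), s * jac f q (pol x s t) := by
      simp only [intervalIntegral.integral_const_mul]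
      exact continuous_id.mul (continuous_innerInt (continuous_jac hfc hq) x)
    intro s hs t ht
    by_contra hne
    have hpos : ∀ s ∈ Icc 0 ρ, ∀ t, 0 ≤ s * jac f q (pol x s t) := fun s hs t =>
      mul_nonneg hs.1 (hnn _ (pol_mem hs.1 hs.2))
    have h1 : 0 < ∫ t in (0:ℝ)..(2 * π), s * jac f q (pol x s t) := by
      apply intervalIntegral.integral_pos (by positivity)
      · exact (continuous_const.mul ((continuous_jac hfc hq).comp (continuous_pol_snd x s))).continuousOn
      · intro t _; exact hpos s hs t
      · exact ⟨t, ht, lt_of_le_of_ne (hpos s hs t) (Ne.symm hne)⟩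
    have h2 : 0 < stokesR f q x ρ := by
      unfold stokesR
      apply intervalIntegral.integral_pos hρ ci.continuousOn
      · intro s hs
        exact intervalIntegral.integral_nonneg (by positivity) fun t _ => hpos s ⟨hs.1.le, hs.2⟩ t
      · exact ⟨s, hs, h1⟩
    linarith
  obtain ⟨s, t, hs0, hs, ht, rfl⟩ := exists_pol hy
  have e1 : f (pol x s t) = f (pol x ρ t) := by
    rcases hs.eq_or_lt with h | h
    · rw [h]
    · have hd : ∀ s', HasDerivAt (fun s' => f (pol x s' t)) (fderiv ℝ f (pol x s' t) (circPt t)) s' := by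
        intro s'
        have := ((hfc.differentiable (by norm_num) (pol x s' t)).hasFDerivAt).comp_hasDerivAt s' (hasDerivAt_pol_fst x s' t)
        exact this
      obtain ⟨ξ, hξ, h1⟩ := exists_hasDerivAt_eq_slope (fun s' => f (pol x s' t)) _ h
        (fun s' _ => (hd s').continuousAt.continuousWithinAt) (fun s' _ => hd s')
      have h3 : fderiv ℝ f (pol x ξ t) = 0 := by
        have hξ0 : 0 < ξ := lt_of_le_of_lt hs0 hξ.1
        have h4 := hzero ξ ⟨hξ0.le, hξ.2.le⟩ t ht
        have h5 : jac f q (pol x ξ t) = 0 := by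
          rcases mul_eq_zero.mp h4 with h | h
          · exact absurd h hξ0.ne'
          · exact h
        rw [hjac] at h5
        rw [hfd]
        rcases mul_eq_zero.mp h5 with h6 | h6
        · rw [h6, zero_smul]
        · have h7 := hJ _ (pol_mem (x := x) (t := t) hξ0.le hξ.2.le)
          rw [h6] at h7
          have h8 : en p q (pol x ξ t) ≤ 0 := by
            by_contra hh
            push Not at hh
            nlinarith [mul_pos hc hh]
          have h9 : fderiv ℝ p (pol x ξ t) = 0 := by
            unfold en at h8
            have a0 : fderiv ℝ p (pol x ξ t) ee0 = 0 := by
              apply pow_eq_zero_iff (two_ne_zero) |>.mp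
              nlinarith [sq_nonneg (fderiv ℝ p (pol x ξ t) ee0), sq_nonneg (fderiv ℝ p (pol x ξ t) ee1), sq_nonneg (fderiv ℝ q (pol x ξ t) ee0), sq_nonneg (fderiv ℝ q (pol x ξ t) ee1)]
            have a1 : fderiv ℝ p (pol x ξ t) ee1 = 0 := by
              apply pow_eq_zero_iff (two_ne_zero) |>.mp
              nlinarith [sq_nonneg (fderiv ℝ p (pol x ξ t) ee0), sq_nonneg (fderiv ℝ p (pol x ξ t) ee1), sq_nonneg (fderiv ℝ q (pol x ξ t) ee0), sq_nonneg (fderiv ℝ q (pol x ξ t) ee1)]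
            ext v
            rw [clm_decomp, a0, a1]; simp
          rw [h9, smul_zero]
      rw [h3] at h1
      have h10 : ρ - s ≠ 0 := by linarith
      rw [zero_apply, eq_div_iff h10, zero_mul] at h1
      linarith
  have e3 : f (pol x ρ t) = 0 := by
    have := hM t ht
    simp only [hf, sqp]
    rw [max_eq_right (by linarith)]; simp
  rw [e3] at e1
  simp only [hf, sqp] at e1
  have := pow_eq_zero_iff (two_ne_zero) |>.mp e1
  have := le_max_left (p (pol x s t) - M) 0
  linarith

lemma cs_interval {f : ℝ → ℝ} (hf : Continuous f) :
    (∫ t in (0:ℝ)..(2 * π), |f t|) ^ 2 ≤ 2 * π * ∫ t in (0:ℝ)..(2 * π), f t ^ 2 := by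
  set I := ∫ t in (0:ℝ)..(2 * π), |f t| with hI
  have hpi := Real.pi_pos
  set m := I / (2 * π) with hm
  have h0 : 0 ≤ ∫ t in (0:ℝ)..(2 * π), (|f t| - m) ^ 2 :=
    intervalIntegral.integral_nonneg (by positivity) fun t _ => sq_nonneg _
  have h1 : ∫ t in (0:ℝ)..(2 * π), (|f t| - m) ^ 2 = (∫ t in (0:ℝ)..(2 * π), f t ^ 2) - 2 * m * I + 2 * π * m ^ 2 := by
    have : ∀ t, (|f t| - m) ^ 2 = f t ^ 2 - 2 * m * |f t| + m ^ 2 := by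
      intro t; rw [← sq_abs (f t)]; ring
    simp only [this]
    rw [intervalIntegral.integral_add, intervalIntegral.integral_sub, intervalIntegral.integral_const_mul]
    · rw [← hI]; simp
    all_goals apply Continuous.intervalIntegrable; fun_prop
  have h2 : I = 2 * π * m := by rw [hm]; field_simp
  rw [h1] at h0
  have : I ^ 2 = 2 * π * (2 * m * I - 2 * π * m ^ 2) := by rw [h2]; ring
  rw [this]
  apply mul_le_mul_of_nonneg_left _ (by positivity)
  linarith

def pth (p : E2 → ℝ) (x : E2) (ρ t : ℝ) : ℝ := fderiv ℝ p (pol x ρ t) (ρ • tauPt t)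

lemma continuous_pth {p : E2 → ℝ} (hp : ContDiff ℝ 1 p) (x : E2) (ρ : ℝ) : Continuous (pth p x ρ) := by
  have h1 := (hp.continuous_fderiv (by norm_num)).comp (continuous_pol_snd x ρ)
  have := continuous_tauPt
  exact (h1.clm_apply (by fun_prop))

lemma pth_sq_le (p : E2 → ℝ) (x : E2) (ρ t : ℝ) :
    pth p x ρ t ^ 2 ≤ ρ ^ 2 * (fderiv ℝ p (pol x ρ t) ee0 ^ 2 + fderiv ℝ p (pol x ρ t) ee1 ^ 2) := by
  unfold pth
  rw [map_smul, smul_eq_mul, mul_pow]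
  apply mul_le_mul_of_nonneg_left _ (sq_nonneg _)
  rw [clm_decomp, tauPt_zero', tauPt_one']
  set a := fderiv ℝ p (pol x ρ t) ee0
  set b := fderiv ℝ p (pol x ρ t) ee1
  have := sin_sq_add_cos_sq t
  have e : a ^ 2 + b ^ 2 = (a ^ 2 + b ^ 2) * (sin t ^ 2 + cos t ^ 2) := by rw [this, mul_one]
  rw [e]
  nlinarith [sq_nonneg (a * cos t + b * sin t)]

def innE (p q : E2 → ℝ) (x : E2) (s : ℝ) : ℝ := ∫ t in (0:ℝ)..(2 * π), en p q (pol x s t)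
def Den (p q : E2 → ℝ) (x : E2) (ρ : ℝ) : ℝ := ∫ s in (0:ℝ)..ρ, s * innE p q x s

lemma innE_nonneg (p q : E2 → ℝ) (x : E2) (s : ℝ) : 0 ≤ innE p q x s :=
  intervalIntegral.integral_nonneg (by positivity) fun t _ => en_nonneg _ _ _


lemma hasDerivAt_pcirc {p : E2 → ℝ} (hp : ContDiff ℝ 1 p) (x : E2) (ρ t : ℝ) : HasDerivAt (fun t => p (pol x ρ t)) (pth p x ρ t) t := by
  have := ((hp.differentiable (by norm_num) (pol x ρ t)).hasFDerivAt).comp_hasDerivAt t (hasDerivAt_pol_snd x ρ t)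
  exact this

lemma osc_circ {p : E2 → ℝ} (hp : ContDiff ℝ 1 p) (x : E2) (ρ : ℝ) {t t' : ℝ} (ht : t ∈ Icc 0 (2 * π)) (ht' : t' ∈ Icc 0 (2 * π)) :
    |p (pol x ρ t) - p (pol x ρ t')| ≤ ∫ t in (0:ℝ)..(2 * π), |pth p x ρ t| := by
  wlog h : t' ≤ t generalizing t t'
  · rw [abs_sub_comm]; exact this ht' ht (le_of_not_ge h)
  have hc := continuous_pth hp x ρ
  have h1 := intervalIntegral.integral_eq_sub_of_hasDerivAt (a := t') (b := t)
    (fun s _ => hasDerivAt_pcirc hp x ρ s) (hc.intervalIntegrable _ _)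
  rw [← h1]
  refine (intervalIntegral.abs_integral_le_integral_abs h).trans ?_
  apply intervalIntegral.integral_mono_interval ht'.1 h ht.2
  · filter_upwards with s using abs_nonneg _
  · exact hc.abs.intervalIntegrable _ _

lemma int_pth_sq {p q : E2 → ℝ} (hp : ContDiff ℝ 1 p) (hq : ContDiff ℝ 1 q) (x : E2) (ρ : ℝ) : (∫ t in (0:ℝ)..(2 * π), |pth p x ρ t|) ^ 2 + (∫ t in (0:ℝ)..(2 * π), |pth q x ρ t|) ^ 2
    ≤ 2 * π * ρ ^ 2 * innE p q x ρ := by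
  have h1 := cs_interval (continuous_pth hp x ρ)
  have h2 := cs_interval (continuous_pth hq x ρ)
  have c1 := continuous_pth hp x ρ
  have c2 := continuous_pth hq x ρ
  have h3 : (∫ t in (0:ℝ)..(2 * π), pth p x ρ t ^ 2) + (∫ t in (0:ℝ)..(2 * π), pth q x ρ t ^ 2) ≤ ρ ^ 2 * innE p q x ρ := by
    unfold innE
    have i1 : IntervalIntegrable (fun t => pth p x ρ t ^ 2) MeasureTheory.volume 0 (2 * π) := (c1.pow 2).intervalIntegrable _ _
    have i2 : IntervalIntegrable (fun t => pth q x ρ t ^ 2) MeasureTheory.volume 0 (2 * π) := (c2.pow 2).intervalIntegrable _ _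
    rw [← intervalIntegral.integral_add i1 i2,
      ← intervalIntegral.integral_const_mul]
    apply intervalIntegral.integral_mono_on (by positivity)
    · exact ((c1.pow 2).add (c2.pow 2)).intervalIntegrable _ _
    · exact (continuous_const.mul ((continuous_en hp hq).comp (continuous_pol_snd x ρ))).intervalIntegrable _ _
    · intro t _
      have := pth_sq_le p x ρ t
      have := pth_sq_le q x ρ t
      unfold en
      linarith
  have hpi := Real.pi_pos
  nlinarith [mul_le_mul_of_nonneg_left h3 hpi.le]

lemma continuous_innE {p q : E2 → ℝ} (hp : ContDiff ℝ 1 p) (hq : ContDiff ℝ 1 q) (x : E2) : Continuous (innE p q x) := continuous_innerInt (continuous_en hp hq) x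

lemma hasDerivAt_Den {p q : E2 → ℝ} (hp : ContDiff ℝ 1 p) (hq : ContDiff ℝ 1 q) (x : E2) (ρ : ℝ) : HasDerivAt (Den p q x) (ρ * innE p q x ρ) ρ := by
  have hc : Continuous fun s => s * innE p q x s := continuous_id.mul (continuous_innE hp hq x)
  exact intervalIntegral.integral_hasDerivAt_right (hc.intervalIntegrable _ _)
    (hc.stronglyMeasurableAtFilter _ _) hc.continuousAt

lemma Den_zero {p q : E2 → ℝ} (x : E2) : Den p q x 0 = 0 := by simp [Den]

lemma Den_mono {p q : E2 → ℝ} (hp : ContDiff ℝ 1 p) (hq : ContDiff ℝ 1 q) (x : E2) {a b : ℝ} (ha : 0 ≤ a) (hab : a ≤ b) : Den p q x a ≤ Den p q x b := by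
  have : MonotoneOn (Den p q x) (Ici 0) := by
    apply monotoneOn_of_deriv_nonneg (convex_Ici 0)
    · exact fun s _ => (hasDerivAt_Den hp hq x s).continuousAt.continuousWithinAt
    · exact fun s _ => (hasDerivAt_Den hp hq x s).differentiableAt.differentiableWithinAt
    · intro s hs
      rw [interior_Ici] at hs
      rw [(hasDerivAt_Den hp hq x s).deriv]
      exact mul_nonneg (le_of_lt (mem_Ioi.mp hs)) (innE_nonneg _ _ _ _)
  exact this (mem_Ici.mpr ha) (mem_Ici.mpr (ha.trans hab)) hab

lemma Den_nonneg {p q : E2 → ℝ} (hp : ContDiff ℝ 1 p) (hq : ContDiff ℝ 1 q) (x : E2) {a : ℝ} (ha : 0 ≤ a) : 0 ≤ Den p q x a := by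
  have := Den_mono hp hq x le_rfl ha
  rwa [Den_zero] at this

lemma Den_le_stokes {p q : E2 → ℝ} (hp : ContDiff ℝ 1 p) (hq : ContDiff ℝ 1 q) (x : E2) {c ρ : ℝ} (hρ : 0 ≤ ρ)
    (hJ : ∀ y ∈ closedBall x ρ, c * en p q y ≤ jac p q y) : c * Den p q x ρ ≤ stokesR p q x ρ := by
  unfold Den stokesR
  rw [← intervalIntegral.integral_const_mul]
  have ci : Continuous fun s : ℝ => ∫ t in (0:ℝ)..(2 * π), s * jac p q (pol x s t) := by
    simp only [intervalIntegral.integral_const_mul]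
    exact continuous_id.mul (continuous_innerInt (continuous_jac hp hq) x)
  apply intervalIntegral.integral_mono_on hρ
  · exact (continuous_const.mul (continuous_id.mul (continuous_innE hp hq x))).intervalIntegrable _ _
  · exact ci.intervalIntegrable _ _
  · intro s hs
    unfold innE
    rw [← mul_assoc, ← intervalIntegral.integral_const_mul]
    apply intervalIntegral.integral_mono_on (by positivity)
    · exact (continuous_const.mul ((continuous_en hp hq).comp (continuous_pol_snd x s))).intervalIntegrable _ _
    · exact (continuous_const.mul ((continuous_jac hp hq).comp (continuous_pol_snd x s))).intervalIntegrable _ _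
    · intro t _
      have := mul_le_mul_of_nonneg_left (hJ _ (pol_mem (x := x) (t := t) hs.1 hs.2)) hs.1
      linarith

lemma stokes_bound {p q : E2 → ℝ} (hp : ContDiff ℝ 1 p) (hq : ContDiff ℝ 1 q) (x : E2) {k O ρ : ℝ} (hρ : 0 ≤ ρ) (hO : ∀ t ∈ Icc 0 (2 * π), |p (pol x ρ t) - k| ≤ O) :
    stokesR p q x ρ ≤ O * ∫ t in (0:ℝ)..(2 * π), |pth q x ρ t| := by
  have h0 : stokesR (fun y => p y - k) q x ρ = stokesR p q x ρ := by
    unfold stokesR jac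
    simp only [fderiv_sub_const]
  have hpk : ContDiff ℝ 1 (fun y => p y - k) := hp.sub contDiff_const
  rw [← h0, ← stokes_C1 _ q hpk hq x hρ]
  unfold stokesL
  rw [← intervalIntegral.integral_const_mul]
  apply intervalIntegral.integral_mono_on (by positivity)
  · exact (stokesL_integrand_cont hpk hq x ρ).intervalIntegrable _ _
  · exact (continuous_const.mul (continuous_pth hq x ρ).abs).intervalIntegrable _ _
  · intro t ht
    refine (le_abs_self _).trans ?_
    rw [abs_mul]
    exact mul_le_mul_of_nonneg_right (hO t ht) (abs_nonneg _)

lemma Den_growth {p q : E2 → ℝ} (hp : ContDiff ℝ 1 p) (hq : ContDiff ℝ 1 q) (x : E2) {c ρ : ℝ} (hρ : 0 ≤ ρ)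
    (hJ : ∀ y ∈ closedBall x ρ, c * en p q y ≤ jac p q y) : c * Den p q x ρ ≤ π * ρ ^ 2 * innE p q x ρ := by
  have h1 := Den_le_stokes hp hq x hρ hJ
  have h2 := stokes_bound hp hq x hρ (k := p (pol x ρ 0)) (fun t ht => osc_circ hp x ρ ht ⟨le_rfl, by positivity⟩)
  have h3 := int_pth_sq hp hq x ρ
  nlinarith [sq_nonneg ((∫ t in (0:ℝ)..(2 * π), |pth p x ρ t|) - (∫ t in (0:ℝ)..(2 * π), |pth q x ρ t|))]

lemma Den_power {p q : E2 → ℝ} (hp : ContDiff ℝ 1 p) (hq : ContDiff ℝ 1 q) (x : E2) {c R : ℝ}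
    (hJ : ∀ y ∈ closedBall x R, c * en p q y ≤ jac p q y) {a b : ℝ} (ha : 0 < a) (hab : a ≤ b) (hb : b ≤ R) :
    Den p q x a ≤ (a / b) ^ (c / π) * Den p q x b := by
  have hpi := Real.pi_pos
  set γ := c / π with hγ
  have hmono : MonotoneOn (fun ρ => ρ ^ (-γ) * Den p q x ρ) (Icc a b) := by
    have hd : ∀ ρ ∈ Icc a b, HasDerivAt (fun ρ => ρ ^ (-γ) * Den p q x ρ)
        ((-γ * ρ ^ (-γ - 1)) * Den p q x ρ + ρ ^ (-γ) * (ρ * innE p q x ρ)) ρ := fun ρ hρ =>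
      (Real.hasDerivAt_rpow_const (Or.inl (by linarith [hρ.1]))).mul (hasDerivAt_Den hp hq x ρ)
    apply monotoneOn_of_deriv_nonneg (convex_Icc a b)
    · exact fun s hs => (hd s hs).continuousAt.continuousWithinAt
    · intro s hs
      rw [interior_Icc] at hs
      exact (hd s ⟨hs.1.le, hs.2.le⟩).differentiableAt.differentiableWithinAt
    · intro s hs
      rw [interior_Icc] at hs
      have hs0 : 0 < s := ha.trans hs.1
      rw [(hd s ⟨hs.1.le, hs.2.le⟩).deriv]
      have hg := Den_growth hp hq x hs0.le (fun y hy => hJ y (closedBall_subset_closedBall (hs.2.le.trans hb) hy))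
      have e : s ^ (-γ) = s ^ (-γ - 1) * s := by
        rw [← Real.rpow_add_one hs0.ne']; congr 1; ring
      rw [e]
      have h1 : γ * Den p q x s ≤ s ^ 2 * innE p q x s := by
        rw [hγ, div_mul_eq_mul_div, div_le_iff₀ hpi]; linarith
      have h2 : 0 ≤ s ^ (-γ - 1) := by positivity
      nlinarith [mul_le_mul_of_nonneg_left h1 h2]
  have hb0 : 0 < b := ha.trans_le hab
  have := hmono ⟨le_rfl, hab⟩ ⟨hab, le_rfl⟩ hab
  simp only at this
  rw [Real.div_rpow ha.le hb0.le]
  rw [Real.rpow_neg ha.le, Real.rpow_neg hb0.le] at this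
  have h1 : 0 < a ^ γ := by positivity
  have h2 : 0 < b ^ γ := by positivity
  rw [div_mul_eq_mul_div, le_div_iff₀ h2]
  have := mul_le_mul_of_nonneg_left this (mul_pos h1 h2).le
  field_simp at this
  linarith

lemma Den_half {p q : E2 → ℝ} (hp : ContDiff ℝ 1 p) (hq : ContDiff ℝ 1 q) (x : E2) {c R O : ℝ} (hR : 0 < R) (hc : 0 < c)
    (hJ : ∀ y ∈ closedBall x R, c * en p q y ≤ jac p q y) (hO : ∀ y ∈ closedBall x R, |p y| ≤ O) :
    Den p q x (R / 2) ≤ 4 * π * O ^ 2 / c ^ 2 := by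
  have hpi := Real.pi_pos
  by_contra hcon
  push Not at hcon
  set d := Den p q x (R / 2) with hd
  have hO0 : 0 ≤ O := (abs_nonneg _).trans (hO x (mem_closedBall_self hR.le))
  have hd0 : 0 < d := lt_of_le_of_lt (by positivity) hcon
  have hkey : ∀ ρ ∈ Icc (R / 2) R, c ^ 2 * Den p q x ρ ^ 2 ≤ 2 * π * O ^ 2 * R * (ρ * innE p q x ρ) := by
    intro ρ hρ
    have hρ0 : 0 < ρ := by linarith [hρ.1]
    have h1 := Den_le_stokes hp hq x hρ0.le (fun y hy => hJ y (closedBall_subset_closedBall hρ.2 hy))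
    have h2 := stokes_bound hp hq x hρ0.le (k := 0) (O := O) (fun t ht => by
      rw [sub_zero]; exact hO _ (pol_mem hρ0.le hρ.2))
    have h3 := int_pth_sq hp hq x ρ
    have h4 := Den_nonneg hp hq x hρ0.le
    set I := ∫ t in (0:ℝ)..(2 * π), |pth q x ρ t|
    have h5 : (c * Den p q x ρ) ^ 2 ≤ (O * I) ^ 2 := pow_le_pow_left₀ (by positivity) (h1.trans h2) 2
    have h6 : I ^ 2 ≤ 2 * π * ρ ^ 2 * innE p q x ρ := by nlinarith [sq_nonneg (∫ t in (0:ℝ)..(2 * π), |pth p x ρ t|)]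
    have h7 : 2 * π * ρ ^ 2 * innE p q x ρ ≤ 2 * π * R * (ρ * innE p q x ρ) := by
      have : 0 ≤ π * (ρ * innE p q x ρ) := mul_nonneg hpi.le (mul_nonneg hρ0.le (innE_nonneg _ _ _ _))
      nlinarith [mul_le_mul_of_nonneg_left hρ.2 this]
    have h8 := mul_le_mul_of_nonneg_left (h6.trans h7) (sq_nonneg O)
    nlinarith
  have hmono : MonotoneOn (fun ρ => -(2 * π * O ^ 2 * R) * (Den p q x ρ)⁻¹ - c ^ 2 * ρ) (Icc (R / 2) R) := by
    have hpos : ∀ ρ ∈ Icc (R / 2) R, 0 < Den p q x ρ := fun ρ hρ =>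
      hd0.trans_le (Den_mono hp hq x (by linarith) hρ.1)
    have hdv : ∀ ρ ∈ Icc (R / 2) R, HasDerivAt (fun ρ => -(2 * π * O ^ 2 * R) * (Den p q x ρ)⁻¹ - c ^ 2 * ρ)
        (-(2 * π * O ^ 2 * R) * (-(ρ * innE p q x ρ) / (Den p q x ρ) ^ 2) - c ^ 2 * 1) ρ := fun ρ hρ =>
      (((hasDerivAt_Den hp hq x ρ).inv (hpos ρ hρ).ne').const_mul _).sub ((hasDerivAt_id ρ).const_mul _)
    apply monotoneOn_of_deriv_nonneg (convex_Icc _ _)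
    · exact fun s hs => (hdv s hs).continuousAt.continuousWithinAt
    · intro s hs
      rw [interior_Icc] at hs
      exact (hdv s ⟨hs.1.le, hs.2.le⟩).differentiableAt.differentiableWithinAt
    · intro s hs
      rw [interior_Icc] at hs
      have hs' : s ∈ Icc (R / 2) R := ⟨hs.1.le, hs.2.le⟩
      rw [(hdv s hs').deriv]
      have h1 := hkey s hs'
      have h2 := hpos s hs'
      have h3 : c ^ 2 ≤ 2 * π * O ^ 2 * R * (s * innE p q x s) / Den p q x s ^ 2 := by
        rw [le_div_iff₀ (by positivity)]; exact h1
      have e : -(2 * π * O ^ 2 * R) * (-(s * innE p q x s) / (Den p q x s) ^ 2) = 2 * π * O ^ 2 * R * (s * innE p q x s) / Den p q x s ^ 2 := by ring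
      rw [e]; linarith
  have := hmono ⟨le_rfl, by linarith⟩ ⟨by linarith, le_rfl⟩ (by linarith : R / 2 ≤ R)
  simp only at this
  have hDR : 0 ≤ (Den p q x R)⁻¹ := inv_nonneg.mpr (Den_nonneg hp hq x hR.le)
  have h1 : c ^ 2 * (R / 2) ≤ 2 * π * O ^ 2 * R * d⁻¹ := by
    have : 0 ≤ 2 * π * O ^ 2 * R * (Den p q x R)⁻¹ := by positivity
    rw [← hd] at *
    linarith
  rw [← div_eq_mul_inv, le_div_iff₀ hd0] at h1
  rw [div_lt_iff₀ (by positivity)] at hcon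
  nlinarith

lemma osc_Den {p q : E2 → ℝ} (hp : ContDiff ℝ 1 p) (hq : ContDiff ℝ 1 q) (x : E2) {c r : ℝ} (hr : 0 < r) (hc : 0 < c)
    (hJ : ∀ y ∈ closedBall x (2 * r), c * en p q y ≤ jac p q y) {y y' : E2}
    (hy : y ∈ closedBall x r) (hy' : y' ∈ closedBall x r) :
    (p y - p y') ^ 2 ≤ 4 * π * Den p q x (2 * r) := by
  have hpi := Real.pi_pos
  wlog hwl : p y' ≤ p y generalizing y y'
  · have := this hy' hy (le_of_not_ge hwl)
    nlinarith
  set o := p y - p y' with ho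
  have ho0 : 0 ≤ o := by linarith
  have hkey : ∀ ρ ∈ Icc r (2 * r), o ^ 2 ≤ 2 * π * ρ ^ 2 * innE p q x ρ := by
    intro ρ hρ
    have hρ0 : 0 < ρ := hr.trans_le hρ.1
    have hJ' : ∀ y ∈ closedBall x ρ, c * en p q y ≤ jac p q y := fun y hy => hJ y (closedBall_subset_closedBall hρ.2 hy)
    have hcomp : IsCompact (Icc (0:ℝ) (2 * π)) := isCompact_Icc
    have hne : (Icc (0:ℝ) (2 * π)).Nonempty := ⟨0, le_rfl, by positivity⟩
    have hcont : Continuous fun t => p (pol x ρ t) := hp.continuous.comp (continuous_pol_snd x ρ)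
    obtain ⟨t1, ht1, hM⟩ := hcomp.exists_isMaxOn hne hcont.continuousOn
    obtain ⟨t2, ht2, hm⟩ := hcomp.exists_isMinOn hne hcont.continuousOn
    have h1 : p y ≤ p (pol x ρ t1) := maxprinc hp hq hρ0 hc hJ' (fun t ht => hM ht)
      (closedBall_subset_closedBall hρ.1 hy)
    have h2 : -p y' ≤ -p (pol x ρ t2) := by
      have hpn : ContDiff ℝ 1 (fun y => -p y) := hp.neg
      have hqn : ContDiff ℝ 1 (fun y => -q y) := hq.neg
      refine maxprinc (p := fun y => -p y) (q := fun y => -q y) hpn hqn hρ0 hc ?_ (fun t ht => neg_le_neg (hm ht))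
        (closedBall_subset_closedBall hρ.1 hy')
      intro y hy
      have := hJ' y hy
      simp only [en, jac, fderiv_fun_neg, neg_apply] at this ⊢
      nlinarith
    have h3 := osc_circ hp x ρ ht1 ht2
    have h4 : o ≤ ∫ t in (0:ℝ)..(2 * π), |pth p x ρ t| := by
      have := le_abs_self (p (pol x ρ t1) - p (pol x ρ t2))
      linarith
    have h5 := int_pth_sq hp hq x ρ
    have := pow_le_pow_left₀ ho0 h4 2
    nlinarith [sq_nonneg (∫ t in (0:ℝ)..(2 * π), |pth q x ρ t|)]
  have hmono : MonotoneOn (fun ρ => 4 * π * Den p q x ρ - o ^ 2 / r * ρ) (Icc r (2 * r)) := by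
    have hdv : ∀ ρ, HasDerivAt (fun ρ => 4 * π * Den p q x ρ - o ^ 2 / r * ρ) (4 * π * (ρ * innE p q x ρ) - o ^ 2 / r * 1) ρ := fun ρ =>
      ((hasDerivAt_Den hp hq x ρ).const_mul _).sub ((hasDerivAt_id ρ).const_mul _)
    apply monotoneOn_of_deriv_nonneg (convex_Icc _ _)
    · exact fun s hs => (hdv s).continuousAt.continuousWithinAt
    · exact fun s hs => (hdv s).differentiableAt.differentiableWithinAt
    · intro s hs
      rw [interior_Icc] at hs
      rw [(hdv s).deriv, mul_one, sub_nonneg, div_le_iff₀ hr]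
      have h1 := hkey s ⟨hs.1.le, hs.2.le⟩
      have : 0 ≤ π * (s * innE p q x s) := mul_nonneg hpi.le (mul_nonneg (hr.trans hs.1).le (innE_nonneg _ _ _ _))
      nlinarith [mul_le_mul_of_nonneg_left hs.2.le this]
  have := hmono ⟨le_rfl, by linarith⟩ ⟨by linarith, le_rfl⟩ (by linarith : r ≤ 2 * r)
  simp only at this
  have h1 := Den_nonneg hp hq x hr.le
  have e : o ^ 2 / r * (2 * r) = 2 * o ^ 2 := by field_simp
  have e' : o ^ 2 / r * r = o ^ 2 := by field_simp
  rw [e, e'] at this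
  nlinarith [mul_nonneg hpi.le h1]

/-- Hölder decay for the first component. -/
lemma lemmaQ {p q : E2 → ℝ} (hp : ContDiff ℝ 1 p) (hq : ContDiff ℝ 1 q) (x : E2) {c R O : ℝ} (hR : 0 < R) (hc : 0 < c) (hc1 : c ≤ 1)
    (hJ : ∀ y ∈ closedBall x R, c * en p q y ≤ jac p q y) (hO : ∀ y ∈ closedBall x R, |p y| ≤ O)
    {r : ℝ} (hr : 0 < r) (hrR : r ≤ R) {y y' : E2}
    (hy : y ∈ closedBall x r) (hy' : y' ∈ closedBall x r) :
    |p y - p y'| ≤ 4 * π / c * O * (4 * r / R) ^ (c / (2 * π)) := by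
  have hpi := Real.pi_pos
  have hO0 : 0 ≤ O := (abs_nonneg _).trans (hO x (mem_closedBall_self hR.le))
  by_cases h4 : 4 * r ≤ R
  · have h1 := osc_Den hp hq x hr hc (fun y hy => hJ y (closedBall_subset_closedBall (by linarith) hy)) hy hy'
    have h2 := Den_power hp hq x hJ (a := 2 * r) (b := R / 2) (by linarith) (by linarith) (by linarith)
    have h3 := Den_half hp hq x hR hc hJ hO
    apply abs_le_of_sq_le_sq _ (by positivity)
    have e : 2 * r / (R / 2) = 4 * r / R := by field_simp; try ring
    rw [e] at h2
    have e2 : ((4 * r / R) ^ (c / (2 * π))) ^ 2 = (4 * r / R) ^ (c / π) := by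
      rw [← Real.rpow_natCast, ← Real.rpow_mul (by positivity)]
      congr 1; push_cast; field_simp
    rw [mul_pow, e2]
    have h5 : 0 ≤ (4 * r / R) ^ (c / π) := by positivity
    have h6 := mul_le_mul_of_nonneg_left h3 h5
    have h7 := mul_le_mul_of_nonneg_left (h2.trans h6) (by positivity : 0 ≤ 4 * π)
    refine h1.trans (h7.trans (le_of_eq ?_))
    field_simp
    try ring
  · push Not at h4
    have h1 : 1 ≤ (4 * r / R) ^ (c / (2 * π)) := by
      apply Real.one_le_rpow _ (by positivity)
      rw [le_div_iff₀ hR]; linarith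
    have h2 : |p y - p y'| ≤ 2 * O := by
      have := hO y (closedBall_subset_closedBall hrR hy)
      have := hO y' (closedBall_subset_closedBall hrR hy')
      have := abs_sub (p y) (p y')
      linarith
    have h3 : 2 ≤ 4 * π / c := by
      rw [le_div_iff₀ hc]; nlinarith [Real.pi_gt_three]
    have h5 : 2 * O ≤ 4 * π / c * O := mul_le_mul_of_nonneg_right h3 hO0
    have h6 : 0 ≤ 4 * π / c * O := by positivity
    nlinarith

abbrev Bil : Type := E2 →L[ℝ] E2 →L[ℝ] ℝ

def Cone (c : ℝ) (B : Bil) : Prop :=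
  c * (B ee0 ee0 ^ 2 + B ee0 ee1 ^ 2 + B ee1 ee0 ^ 2 + B ee1 ee1 ^ 2) ≤ B ee0 ee1 * B ee1 ee0 - B ee0 ee0 * B ee1 ee1

lemma clm_norm_le (L : E2 →L[ℝ] ℝ) : ‖L‖ ≤ |L ee0| + |L ee1| := by
  apply ContinuousLinearMap.opNorm_le_bound _ (by positivity)
  intro v
  have h := E2_norm_sq v
  have h0 : |v 0| ≤ ‖v‖ := by
    apply abs_le_of_sq_le_sq _ (norm_nonneg _); nlinarith [sq_nonneg (v 1)]
  have h1 : |v 1| ≤ ‖v‖ := by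
    apply abs_le_of_sq_le_sq _ (norm_nonneg _); nlinarith [sq_nonneg (v 0)]
  rw [clm_decomp L v, Real.norm_eq_abs]
  refine (abs_add_le _ _).trans ?_
  rw [abs_mul, abs_mul, add_mul]
  nlinarith [mul_le_mul_of_nonneg_right h0 (abs_nonneg (L ee0)), mul_le_mul_of_nonneg_right h1 (abs_nonneg (L ee1))]

lemma fderiv_fderiv_apply {w : E2 → ℝ} (hw : ContDiff ℝ 2 w) (y v e : E2) :
    fderiv ℝ (fun z => fderiv ℝ w z e) y v = fderiv ℝ (fderiv ℝ w) y v e := by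
  have hd : ContDiff ℝ 1 (fderiv ℝ w) := hw.fderiv_right (by norm_num)
  have h1 := ((hd.differentiable (by norm_num) y).hasFDerivAt).clm_apply (hasFDerivAt_const e y)
  rw [h1.fderiv]; simp

lemma abs_apply_ee_le (L : E2 →L[ℝ] ℝ) : |L ee0| ≤ ‖L‖ ∧ |L ee1| ≤ ‖L‖ := by
  constructor
  · simpa [norm_ee0] using L.le_opNorm ee0
  · simpa [norm_ee1] using L.le_opNorm ee1

lemma grad_holder {c : ℝ} (hc : 0 < c) (hc1 : c ≤ 1) {w : E2 → ℝ} (hw : ContDiff ℝ 2 w) {x : E2} {R O : ℝ} (hR : 0 < R)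
    (hC : ∀ y ∈ closedBall x R, Cone c (fderiv ℝ (fderiv ℝ w) y))
    (hO : ∀ y ∈ closedBall x R, ‖fderiv ℝ w y‖ ≤ O) {r : ℝ} (hr : 0 < r) (hrR : r ≤ R) {y y' : E2}
    (hy : y ∈ closedBall x r) (hy' : y' ∈ closedBall x r) :
    ‖fderiv ℝ w y - fderiv ℝ w y'‖ ≤ 8 * π / c * O * (4 * r / R) ^ (c / (2 * π)) := by
  have hd : ContDiff ℝ 1 (fderiv ℝ w) := hw.fderiv_right (by norm_num)
  set p : E2 → ℝ := fun z => fderiv ℝ w z ee0 with hp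
  set q : E2 → ℝ := fun z => fderiv ℝ w z ee1 with hq
  have hpc : ContDiff ℝ 1 p := hd.clm_apply contDiff_const
  have hqc : ContDiff ℝ 1 q := hd.clm_apply contDiff_const
  have fp : ∀ y v, fderiv ℝ p y v = fderiv ℝ (fderiv ℝ w) y v ee0 := fun y v => fderiv_fderiv_apply hw y v ee0
  have fq : ∀ y v, fderiv ℝ q y v = fderiv ℝ (fderiv ℝ w) y v ee1 := fun y v => fderiv_fderiv_apply hw y v ee1
  have h1 : |p y - p y'| ≤ 4 * π / c * O * (4 * r / R) ^ (c / (2 * π)) := by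
    refine lemmaQ hpc (q := fun z => -q z) hqc.neg x hR hc hc1 ?_ ?_ hr hrR hy hy'
    · intro y hy
      have := hC y hy
      simp only [en, jac, fderiv_fun_neg, neg_apply, fp, fq, Cone] at this ⊢
      linarith
    · intro y hy; exact (abs_apply_ee_le _).1.trans (hO y hy)
  have h2 : |q y - q y'| ≤ 4 * π / c * O * (4 * r / R) ^ (c / (2 * π)) := by
    refine lemmaQ hqc (q := p) hpc x hR hc hc1 ?_ ?_ hr hrR hy hy'
    · intro y hy
      have := hC y hy
      simp only [en, jac, fp, fq, Cone] at this ⊢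
      linarith
    · intro y hy; exact (abs_apply_ee_le _).2.trans (hO y hy)
  refine (clm_norm_le _).trans ?_
  simp only [sub_apply]
  have e : 8 * π / c * O * (4 * r / R) ^ (c / (2 * π)) = 4 * π / c * O * (4 * r / R) ^ (c / (2 * π)) + 4 * π / c * O * (4 * r / R) ^ (c / (2 * π)) := by ring
  rw [e]
  exact add_le_add h1 h2

lemma lin_approx {w : E2 → ℝ} (hw : ContDiff ℝ 1 w) {y v : E2} {h δ : ℝ} (hh : 0 ≤ h) (hv : ‖v‖ ≤ 1)
    (hD : ∀ z ∈ closedBall y h, ‖fderiv ℝ w z - fderiv ℝ w y‖ ≤ δ) :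
    |w (y + h • v) - w y - h * fderiv ℝ w y v| ≤ δ * h := by
  have hδ : 0 ≤ δ := (norm_nonneg _).trans (hD y (mem_closedBall_self hh))
  have := (convex_closedBall y h).norm_image_sub_le_of_norm_hasFDerivWithin_le'
    (f := w) (f' := fderiv ℝ w) (φ := fderiv ℝ w y) (C := δ)
    (fun z _ => (hw.differentiable (by norm_num) z).hasFDerivAt.hasFDerivWithinAt) hD
    (mem_closedBall_self hh) (y := y + h • v) (by
      rw [mem_closedBall, dist_eq_norm, add_sub_cancel_left, norm_smul, Real.norm_of_nonneg hh]
      nlinarith)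
  rw [add_sub_cancel_left, map_smul, smul_eq_mul, norm_smul, Real.norm_of_nonneg hh, Real.norm_eq_abs] at this
  refine this.trans ?_
  have : h * ‖v‖ ≤ h := by nlinarith
  nlinarith

lemma lemmaI {c : ℝ} (hc : 0 < c) (hc1 : c ≤ 1) : ∃ C : ℝ, 1 ≤ C ∧ ∀ (w : E2 → ℝ) (x : E2) (R S : ℝ),
    ContDiff ℝ 2 w → 0 < R → (∀ y ∈ closedBall x R, Cone c (fderiv ℝ (fderiv ℝ w) y)) →
    (∀ y ∈ closedBall x R, |w y| ≤ S) →
    (∀ y ∈ closedBall x (R / 2), ‖fderiv ℝ w y‖ ≤ C * S / R) ∧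
    (∀ y ∈ closedBall x (R / 4), ∀ y' ∈ closedBall x (R / 4),
      ‖fderiv ℝ w y - fderiv ℝ w y'‖ ≤ C * S / R * (‖y - y'‖ / R) ^ (c / (2 * π))) := by
  have hpi := Real.pi_pos
  set β := c / (2 * π) with hβ
  have hβ0 : 0 < β := by positivity
  set K := 8 * π / c with hK
  have hK0 : 0 < K := by positivity
  have hK2 : 2 ≤ K := by
    rw [hK, le_div_iff₀ hc]; nlinarith [Real.pi_gt_three]
  -- choose σ
  set σ := (1 / (4 * K)) ^ (1 / β) / 4 with hσ
  have hσ0 : 0 < σ := by positivity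
  have hσ1 : σ ≤ 1 := by
    have : (1 / (4 * K)) ^ (1 / β) ≤ 1 := by
      apply Real.rpow_le_one (by positivity) _ (by positivity)
      rw [div_le_one (by positivity)]; linarith
    linarith
  have hσK : (4 * σ) ^ β = 1 / (4 * K) := by
    have : 4 * σ = (1 / (4 * K)) ^ (1 / β) := by rw [hσ]; ring
    rw [this, ← Real.rpow_mul (by positivity), one_div_mul_cancel hβ0.ne', Real.rpow_one]
  refine ⟨K * (16 / σ) * 16 ^ β, ?_, ?_⟩
  · have h1 : 1 ≤ (16:ℝ) ^ β := Real.one_le_rpow (by norm_num) hβ0.le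
    have h2 : 1 ≤ 16 / σ := by rw [le_div_iff₀ hσ0]; linarith
    have : 1 ≤ K * (16 / σ) := by nlinarith
    nlinarith
  intro w x R S hw hR hC hS
  have hw1 : ContDiff ℝ 1 w := hw.of_le (by norm_num)
  have hS0 : 0 ≤ S := (abs_nonneg _).trans (hS x (mem_closedBall_self hR.le))
  have hcd : Continuous (fderiv ℝ w) := hw.continuous_fderiv (by norm_num)
  have hmain : ∀ y ∈ closedBall x R, (R - dist y x) * ‖fderiv ℝ w y‖ ≤ 8 * S / σ := by
    obtain ⟨y0, hy0, hmax⟩ := (isCompact_closedBall x R).exists_isMaxOn ⟨x, mem_closedBall_self hR.le⟩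
      (f := fun y => (R - dist y x) * ‖fderiv ℝ w y‖) (by fun_prop)
    set m := (R - dist y0 x) * ‖fderiv ℝ w y0‖ with hm
    suffices m ≤ 8 * S / σ from fun y hy => (hmax hy).trans this
    set d := R - dist y0 x with hd
    have hd0 : 0 ≤ d := by rw [mem_closedBall] at hy0; linarith
    rcases hd0.eq_or_lt with h0 | h0
    · rw [hm, ← h0, zero_mul]; positivity
    have hsub : closedBall y0 (d / 2) ⊆ closedBall x R := by
      apply closedBall_subset_closedBall'; linarith
    have hO : ∀ y ∈ closedBall y0 (d / 2), ‖fderiv ℝ w y‖ ≤ 2 * m / d := by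
      intro y hy
      have h1 := hmax (hsub hy)
      simp only [mem_ofPred_eq] at h1
      rw [mem_closedBall] at hy
      have h2 : d / 2 ≤ R - dist y x := by linarith [dist_triangle y y0 x]
      rw [le_div_iff₀ h0]
      have := mul_le_mul_of_nonneg_right h2 (norm_nonneg (fderiv ℝ w y))
      have h3 : (R - dist y x) * ‖fderiv ℝ w y‖ ≤ m := h1
      linarith
    set h := σ * (d / 2) with hh
    have hh0 : 0 < h := by positivity
    have hhd : h ≤ d / 2 := by rw [hh]; nlinarith
    have hHol : ∀ z ∈ closedBall y0 h, ‖fderiv ℝ w z - fderiv ℝ w y0‖ ≤ m / (2 * d) := by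
      intro z hz
      have := grad_holder hc hc1 hw (by positivity) (fun y hy => hC y (hsub hy)) hO hh0 hhd hz (mem_closedBall_self hh0.le)
      have e : 4 * h / (d / 2) = 4 * σ := by rw [hh]; field_simp
      rw [e, hσK] at this
      refine this.trans (le_of_eq ?_)
      rw [← hK]; field_simp; ring
    have hn : ‖fderiv ℝ w y0‖ ≤ 2 * S / h + m / (2 * d) := by
      have hm0 : 0 ≤ m := by positivity
      apply ContinuousLinearMap.opNorm_le_of_unit_norm (by positivity)
      intro v hv
      have h1 := lin_approx hw1 hh0.le hv.le hHol
      have h2 := hS y0 hy0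
      have h3 := hS (y0 + h • v) (hsub (by
        rw [mem_closedBall, dist_eq_norm, add_sub_cancel_left, norm_smul, hv, Real.norm_of_nonneg hh0.le]; linarith))
      rw [Real.norm_eq_abs]
      have h4 : |h * fderiv ℝ w y0 v| ≤ 2 * S + m / (2 * d) * h := by
        rw [abs_le] at *
        constructor <;> linarith
      rw [abs_mul, abs_of_pos hh0] at h4
      have e : 2 * S / h + m / (2 * d) = (2 * S + m / (2 * d) * h) / h := by field_simp
      rw [e, le_div_iff₀ hh0]; linarith
    have e1 : ‖fderiv ℝ w y0‖ = m / d := by rw [hm]; field_simp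
    rw [e1] at hn
    have e2 : 2 * S / h = 4 * S / (σ * d) := by rw [hh]; field_simp; ring
    rw [e2, div_le_iff₀ h0] at hn
    have e3 : (4 * S / (σ * d) + m / (2 * d)) * d = 4 * S / σ + m / 2 := by field_simp
    rw [e3] at hn
    have : 8 * S / σ = 2 * (4 * S / σ) := by ring
    linarith
  have hgrad : ∀ y ∈ closedBall x (R / 2), ‖fderiv ℝ w y‖ ≤ 16 / σ * S / R := by
    intro y hy
    have h1 := hmain y (closedBall_subset_closedBall (by linarith) hy)
    rw [mem_closedBall] at hy
    rw [le_div_iff₀ hR]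
    have h2 : R / 2 * ‖fderiv ℝ w y‖ ≤ (R - dist y x) * ‖fderiv ℝ w y‖ := by
      apply mul_le_mul_of_nonneg_right _ (norm_nonneg _); linarith
    have : 16 / σ * S = 2 * (8 * S / σ) := by ring
    linarith
  have h16 : 1 ≤ (16:ℝ) ^ β := Real.one_le_rpow (by norm_num) hβ0.le
  have hA : 0 ≤ 16 / σ * S / R := by positivity
  constructor
  · intro y hy
    refine (hgrad y hy).trans ?_
    have : K * (16 / σ) * 16 ^ β * S / R = (K * 16 ^ β) * (16 / σ * S / R) := by ring
    rw [this]
    have : 1 ≤ K * 16 ^ β := by nlinarith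
    nlinarith
  · intro y hy y' hy'
    have e : K * (16 / σ) * 16 ^ β * S / R * (‖y - y'‖ / R) ^ β = K * (16 / σ * S / R) * (16 * ‖y - y'‖ / R) ^ β := by
      rw [mul_div_assoc 16, Real.mul_rpow (by norm_num) (by positivity)]; ring
    rw [e]
    by_cases hyy : y = y'
    · subst hyy; simp only [sub_self, norm_zero]; positivity
    have hr0 : 0 < ‖y - y'‖ := norm_pos_iff.mpr (sub_ne_zero.mpr hyy)
    by_cases hr : ‖y - y'‖ ≤ R / 4
    · have hs : closedBall y (R / 4) ⊆ closedBall x (R / 2) := by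
        apply closedBall_subset_closedBall'; rw [mem_closedBall] at hy; linarith
      have := grad_holder hc hc1 hw (x := y) (R := R / 4) (by positivity)
        (fun z hz => hC z (closedBall_subset_closedBall (by linarith) (hs hz))) (fun z hz => hgrad z (hs hz)) hr0 hr
        (mem_closedBall_self hr0.le) (y' := y') (by rw [mem_closedBall, dist_comm, dist_eq_norm])
      have e : 4 * ‖y - y'‖ / (R / 4) = 16 * ‖y - y'‖ / R := by field_simp; norm_num
      rw [e] at this
      exact this
    · push Not at hr
      have h1 : 1 ≤ (16 * ‖y - y'‖ / R) ^ β := by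
        apply Real.one_le_rpow _ hβ0.le
        rw [le_div_iff₀ hR]; linarith
      have a1 := hgrad y (closedBall_subset_closedBall (by linarith) hy)
      have a2 := hgrad y' (closedBall_subset_closedBall (by linarith) hy')
      have a3 := norm_sub_le (fderiv ℝ w y) (fderiv ℝ w y')
      have a4 : 2 * (16 / σ * S / R) ≤ K * (16 / σ * S / R) := mul_le_mul_of_nonneg_right hK2 hA
      have a5 : 0 ≤ K * (16 / σ * S / R) := by positivity
      nlinarith

def IConst (c C : ℝ) : Prop := 1 ≤ C ∧ ∀ (w : E2 → ℝ) (x : E2) (R S : ℝ),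
    ContDiff ℝ 2 w → 0 < R → (∀ y ∈ closedBall x R, Cone c (fderiv ℝ (fderiv ℝ w) y)) →
    (∀ y ∈ closedBall x R, |w y| ≤ S) →
    (∀ y ∈ closedBall x (R / 2), ‖fderiv ℝ w y‖ ≤ C * S / R) ∧
    (∀ y ∈ closedBall x (R / 4), ∀ y' ∈ closedBall x (R / 4),
      ‖fderiv ℝ w y - fderiv ℝ w y'‖ ≤ C * S / R * (‖y - y'‖ / R) ^ (c / (2 * π)))

def Cls (c : ℝ) (v : E2 → ℝ) : Prop := ∀ ρ < 1, ∀ ε > 0, ∃ w : E2 → ℝ, ContDiff ℝ 2 w ∧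
  (∀ y ∈ closedBall (0:E2) ρ, Cone c (fderiv ℝ (fderiv ℝ w) y)) ∧ ∀ y ∈ closedBall (0:E2) ρ, |w y - v y| ≤ ε

lemma Cone.smul {c : ℝ} {B : Bil} (h : Cone c B) (k : ℝ) : Cone c (k • B) := by
  unfold Cone at *
  simp only [smul_apply, smul_eq_mul]
  nlinarith [mul_le_mul_of_nonneg_left h (sq_nonneg k)]

lemma Cls.congr {c : ℝ} {v v' : E2 → ℝ} (h : Cls c v) (hv : ∀ y ∈ ball (0:E2) 1, v y = v' y) : Cls c v' := by
  intro ρ hρ ε hε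
  obtain ⟨w, h1, h2, h3⟩ := h ρ hρ ε hε
  refine ⟨w, h1, h2, fun y hy => ?_⟩
  rw [← hv y (closedBall_subset_ball hρ hy)]; exact h3 y hy

lemma Cls.smul {c : ℝ} {v : E2 → ℝ} (h : Cls c v) (k : ℝ) : Cls c (fun y => k * v y) := by
  intro ρ hρ ε hε
  obtain ⟨w, h1, h2, h3⟩ := h ρ hρ (ε / (|k| + 1)) (by positivity)
  refine ⟨fun y => k * w y, contDiff_const.mul h1, fun y hy => ?_, fun y hy => ?_⟩
  · have e1 : fderiv ℝ (fun y => k * w y) = fun y => k • fderiv ℝ w y := by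
      ext1 y; exact fderiv_const_mul (h1.differentiable (by norm_num) y) k
    have hd : ContDiff ℝ 1 (fderiv ℝ w) := h1.fderiv_right (by norm_num)
    rw [e1, fderiv_fun_const_smul (hd.differentiable (by norm_num) y)]
    exact (h2 y hy).smul k
  · rw [← mul_sub, abs_mul]
    have := h3 y hy
    rw [le_div_iff₀ (by positivity)] at this
    nlinarith [abs_nonneg (w y - v y)]

lemma Cls.neg {c : ℝ} {v : E2 → ℝ} (h : Cls c v) : Cls c (fun y => - v y) := by
  have := h.smul (-1)
  simpa using this

lemma Cls.add_affine {c : ℝ} {v : E2 → ℝ} (h : Cls c v) (L : E2 →L[ℝ] ℝ) (a : ℝ) : Cls c (fun y => v y + (L y + a)) := by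
  intro ρ hρ ε hε
  obtain ⟨w, h1, h2, h3⟩ := h ρ hρ ε hε
  refine ⟨fun y => w y + (L y + a), h1.add (L.contDiff.add contDiff_const), fun y hy => ?_, fun y hy => ?_⟩
  · have e1 : fderiv ℝ (fun y => w y + (L y + a)) = fun y => fderiv ℝ w y + L := by
      ext1 y
      have := ((h1.differentiable (by norm_num) y).hasFDerivAt).add (L.hasFDerivAt (x := y) |>.add_const a)
      exact this.fderiv
    rw [e1, fderiv_add_const]; exact h2 y hy
  · have := h3 y hy
    rwa [add_sub_add_right_eq_sub]

lemma le_of_eps {a b k : ℝ} (hk : 0 ≤ k) (h : ∀ ε > 0, a ≤ b + k * ε) : a ≤ b := by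
  by_contra hh
  push Not at hh
  have := h ((a - b) / (2 * (k + 1))) (by apply div_pos <;> linarith)
  have h2 : k * ((a - b) / (2 * (k + 1))) ≤ (a - b) / 2 := by
    rw [mul_div_assoc', div_le_iff₀ (by positivity)]
    nlinarith
  linarith

lemma closedBall_sub_zero {x : E2} {R : ℝ} : closedBall x R ⊆ closedBall 0 (‖x‖ + R) := by
  apply closedBall_subset_closedBall'; rw [dist_zero_right]; linarith

lemma Cls.osc {c C : ℝ} (hI : IConst c C) {v : E2 → ℝ} (h : Cls c v) {x : E2} {R S : ℝ} (hR : 0 < R)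
    (hxR : ‖x‖ + R < 1) (hS : ∀ y ∈ closedBall x R, |v y| ≤ S) {y y' : E2} (hy : y ∈ closedBall x (R / 2))
    (hy' : y' ∈ closedBall x (R / 2)) : |v y - v y'| ≤ C * S / R * ‖y - y'‖ := by
  have hC : 0 ≤ C := by linarith [hI.1]
  apply le_of_eps (k := C / R * ‖y - y'‖ + 2) (by positivity)
  intro ε hε
  obtain ⟨w, h1, h2, h3⟩ := h _ hxR ε hε
  have hg := (hI.2 w x R (S + ε) h1 hR (fun y hy => h2 y (closedBall_sub_zero hy)) (fun y hy => by
    have a := h3 y (closedBall_sub_zero hy)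
    have b := hS y hy
    rw [abs_le] at *; constructor <;> linarith)).1
  have hm := (convex_closedBall x (R / 2)).norm_image_sub_le_of_norm_fderiv_le
    (fun z _ => h1.differentiable (by norm_num) z) hg hy' hy
  have hs : closedBall x (R / 2) ⊆ closedBall 0 (‖x‖ + R) :=
    (closedBall_subset_closedBall (by linarith)).trans closedBall_sub_zero
  have a1 := h3 y (hs hy)
  have a2 := h3 y' (hs hy')
  rw [Real.norm_eq_abs] at hm
  have e : C * (S + ε) / R * ‖y - y'‖ = C * S / R * ‖y - y'‖ + (C / R * ‖y - y'‖) * ε := by ring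
  rw [e] at hm
  rw [abs_le] at *
  constructor <;> linarith

lemma Cls.grad_le {c C : ℝ} (hI : IConst c C) {v : E2 → ℝ} (h : Cls c v) {x : E2} {R S : ℝ} (hR : 0 < R)
    (hxR : ‖x‖ + R < 1) (hS : ∀ y ∈ closedBall x R, |v y| ≤ S) {y : E2} (hy : y ∈ ball x (R / 2))
    {L : E2 →L[ℝ] ℝ} (hL : HasFDerivAt v L y) : ‖L‖ ≤ C * S / R := by
  have hC : 0 ≤ C := by linarith [hI.1]
  have hS0 : 0 ≤ S := (abs_nonneg _).trans (hS x (mem_closedBall_self hR.le))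
  apply hL.le_of_lip' (by positivity)
  filter_upwards [isOpen_ball.mem_nhds hy] with z hz
  exact h.osc hI hR hxR hS (ball_subset_closedBall hz) (ball_subset_closedBall hy)

lemma Cls.grad_holder {c C : ℝ} (hI : IConst c C) {v : E2 → ℝ} (h : Cls c v) {x : E2} {R S : ℝ} (hR : 0 < R)
    (hxR : ‖x‖ + R < 1) (hS : ∀ y ∈ closedBall x R, |v y| ≤ S) {y y' : E2} (hy : y ∈ ball x (R / 4))
    (hy' : y' ∈ ball x (R / 4)) {L L' : E2 →L[ℝ] ℝ} (hL : HasFDerivAt v L y) (hL' : HasFDerivAt v L' y') :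
    ‖L - L'‖ ≤ C * S / R * (‖y - y'‖ / R) ^ (c / (2 * π)) := by
  have hC : 0 ≤ C := by linarith [hI.1]
  have hS0 : 0 ≤ S := (abs_nonneg _).trans (hS x (mem_closedBall_self hR.le))
  set P := (‖y - y'‖ / R) ^ (c / (2 * π)) with hP
  have hP0 : 0 ≤ P := by positivity
  have hφ : HasFDerivAt (fun z => v (z + y) - v (z + y')) (L - L') (0:E2) := by
    apply HasFDerivAt.sub
    · exact (hasFDerivAt_comp_add_right y).mpr (by rw [zero_add]; exact hL)
    · exact (hasFDerivAt_comp_add_right y').mpr (by rw [zero_add]; exact hL')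
  obtain ⟨δ, hδ, hb⟩ : ∃ δ > 0, ∀ z ∈ ball (0:E2) δ, z + y ∈ ball x (R / 4) ∧ z + y' ∈ ball x (R / 4) := by
    have h1 : ∀ᶠ z in nhds (0:E2), z + y ∈ ball x (R / 4) :=
      (by fun_prop : Continuous fun z : E2 => z + y).continuousAt.eventually_mem (isOpen_ball.mem_nhds (by simpa using hy))
    have h2 : ∀ᶠ z in nhds (0:E2), z + y' ∈ ball x (R / 4) :=
      (by fun_prop : Continuous fun z : E2 => z + y').continuousAt.eventually_mem (isOpen_ball.mem_nhds (by simpa using hy'))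
    obtain ⟨δ, hδ, hh⟩ := Metric.eventually_nhds_iff_ball.mp (h1.and h2)
    exact ⟨δ, hδ, hh⟩
  apply hφ.le_of_lip' (by positivity)
  filter_upwards [ball_mem_nhds (0:E2) hδ] with z hz
  apply le_of_eps (k := C / R * P * ‖z‖ + 4) (by positivity)
  intro ε hε
  obtain ⟨w, h1, h2, h3⟩ := h _ hxR ε hε
  have hg := (hI.2 w x R (S + ε) h1 hR (fun y hy => h2 y (closedBall_sub_zero hy)) (fun y hy => by
    have a := h3 y (closedBall_sub_zero hy)
    have b := hS y hy
    rw [abs_le] at *; constructor <;> linarith)).2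
  have hwd : ∀ z, HasFDerivAt (fun z => w (z + y) - w (z + y')) (fderiv ℝ w (z + y) - fderiv ℝ w (z + y')) z := by
    intro z
    have hdw := fun z => (h1.differentiable (by norm_num) z).hasFDerivAt
    exact ((hasFDerivAt_comp_add_right y).mpr (hdw _)).sub ((hasFDerivAt_comp_add_right y').mpr (hdw _))
  have hm := (convex_ball (0:E2) δ).norm_image_sub_le_of_norm_hasFDerivWithin_le (C := C * (S + ε) / R * P)
    (fun z _ => (hwd z).hasFDerivWithinAt) (fun z hz => by
      have := hg _ (ball_subset_closedBall (hb z hz).1) _ (ball_subset_closedBall (hb z hz).2)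
      rwa [add_sub_add_left_eq_sub] at this) (mem_ball_self hδ) hz
  have hs : ball x (R / 4) ⊆ closedBall 0 (‖x‖ + R) :=
    (ball_subset_closedBall.trans (closedBall_subset_closedBall (by linarith))).trans closedBall_sub_zero
  have a1 := h3 _ (hs (hb z hz).1)
  have a2 := h3 _ (hs (hb z hz).2)
  have a3 := h3 _ (hs hy)
  have a4 := h3 _ (hs hy')
  simp only [zero_add, sub_zero, Real.norm_eq_abs] at hm ⊢
  have e : C * (S + ε) / R * P * ‖z‖ = C * S / R * P * ‖z‖ + (C / R * P * ‖z‖) * ε := by ring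
  rw [e] at hm
  rw [abs_le] at *
  constructor <;> linarith

/-- a global twice differentiable function that agrees with `u` on a smaller ball -/
lemma exists_cutoff {u : E2 → ℝ} (hu : ContDiffOn ℝ 2 u (ball (0:E2) 1)) {ρ : ℝ} (hρ0 : 0 < ρ) (hρ : ρ < 1) :
    ∃ w : E2 → ℝ, ContDiff ℝ 2 w ∧ ∀ y ∈ closedBall (0:E2) ρ, w y = u y := by
  set χ : ContDiffBump (0:E2) := ⟨ρ, (ρ + 1) / 2, hρ0, by linarith⟩ with hχ
  refine ⟨fun y => χ y * u y, ?_, fun y hy => ?_⟩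
  · rw [contDiff_iff_contDiffAt]
    intro y
    by_cases hy : y ∈ ball (0:E2) 1
    · exact (χ.contDiff.contDiffAt).mul (hu.contDiffAt (isOpen_ball.mem_nhds hy))
    · have h0 : (fun y => χ y * u y) =ᶠ[nhds y] fun _ => 0 := by
        have : (closedBall (0:E2) ((ρ + 1) / 2))ᶜ ∈ nhds y := by
          apply isClosed_closedBall.isOpen_compl.mem_nhds
          intro h; apply hy
          exact closedBall_subset_ball (by linarith) h
        filter_upwards [this] with z hz
        rw [χ.zero_of_le_dist, zero_mul]
        simp only [mem_compl_iff, mem_closedBall, not_le] at hz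
        exact hz.le
      exact contDiffAt_const.congr_of_eventuallyEq h0
  · simp only
    rw [χ.one_of_mem_closedBall hy, one_mul]

lemma cutoff_fderiv {u w : E2 → ℝ} {ρ : ℝ} (h : ∀ y ∈ closedBall (0:E2) ρ, w y = u y) {y : E2} (hy : y ∈ ball (0:E2) ρ) :
    fderiv ℝ w y = fderiv ℝ u y ∧ fderiv ℝ (fderiv ℝ w) y = fderiv ℝ (fderiv ℝ u) y := by
  have h1 : ∀ y ∈ ball (0:E2) ρ, fderiv ℝ w y = fderiv ℝ u y := by
    intro y hy
    apply Filter.EventuallyEq.fderiv_eq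
    filter_upwards [isOpen_ball.mem_nhds hy] with z hz using h z (ball_subset_closedBall hz)
  refine ⟨h1 y hy, ?_⟩
  apply Filter.EventuallyEq.fderiv_eq
  filter_upwards [isOpen_ball.mem_nhds hy] with z hz using h1 z hz

lemma Cls_self {c : ℝ} {u : E2 → ℝ} (hu : ContDiffOn ℝ 2 u (ball (0:E2) 1))
    (hC : ∀ x ∈ ball (0:E2) 1, Cone c (fderiv ℝ (fderiv ℝ u) x)) : Cls c u := by
  intro ρ hρ ε hε
  set ρ' := (max ρ 0 + 1) / 2 with hρ'
  have h0 : 0 ≤ max ρ 0 := le_max_right _ _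
  have h1 : ρ ≤ max ρ 0 := le_max_left _ _
  have h2 : max ρ 0 < 1 := max_lt hρ one_pos
  obtain ⟨w, hw, hwu⟩ := exists_cutoff hu (ρ := ρ') (by linarith) (by linarith)
  have hs : closedBall (0:E2) ρ ⊆ ball 0 ρ' := closedBall_subset_ball (by linarith)
  refine ⟨w, hw, fun y hy => ?_, fun y hy => ?_⟩
  · rw [(cutoff_fderiv hwu (hs hy)).2]
    exact hC y (closedBall_subset_ball hρ hy)
  · rw [hwu y (ball_subset_closedBall (hs hy)), sub_self, abs_zero]; exact hε.le

lemma Cls_deriv {c : ℝ} {u : E2 → ℝ} (hu : ContDiffOn ℝ 2 u (ball (0:E2) 1))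
    (hC : ∀ x ∈ ball (0:E2) 1, ∀ y ∈ ball (0:E2) 1, Cone c (fderiv ℝ (fderiv ℝ u) x - fderiv ℝ (fderiv ℝ u) y))
    (e : E2) (he : ‖e‖ = 1) : Cls c (fun y => fderiv ℝ u y e) := by
  intro ρ hρ ε hε
  set ρ' := (max ρ 0 + 1) / 2 with hρ'
  have h0 : 0 ≤ max ρ 0 := le_max_right _ _
  have h1 : ρ ≤ max ρ 0 := le_max_left _ _
  have h2 : max ρ 0 < 1 := max_lt hρ one_pos
  obtain ⟨w, hw, hwu⟩ := exists_cutoff hu (ρ := ρ') (by linarith) (by linarith)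
  have hcd : Continuous (fderiv ℝ w) := hw.continuous_fderiv (by norm_num)
  have hcd1 : ContDiff ℝ 1 (fderiv ℝ w) := hw.fderiv_right (by norm_num)
  have hw1 : ContDiff ℝ 1 w := hw.of_le (by norm_num)
  have huc := (isCompact_closedBall (0:E2) 1).uniformContinuousOn_of_continuous hcd.continuousOn
  rw [Metric.uniformContinuousOn_iff] at huc
  obtain ⟨δ, hδ, hfδ⟩ := huc ε hε
  set h := min (δ / 2) ((ρ' - max ρ 0) / 2) with hh
  have hh0 : 0 < h := lt_min (by linarith) (by linarith)
  have hhδ : h < δ := (min_le_left _ _).trans_lt (by linarith)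
  have hhρ : h ≤ (ρ' - max ρ 0) / 2 := min_le_right _ _
  have hmem : ∀ y ∈ closedBall (0:E2) ρ, ∀ s, 0 ≤ s → s ≤ h → ∀ z ∈ closedBall y s, z ∈ ball (0:E2) ρ' := by
    intro y hy s hs0 hs z hz
    rw [mem_closedBall, dist_zero_right] at hy
    rw [mem_closedBall] at hz
    rw [mem_ball, dist_zero_right]
    have := norm_le_norm_add_norm_sub' z y
    rw [← dist_eq_norm] at this
    linarith
  have hs1 : ball (0:E2) ρ' ⊆ closedBall 0 1 := ball_subset_closedBall.trans (closedBall_subset_closedBall (by linarith))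
  refine ⟨fun y => h⁻¹ * (w (y + h • e) - w y), ?_, fun y hy => ?_, fun y hy => ?_⟩
  · apply contDiff_const.mul; apply ContDiff.sub _ hw
    exact hw.comp (by fun_prop)
  · have e1 : fderiv ℝ (fun y => h⁻¹ * (w (y + h • e) - w y)) = fun y => h⁻¹ • (fderiv ℝ w (y + h • e) - fderiv ℝ w y) := by
      ext1 y
      have a1 : HasFDerivAt (fun y => w (y + h • e)) (fderiv ℝ w (y + h • e)) y :=
        (hasFDerivAt_comp_add_right _).mpr (hw1.differentiable (by norm_num) _).hasFDerivAt
      exact ((a1.sub (hw1.differentiable (by norm_num) y).hasFDerivAt).const_mul h⁻¹).fderiv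
    have e2 : fderiv ℝ (fun y => h⁻¹ • (fderiv ℝ w (y + h • e) - fderiv ℝ w y)) y
        = h⁻¹ • (fderiv ℝ (fderiv ℝ w) (y + h • e) - fderiv ℝ (fderiv ℝ w) y) := by
      have a1 : HasFDerivAt (fun y => fderiv ℝ w (y + h • e)) (fderiv ℝ (fderiv ℝ w) (y + h • e)) y :=
        (hasFDerivAt_comp_add_right _).mpr (hcd1.differentiable (by norm_num) _).hasFDerivAt
      exact ((a1.sub (hcd1.differentiable (by norm_num) y).hasFDerivAt).const_smul h⁻¹).fderiv
    rw [e1, e2]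
    apply Cone.smul
    have m1 := hmem y hy h hh0.le le_rfl (y + h • e) (by
      rw [mem_closedBall, dist_eq_norm, add_sub_cancel_left, norm_smul, he, mul_one, Real.norm_of_nonneg hh0.le])
    have m2 := hmem y hy h hh0.le le_rfl y (mem_closedBall_self hh0.le)
    rw [(cutoff_fderiv hwu m1).2, (cutoff_fderiv hwu m2).2]
    exact hC _ (ball_subset_ball (by linarith) m1) _ (ball_subset_ball (by linarith) m2)
  · have m2 := hmem y hy h hh0.le le_rfl y (mem_closedBall_self hh0.le)
    have := lin_approx hw1 (y := y) (v := e) (h := h) (δ := ε) hh0.le he.le (fun z hz => by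
      have mz := hmem y hy h hh0.le le_rfl z hz
      rw [← dist_eq_norm]
      exact (hfδ z (hs1 mz) y (hs1 m2) (lt_of_le_of_lt (mem_closedBall.mp hz) hhδ)).le)
    simp only
    rw [← (cutoff_fderiv hwu m2).1]
    have e3 : h⁻¹ * (w (y + h • e) - w y) - fderiv ℝ w y e = h⁻¹ * (w (y + h • e) - w y - h * fderiv ℝ w y e) := by
      field_simp
    rw [e3, abs_mul, abs_of_pos (inv_pos.mpr hh0), inv_mul_le_iff₀ hh0]
    linarith

def rot (e : E2) : E2 := (-e 1) • ee0 + e 0 • ee1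

@[simp] lemma rot_zero' (e : E2) : rot e 0 = -e 1 := by simp [rot]
@[simp] lemma rot_one' (e : E2) : rot e 1 = e 0 := by simp [rot]

lemma bil_decomp (B : Bil) (u v : E2) : B u v = u 0 * v 0 * B ee0 ee0 + u 0 * v 1 * B ee0 ee1
    + u 1 * v 0 * B ee1 ee0 + u 1 * v 1 * B ee1 ee1 := by
  have h1 : B u = u 0 • B ee0 + u 1 • B ee1 := by
    conv_lhs => rw [E2_decomp u]
    simp
  rw [clm_decomp (B u) v, h1]
  simp only [add_apply, smul_apply, smul_eq_mul]
  ring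

lemma Cone.rot {c : ℝ} {B : Bil} (h : Cone c B) {e : E2} (he : ‖e‖ = 1) :
    c * (B e e ^ 2 + B e (rot e) ^ 2 + B (rot e) e ^ 2 + B (rot e) (rot e) ^ 2) ≤
      B e (rot e) * B (rot e) e - B e e * B (rot e) (rot e) := by
  have hn := E2_norm_sq e
  rw [he] at hn
  rw [bil_decomp B e e, bil_decomp B e (_root_.rot e), bil_decomp B (_root_.rot e) e, bil_decomp B (_root_.rot e) (_root_.rot e)]
  simp only [rot_zero', rot_one']
  unfold Cone at h
  set a := B ee0 ee0
  set b := B ee0 ee1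
  set b' := B ee1 ee0
  set d := B ee1 ee1
  set x := e 0
  set y := e 1
  have e1 : (x * x * a + x * y * b + y * x * b' + y * y * d) ^ 2 + (x * -y * a + x * x * b + y * -y * b' + y * x * d) ^ 2 +
        (-y * x * a + -y * y * b + x * x * b' + x * y * d) ^ 2 +
      (-y * -y * a + -y * x * b + x * -y * b' + x * x * d) ^ 2 = (a ^ 2 + b ^ 2 + b' ^ 2 + d ^ 2) * (x ^ 2 + y ^ 2) ^ 2 := by ring
  have e2 : (x * -y * a + x * x * b + y * -y * b' + y * x * d) * (-y * x * a + -y * y * b + x * x * b' + x * y * d) -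
    (x * x * a + x * y * b + y * x * b' + y * y * d) * (-y * -y * a + -y * x * b + x * -y * b' + x * x * d)
      = (b * b' - a * d) * (x ^ 2 + y ^ 2) ^ 2 := by ring
  rw [e1, e2, ← hn]
  linarith

lemma line_hasDerivAt {f : E2 → ℝ} (hf : ContDiff ℝ 2 f) (y v : E2) :
    (∀ t : ℝ, HasDerivAt (fun t : ℝ => f (y + t • v)) (fderiv ℝ f (y + t • v) v) t) ∧
    HasDerivAt (fun t : ℝ => fderiv ℝ f (y + t • v) v) (fderiv ℝ (fderiv ℝ f) y v v) 0 := by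
  have hd : ContDiff ℝ 1 (fderiv ℝ f) := hf.fderiv_right (by norm_num)
  have hl : ∀ t : ℝ, HasDerivAt (fun t : ℝ => y + t • v) v t := by
    intro t
    simpa using ((hasDerivAt_id t).smul_const v).const_add y
  constructor
  · intro t
    have h3 : HasFDerivAt f (fderiv ℝ f (y + t • v)) (y + t • v) := (hf.differentiable (by norm_num) (y + t • v)).hasFDerivAt
    have h4 := HasFDerivAt.comp_hasDerivAt (f := fun t : ℝ => y + t • v) t h3 (hl t)
    exact h4
  · have h1 : HasFDerivAt (fderiv ℝ f) (fderiv ℝ (fderiv ℝ f) y) (y + (0:ℝ) • v) := by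
      rw [zero_smul, add_zero]
      exact (hd.differentiable (by norm_num) y).hasFDerivAt
    have h2 := HasFDerivAt.comp_hasDerivAt (f := fun t : ℝ => y + t • v) (0:ℝ) h1 (hl 0)
    have h3 : HasFDerivAt (fun L : E2 →L[ℝ] ℝ => L v) (ContinuousLinearMap.apply ℝ ℝ v) (fderiv ℝ f (y + (0:ℝ) • v)) :=
      (ContinuousLinearMap.apply ℝ ℝ v).hasFDerivAt
    have h4 := HasFDerivAt.comp_hasDerivAt (f := fun t : ℝ => fderiv ℝ f (y + t • v)) (0:ℝ) h3 h2
    exact h4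

lemma hess_line {f : E2 → ℝ} (hf : ContDiff ℝ 2 f) (y v : E2) {φ φ' : ℝ → ℝ} {s : ℝ}
    (h0 : ∀ t : ℝ, f (y + t • v) = φ t) (h1 : ∀ t, HasDerivAt φ (φ' t) t) (h2 : HasDerivAt φ' s 0) :
    fderiv ℝ (fderiv ℝ f) y v v = s := by
  obtain ⟨a, b⟩ := line_hasDerivAt hf y v
  have e : (fun t : ℝ => fderiv ℝ f (y + t • v) v) = φ' := by
    ext t
    have := a t
    simp only [h0] at this
    exact this.unique (h1 t)
  rw [e] at b
  exact b.unique h2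

lemma second_nonneg {f : E2 → ℝ} (hf : ContDiff ℝ 2 f) {z : E2} (hz : IsLocalMin f z) (v : E2) :
    0 ≤ fderiv ℝ (fderiv ℝ f) z v v := by
  obtain ⟨a, b⟩ := line_hasDerivAt hf z v
  set φ : ℝ → ℝ := fun t => f (z + t • v) with hφ
  have hd : deriv φ = fun t => fderiv ℝ f (z + t • v) v := funext fun t => (a t).deriv
  have hdd : deriv (deriv φ) 0 = fderiv ℝ (fderiv ℝ f) z v v := by rw [hd]; exact b.deriv
  have hmin : IsLocalMin φ 0 := by
    have hc : ContinuousAt (fun t : ℝ => z + t • v) 0 := by fun_prop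
    have : IsLocalMin f (z + (0:ℝ) • v) := by simpa using hz
    exact hc.eventually this
  by_contra hneg
  push Not at hneg
  have hmax : IsLocalMax φ 0 := isLocalMax_of_deriv_deriv_neg (by rw [hdd]; exact hneg) hmin.deriv_eq_zero (a 0).continuousAt
  have heq : φ =ᶠ[nhds 0] fun _ => φ 0 := by
    filter_upwards [hmin, hmax] with t h1 h2 using le_antisymm h2 h1
  have : deriv (deriv φ) 0 = 0 := by
    have h1 : deriv φ =ᶠ[nhds 0] deriv (fun _ => φ 0) := heq.deriv
    rw [h1.deriv_eq]; simp
  rw [hdd] at this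
  linarith

/-- pointwise strict subsolution condition -/
def StrictSub (c : ℝ) (B : Bil) : Prop := ∃ e : E2, ‖e‖ = 1 ∧ ∃ p q : ℝ, 0 ≤ q ∧ q < c * p ∧
  ∀ v : E2, p * (e 0 * v 0 + e 1 * v 1) ^ 2 - q * (e 0 * v 1 - e 1 * v 0) ^ 2 ≤ B v v

lemma strictSub_contra {c : ℝ} (hc : 0 < c) {N M : Bil} (hN : Cone c N) (hM : StrictSub c M)
    (h : ∀ v, M v v ≤ N v v) : False := by
  obtain ⟨e, he, p, q, hq, hqp, hB⟩ := hM
  have hn := E2_norm_sq e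
  rw [he] at hn
  have hR := hN.rot he
  set a := N e e with ha
  set b := N e (rot e)
  set b' := N (rot e) e
  set d := N (rot e) (rot e)
  have hform : ∀ s t : ℝ, p * s ^ 2 - q * t ^ 2 ≤ a * s ^ 2 + (b + b') * s * t + d * t ^ 2 := by
    intro s t
    have h1 := (hB (s • e + t • rot e)).trans (h _)
    have e1 : N (s • e + t • rot e) (s • e + t • rot e) = a * s ^ 2 + (b + b') * s * t + d * t ^ 2 := by
      simp only [map_add, map_smul, add_apply, smul_apply, smul_eq_mul]
      ring
    rw [e1] at h1
    have e2 : e 0 * (s • e + t • rot e) 0 + e 1 * (s • e + t • rot e) 1 = s := by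
      simp only [PiLp.add_apply, PiLp.smul_apply, smul_eq_mul, rot_zero', rot_one']
      linear_combination (-s) * hn
    have e3 : e 0 * (s • e + t • rot e) 1 - e 1 * (s • e + t • rot e) 0 = t := by
      simp only [PiLp.add_apply, PiLp.smul_apply, smul_eq_mul, rot_zero', rot_one']
      linear_combination (-t) * hn
    rwa [e2, e3] at h1
  have h1 := hform 1 0
  have h2 := hform 0 1
  have h3 : discrim (a - p) (b + b') (d + q) ≤ 0 := by
    apply discrim_le_zero
    intro s
    have := hform s 1
    linarith
  unfold discrim at h3
  have h4 : 0 ≤ c * (b ^ 2 + b' ^ 2 + d ^ 2) := by positivity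
  have hp : 0 < p := by nlinarith
  have h5 : c * a ^ 2 ≤ a * q := by
    have : 0 ≤ p * (d + q) := mul_nonneg hp.le (by linarith)
    nlinarith [sq_nonneg (b - b')]
  have ha0 : 0 < a := by linarith
  have h6 : c * a ≤ q := by nlinarith
  nlinarith

lemma Cls.compare {c : ℝ} (hc : 0 < c) {v ψ : E2 → ℝ} (h : Cls c v) {K G : Set E2} (hK : IsCompact K) (hG : IsOpen G)
    (hGK : G ⊆ K) (hG1 : G ⊆ ball 0 1) (hv : ContinuousOn v K) (hψ : ContDiff ℝ 2 ψ)
    (hψ2 : ∀ y ∈ G, StrictSub c (fderiv ℝ (fderiv ℝ ψ) y)) (hb : ∀ y ∈ K, y ∉ G → ψ y ≤ v y) :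
    ∀ y ∈ K, ψ y ≤ v y := by
  by_contra hcon
  push Not at hcon
  obtain ⟨y1, hy1, hlt⟩ := hcon
  have hcont : ContinuousOn (fun y => v y - ψ y) K := hv.sub hψ.continuous.continuousOn
  obtain ⟨ys, hys, hmin⟩ := hK.exists_isMinOn ⟨y1, hy1⟩ hcont
  set μ := -(v ys - ψ ys) with hμ
  have hμ0 : 0 < μ := by
    have : v ys - ψ ys ≤ v y1 - ψ y1 := hmin hy1
    linarith
  set A := {y ∈ K | v y - ψ y ≤ -μ / 2} with hA
  have hAc : IsCompact A := by
    have : A = K ∩ (fun y => v y - ψ y) ⁻¹' (Iic (-μ / 2)) := by ext; simp [hA]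
    rw [this]
    exact hK.of_isClosed_subset (hcont.preimage_isClosed_of_isClosed hK.isClosed isClosed_Iic) inter_subset_left
  have hAG : A ⊆ G := by
    intro y hy
    by_contra hyG
    have := hb y hy.1 hyG
    have h2 := hy.2
    linarith
  have hysA : ys ∈ A := ⟨hys, by linarith⟩
  obtain ⟨ym, hym, hmax⟩ := hAc.exists_isMaxOn ⟨ys, hysA⟩ continuous_norm.continuousOn
  have hρ : ‖ym‖ < 1 := by simpa using hG1 (hAG hym)
  obtain ⟨w, hw, hwC, hwv⟩ := h ‖ym‖ hρ (μ / 8) (by linarith)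
  have hAb : A ⊆ closedBall 0 ‖ym‖ := by
    intro y hy
    rw [mem_closedBall, dist_zero_right]; exact hmax hy
  obtain ⟨z, hz, hzmin⟩ := hAc.exists_isMinOn ⟨ys, hysA⟩ (hw.continuous.sub hψ.continuous).continuousOn
  have hzv : v z - ψ z < -μ / 2 := by
    have h1 : w z - ψ z ≤ w ys - ψ ys := hzmin hysA
    have h2 := abs_le.mp (hwv z (hAb hz))
    have h3 := abs_le.mp (hwv ys (hAb hysA))
    linarith
  have hnear : ∀ᶠ y in nhds z, y ∈ A := by
    have hGz := hG.mem_nhds (hAG hz)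
    have hca : ContinuousAt (fun y => v y - ψ y) z := hcont.continuousAt (Filter.mem_of_superset hGz hGK)
    filter_upwards [hGz, hca.eventually_lt continuousAt_const hzv] with y hy1 hy2
    exact ⟨hGK hy1, hy2.le⟩
  have hloc : IsLocalMin (fun y => w y - ψ y) z := by
    filter_upwards [hnear] with y hy using hzmin hy
  have hwψ : ContDiff ℝ 2 (fun y => w y - ψ y) := hw.sub hψ
  apply strictSub_contra hc (hwC z (hAb hz)) (hψ2 z (hAG hz))
  intro v
  have h1 := second_nonneg hwψ hloc v
  have e1 : fderiv ℝ (fun y => w y - ψ y) = fun y => fderiv ℝ w y - fderiv ℝ ψ y := by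
    ext1 y
    exact fderiv_fun_sub (hw.differentiable (by norm_num) y) (hψ.differentiable (by norm_num) y)
  have hw' : ContDiff ℝ 1 (fderiv ℝ w) := hw.fderiv_right (by norm_num)
  have hψ' : ContDiff ℝ 1 (fderiv ℝ ψ) := hψ.fderiv_right (by norm_num)
  rw [e1, fderiv_fun_sub (hw'.differentiable (by norm_num) z) (hψ'.differentiable (by norm_num) z)] at h1
  simp only [sub_apply] at h1
  linarith

def dY (x0 x : E2) : ℝ := 1 - (x0 0 * x 0 + x0 1 * x 1)
def dZ (x0 x : E2) : ℝ := x0 0 * x 1 - x0 1 * x 0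

lemma dYZ_sq {x0 : E2} (h0 : ‖x0‖ = 1) (x : E2) : ‖x - x0‖ ^ 2 = dZ x0 x ^ 2 + dY x0 x ^ 2 := by
  have h := E2_norm_sq x0
  rw [h0] at h
  rw [E2_norm_sq]
  unfold dY dZ
  simp only [PiLp.sub_apply]
  linear_combination (x 0 ^ 2 + x 1 ^ 2 - 1) * h

lemma norm_sq_dY {x0 : E2} (h0 : ‖x0‖ = 1) (x : E2) : ‖x‖ ^ 2 = 1 - 2 * dY x0 x + ‖x - x0‖ ^ 2 := by
  have h := E2_norm_sq x0
  rw [h0] at h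
  rw [E2_norm_sq, E2_norm_sq]
  unfold dY
  simp only [PiLp.sub_apply]
  linear_combination h

lemma dY_ge {x0 : E2} (h0 : ‖x0‖ = 1) {x : E2} (hx : ‖x‖ ≤ 1) : ‖x - x0‖ ^ 2 ≤ 2 * dY x0 x := by
  have := norm_sq_dY h0 x
  nlinarith [norm_nonneg x]

lemma dY_nonneg {x0 : E2} (h0 : ‖x0‖ = 1) {x : E2} (hx : ‖x‖ ≤ 1) : 0 ≤ dY x0 x := by
  have := dY_ge h0 hx
  nlinarith [sq_nonneg ‖x - x0‖]

lemma dY_circ {x0 : E2} (h0 : ‖x0‖ = 1) {x : E2} (hx : ‖x‖ = 1) : 2 * dY x0 x = ‖x - x0‖ ^ 2 := by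
  have := norm_sq_dY h0 x
  rw [hx] at this
  linarith

lemma abs_dY_le {x0 : E2} (h0 : ‖x0‖ = 1) (x : E2) : |dY x0 x| ≤ ‖x - x0‖ := by
  apply abs_le_of_sq_le_sq _ (norm_nonneg _)
  rw [dYZ_sq h0]; nlinarith [sq_nonneg (dZ x0 x)]

lemma abs_dZ_le {x0 : E2} (h0 : ‖x0‖ = 1) (x : E2) : |dZ x0 x| ≤ ‖x - x0‖ := by
  apply abs_le_of_sq_le_sq _ (norm_nonneg _)
  rw [dYZ_sq h0]; nlinarith [sq_nonneg (dY x0 x)]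

lemma contDiff_coord (i : Fin 2) {n : WithTop ℕ∞} : ContDiff ℝ n (fun x : E2 => x i) := by fun_prop

lemma contDiff_dY (x0 : E2) {n : WithTop ℕ∞} : ContDiff ℝ n (dY x0) := by
  unfold dY; fun_prop
lemma contDiff_dZ (x0 : E2) {n : WithTop ℕ∞} : ContDiff ℝ n (dZ x0) := by
  unfold dZ; fun_prop

lemma dY_line (x0 y v : E2) (t : ℝ) : dY x0 (y + t • v) = dY x0 y - t * (x0 0 * v 0 + x0 1 * v 1) := by
  unfold dY; simp; ring
lemma dZ_line (x0 y v : E2) (t : ℝ) : dZ x0 (y + t • v) = dZ x0 y + t * (x0 0 * v 1 - x0 1 * v 0) := by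
  unfold dZ; simp; ring

lemma barrier1 {c : ℝ} (hc : 0 < c) {V : E2 → ℝ} (hV : Cls c V) (hVc : ContinuousOn V (closedBall 0 1))
    {x0 : E2} (h0 : ‖x0‖ = 1) {r δ : ℝ} (hr : 0 < r) (hδ : 0 ≤ δ)
    (h1 : ∀ x, ‖x‖ ≤ 1 → ‖x - x0‖ ≤ r → -1 ≤ V x)
    (h2 : ∀ x, ‖x‖ = 1 → ‖x - x0‖ ≤ r → -δ ≤ V x) :
    ∀ x, ‖x‖ ≤ 1 → ‖x - x0‖ ≤ r / 2 → -δ - (5 + 4 / c) * dY x0 x / r ≤ V x := by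
  intro x hx hxr
  set K := 5 + 4 / c with hK
  have hK0 : 4 / c > 0 := by positivity
  set s := dZ x0 x with hs
  have hsr : |s| ≤ r / 2 := (abs_dZ_le h0 x).trans hxr
  set ψ : E2 → ℝ := fun y => -δ - 4 * ((dZ x0 y - s) ^ 2 + dY x0 y ^ 2) / r ^ 2 - K * dY x0 y / r + K * dY x0 y ^ 2 / r ^ 2 with hψ
  have hψd : ContDiff ℝ 2 ψ := by
    have a := contDiff_dY x0 (n := 2)
    have b := contDiff_dZ x0 (n := 2)
    rw [hψ]; fun_prop
  have key := hV.compare hc (K := closedBall 0 1 ∩ closedBall x0 r) (G := ball 0 1 ∩ ball x0 r) (ψ := ψ)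
    ((isCompact_closedBall _ _).inter_right isClosed_closedBall) (isOpen_ball.inter isOpen_ball)
    (inter_subset_inter ball_subset_closedBall ball_subset_closedBall) inter_subset_left
    (hVc.mono inter_subset_left) hψd ?_ ?_ x ⟨by simpa using hx, by rw [mem_closedBall, dist_eq_norm]; linarith⟩
  · refine le_trans ?_ key
    simp only [hψ, hs, sub_self]
    have : 4 * (dY x0 x ^ 2) / r ^ 2 ≤ K * dY x0 x ^ 2 / r ^ 2 := by gcongr; linarith
    have e : (0:ℝ) ^ 2 = 0 := by norm_num
    rw [e, zero_add]
    linarith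
  · intro y hy
    refine ⟨x0, h0, (2 * K - 8) / r ^ 2, 8 / r ^ 2, by positivity, ?_, fun v => le_of_eq ?_⟩
    · rw [← mul_div_assoc]
      apply div_lt_div_of_pos_right _ (by positivity)
      have : c * (2 * K - 8) = 2 * c + 8 := by rw [hK]; field_simp; ring
      linarith
    · symm
      set a := x0 0 * v 0 + x0 1 * v 1 with ha
      set b := x0 0 * v 1 - x0 1 * v 0 with hb
      have hl : ∀ t : ℝ, ψ (y + t • v) = ψ y + t * (-8 * ((dZ x0 y - s) * b - dY x0 y * a) / r ^ 2 + K * a / r - 2 * K * dY x0 y * a / r ^ 2)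
          + t ^ 2 * ((K - 4) * a ^ 2 / r ^ 2 - 4 * b ^ 2 / r ^ 2) := by
        intro t
        simp only [hψ, dY_line, dZ_line, ← ha, ← hb]
        ring
      rw [hess_line hψd y v (φ' := fun t => (-8 * ((dZ x0 y - s) * b - dY x0 y * a) / r ^ 2 + K * a / r - 2 * K * dY x0 y * a / r ^ 2) + 2 * t * ((K - 4) * a ^ 2 / r ^ 2 - 4 * b ^ 2 / r ^ 2))
        (s := 2 * ((K - 4) * a ^ 2 / r ^ 2 - 4 * b ^ 2 / r ^ 2)) hl]
      · ring
      · intro t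
        have := ((hasDerivAt_id' t).mul_const (-8 * ((dZ x0 y - s) * b - dY x0 y * a) / r ^ 2 + K * a / r - 2 * K * dY x0 y * a / r ^ 2)).const_add (ψ y)
          |>.add ((hasDerivAt_pow 2 t).mul_const ((K - 4) * a ^ 2 / r ^ 2 - 4 * b ^ 2 / r ^ 2))
        refine this.congr_deriv ?_
        simp
      · have := (((hasDerivAt_id' (0:ℝ)).const_mul 2).mul_const ((K - 4) * a ^ 2 / r ^ 2 - 4 * b ^ 2 / r ^ 2)).const_add (-8 * ((dZ x0 y - s) * b - dY x0 y * a) / r ^ 2 + K * a / r - 2 * K * dY x0 y * a / r ^ 2)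
        refine this.congr_deriv ?_
        ring
  · rintro y ⟨hy1, hy2⟩ hyG
    rw [mem_closedBall, dist_zero_right] at hy1
    rw [mem_closedBall, dist_eq_norm] at hy2
    have hY0 := dY_nonneg h0 hy1
    have hY1 : dY x0 y ≤ r := (le_abs_self _).trans ((abs_dY_le h0 y).trans hy2)
    have e1 : ψ y = -δ - 4 * ((dZ x0 y - s) ^ 2 + dY x0 y ^ 2) / r ^ 2 - K * dY x0 y * (r - dY x0 y) / r ^ 2 := by
      simp only [hψ]; field_simp; ring
    have p1 : 0 ≤ K * dY x0 y * (r - dY x0 y) / r ^ 2 := by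
      apply div_nonneg _ (by positivity)
      apply mul_nonneg (mul_nonneg (by linarith) hY0) (by linarith)
    rcases hy1.lt_or_eq with hlt | heq
    · have hyr : ‖y - x0‖ = r := by
        by_contra hne
        exact hyG ⟨by simpa using hlt, by rw [mem_ball, dist_eq_norm]; exact lt_of_le_of_ne hy2 hne⟩
      have hsq := dYZ_sq h0 y
      rw [hyr] at hsq
      have hZr := (abs_dZ_le h0 y).trans hy2
      have h3 : r ^ 2 ≤ 4 * ((dZ x0 y - s) ^ 2 + dY x0 y ^ 2) := by
        rw [abs_le] at hZr hsr
        have e : (dZ x0 y - s) ^ 2 + dY x0 y ^ 2 = r ^ 2 - 2 * (dZ x0 y * s) + s ^ 2 := by rw [hsq]; ring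
        rw [e]
        have hb : 2 * (dZ x0 y * s) ≤ 2 * (r * |s|) := by
          have : dZ x0 y * s ≤ |dZ x0 y| * |s| := by rw [← abs_mul]; exact le_abs_self _
          have : |dZ x0 y| * |s| ≤ r * |s| := by gcongr; exact abs_le.mpr hZr
          linarith
        have hs2 : |s| ≤ r / 2 := abs_le.mpr hsr
        have hs3 := sq_abs s
        nlinarith [abs_nonneg s]
      have h4 : 1 ≤ 4 * ((dZ x0 y - s) ^ 2 + dY x0 y ^ 2) / r ^ 2 := by
        rw [le_div_iff₀ (by positivity)]; linarith
      have := h1 y hy1 hy2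
      linarith
    · have := h2 y heq hy2
      have h4 : 0 ≤ 4 * ((dZ x0 y - s) ^ 2 + dY x0 y ^ 2) / r ^ 2 := by positivity
      linarith

lemma norm_sub_P_sq {x0 : E2} (h0 : ‖x0‖ = 1) (y : E2) (s : ℝ) :
    ‖y - (1 - s) • x0‖ ^ 2 = dZ x0 y ^ 2 + (dY x0 y - s) ^ 2 := by
  have h := E2_norm_sq x0
  rw [h0] at h
  rw [E2_norm_sq]
  unfold dY dZ
  simp only [PiLp.sub_apply, PiLp.smul_apply, smul_eq_mul]
  linear_combination (y 0 ^ 2 + y 1 ^ 2 - (1 - s) ^ 2) * h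

lemma exp_strictSub {c : ℝ} (hc : 0 < c) {x0 : E2} (h0 : ‖x0‖ = 1) {ε0 k s m A B : ℝ} (hε : 0 < ε0) (hk : 0 < k) {ψ : E2 → ℝ}
    (hψ : ψ = fun y => ε0 * exp (-k * ((dZ x0 y - s) ^ 2 + (dY x0 y - m) ^ 2)) + A * dY x0 y + B) {y : E2}
    (hy : 1 + 1 / c < 2 * k * ((dZ x0 y - s) ^ 2 + (dY x0 y - m) ^ 2)) :
    StrictSub c (fderiv ℝ (fderiv ℝ ψ) y) := by
  have hψd : ContDiff ℝ 2 ψ := by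
    have a := contDiff_dY x0 (n := 2)
    have b := contDiff_dZ x0 (n := 2)
    rw [hψ]; fun_prop
  have hn := E2_norm_sq x0
  rw [h0] at hn
  set q := (dZ x0 y - s) ^ 2 + (dY x0 y - m) ^ 2 with hq
  have hc' : 0 < 1 / c := by positivity
  have hq0 : 0 < q := by
    by_contra hh
    push Not at hh
    nlinarith
  set ρ := √q with hρ
  have hρ0 : 0 < ρ := by positivity
  have hρ2 : ρ ^ 2 = q := Real.sq_sqrt hq0.le
  set w1 := (dZ x0 y - s) / ρ with hw1
  set w2 := (dY x0 y - m) / ρ with hw2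
  have hw : w1 ^ 2 + w2 ^ 2 = 1 := by
    rw [hw1, hw2, div_pow, div_pow, ← add_div, ← hq, hρ2]; field_simp
  have hz1 : dZ x0 y - s = ρ * w1 := by rw [hw1]; field_simp
  have hz2 : dY x0 y - m = ρ * w2 := by rw [hw2]; field_simp
  set e : E2 := w1 • rot x0 - w2 • x0 with he
  have he0 : e 0 = - w1 * x0 1 - w2 * x0 0 := by simp [he]
  have he1 : e 1 = w1 * x0 0 - w2 * x0 1 := by simp [he]
  have hen : e 0 ^ 2 + e 1 ^ 2 = 1 := by
    rw [he0, he1]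
    linear_combination (-(w1 ^ 2 + w2 ^ 2)) * hn + hw
  have hE : 0 < ε0 * exp (-k * q) := by positivity
  refine ⟨e, ?_, ε0 * exp (-k * q) * (4 * k ^ 2 * q - 2 * k), ε0 * exp (-k * q) * (2 * k), by positivity, ?_, fun v => le_of_eq ?_⟩
  · have := E2_norm_sq e
    rw [hen] at this
    nlinarith [norm_nonneg e]
  · have h1 : 2 * k < c * (4 * k ^ 2 * q - 2 * k) := by
      have h2 : c + 1 < c * (2 * k * q) := by
        have := mul_lt_mul_of_pos_left hy hc
        have e1 : c * (1 + 1 / c) = c + 1 := by field_simp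
        linarith
      nlinarith
    calc _ < ε0 * exp (-k * q) * (c * (4 * k ^ 2 * q - 2 * k)) := by gcongr
      _ = _ := by ring
  · symm
    set a := x0 0 * v 0 + x0 1 * v 1 with ha
    set b := x0 0 * v 1 - x0 1 * v 0 with hb
    have hea : e 0 * v 0 + e 1 * v 1 = w1 * b - w2 * a := by rw [he0, he1, ha, hb]; ring
    have heb : (e 0 * v 1 - e 1 * v 0) ^ 2 = a ^ 2 + b ^ 2 - (w1 * b - w2 * a) ^ 2 := by
      rw [he0, he1, ha, hb]
      have : (-w1 * x0 1 - w2 * x0 0) * v 1 - (w1 * x0 0 - w2 * x0 1) * v 0 = - (w1 * a + w2 * b) := by rw [ha, hb]; ring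
      rw [this, ← ha, ← hb]
      linear_combination (a ^ 2 + b ^ 2) * hw
    have hl : ∀ t : ℝ, ψ (y + t • v) = ε0 * exp (-k * (q + t * (2 * ρ * (w1 * b - w2 * a)) + t ^ 2 * (a ^ 2 + b ^ 2))) + A * (dY x0 y - t * a) + B := by
      intro t
      simp only [hψ, dY_line, dZ_line, ← ha, ← hb]
      have : (dZ x0 y + t * b - s) ^ 2 + (dY x0 y - t * a - m) ^ 2 = q + t * (2 * ρ * (w1 * b - w2 * a)) + t ^ 2 * (a ^ 2 + b ^ 2) := by
        rw [hq]
        linear_combination (2 * t * b) * hz1 - (2 * t * a) * hz2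
      rw [this]
    set M := 2 * ρ * (w1 * b - w2 * a) with hM
    set N := a ^ 2 + b ^ 2 with hN
    have hin : ∀ t : ℝ, HasDerivAt (fun t : ℝ => -k * (q + t * M + t ^ 2 * N)) (-k * (M + 2 * t * N)) t := by
      intro t
      have := ((((hasDerivAt_id' t).mul_const M).const_add q).add ((hasDerivAt_pow 2 t).mul_const N)).const_mul (-k)
      refine this.congr_deriv ?_
      simp
    rw [hess_line hψd y v (φ' := fun t => ε0 * (exp (-k * (q + t * M + t ^ 2 * N)) * (-k * (M + 2 * t * N))) - A * a)
        (s := ε0 * (exp (-k * q) * ((k * M) ^ 2 - 2 * k * N))) hl]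
    · rw [hea, heb, hM, ← hρ2]; ring
    · intro t
      have := (((hin t).exp.const_mul ε0).add ((((hasDerivAt_id' t).mul_const a).const_sub (dY x0 y)).const_mul A)).add_const B
      refine this.congr_deriv ?_
      ring
    · have h1 : HasDerivAt (fun t : ℝ => -k * (M + 2 * t * N)) (-k * (2 * N)) 0 := by
        have := ((((hasDerivAt_id' (0:ℝ)).const_mul 2).mul_const N).const_add M).const_mul (-k)
        refine this.congr_deriv ?_
        ring
      have := (((hin 0).exp.mul h1).const_mul ε0).sub_const (A * a)
      refine this.congr_deriv ?_
      have e1 : -k * (q + 0 * M + 0 ^ 2 * N) = -k * q := by ring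
      rw [e1]; ring

lemma exp_diff_ge (a b : ℝ) : exp b * (a - b) ≤ exp a - exp b := by
  have h1 := Real.add_one_le_exp (a - b)
  have h2 : exp a = exp b * exp (a - b) := by rw [← exp_add]; ring_nf
  rw [h2]
  nlinarith [exp_pos b]

set_option maxHeartbeats 1600000 in
lemma barrier2 {c C : ℝ} (hc : 0 < c) (hI : IConst c C) {V : E2 → ℝ} (hV : Cls c V) (hVc : ContinuousOn V (closedBall 0 1))
    {x0 : E2} (h0 : ‖x0‖ = 1) {r δ Γ η κ : ℝ} (hr : 0 < r) (hr1 : r ≤ 1) (hδ : 0 ≤ δ) (hΓ : 2 ≤ Γ)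
    (hη : η = 1 / (1024 * C)) (hκ : κ = 4 * (1 + 1 / c) / η ^ 2)
    (h1 : ∀ x, ‖x‖ ≤ 1 → ‖x - x0‖ ≤ r → -1 ≤ V x)
    (h2 : ∀ x, ‖x‖ = 1 → ‖x - x0‖ ≤ r → -δ ≤ V x)
    (h3 : ∀ x, ‖x‖ ≤ 1 → ‖x - x0‖ ≤ r → V x ≤ Γ + 1)
    (hP : Γ / 16 ≤ V ((1 - r / 8) • x0)) :
    ∀ x, ‖x‖ ≤ 1 → ‖x - x0‖ ≤ η / 2 * r →
      (exp (-κ / 64) * κ / 256 * Γ - (5 + 4 / c)) * dY x0 x / r - δ - Γ * κ * r / 1024 ≤ V x := by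
  intro x hx hxr
  have hb1 := barrier1 hc hV hVc h0 hr hδ h1 h2
  set K := 5 + 4 / c with hK
  have hK0 : 0 < K := by positivity
  have hC1 := hI.1
  have hη0 : 0 < η := by rw [hη]; positivity
  have hη1 : η ≤ 1 / 1024 := by
    rw [hη]; apply one_div_le_one_div_of_le <;> linarith
  have hκ0 : 0 < κ := by rw [hκ]; positivity
  set P := (1 - r / 8) • x0 with hPdef
  have hPn : ‖P‖ = 1 - r / 8 := by
    rw [hPdef, norm_smul, h0, mul_one, Real.norm_of_nonneg (by linarith)]
  have hPx : ‖P - x0‖ = r / 8 := by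
    have : P - x0 = (-(r / 8)) • x0 := by rw [hPdef]; module
    rw [this, norm_smul, h0, mul_one, norm_neg, Real.norm_of_nonneg (by linarith)]
  have hnear : ∀ y ∈ closedBall P (η * r), Γ / 32 ≤ V y := by
    intro y hy
    have ho := hV.osc hI (x := P) (R := r / 16) (S := 2 * Γ) (by linarith) (by rw [hPn]; linarith) (fun z hz => by
      rw [mem_closedBall, dist_eq_norm] at hz
      have a1 : ‖z‖ ≤ 1 := by
        have := norm_le_norm_add_norm_sub P z
        rw [norm_sub_rev] at this
        linarith
      have a2 : ‖z - x0‖ ≤ r := by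
        have := norm_sub_le_norm_sub_add_norm_sub z P x0
        linarith
      have := h1 z a1 a2
      have := h3 z a1 a2
      rw [abs_le]; constructor <;> linarith) (y := y) (y' := P)
      (closedBall_subset_closedBall (by have := mul_le_mul_of_nonneg_right hη1 hr.le; linarith) hy) (mem_closedBall_self (by linarith))
    rw [mem_closedBall, dist_eq_norm] at hy
    have : C * (2 * Γ) / (r / 16) * ‖y - P‖ ≤ C * (2 * Γ) / (r / 16) * (η * r) := by gcongr
    have e : C * (2 * Γ) / (r / 16) * (η * r) = Γ / 32 := by rw [hη]; field_simp; norm_num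
    rw [abs_le] at ho
    linarith [ho.1]
  set s := dZ x0 x with hs
  have hsr : |s| ≤ η / 2 * r := (abs_dZ_le h0 x).trans hxr
  have hs2 : s ^ 2 ≤ (η * r) ^ 2 / 4 := by
    rw [← sq_abs]
    have := pow_le_pow_left₀ (abs_nonneg s) hsr 2
    linarith
  have hηr : (η * r) ^ 2 ≤ r ^ 2 / 1048576 := by
    have := mul_le_mul_of_nonneg_right (pow_le_pow_left₀ hη0.le hη1 2) (sq_nonneg r)
    rw [mul_pow]; linarith
  set q : E2 → ℝ := fun y => (dZ x0 y - s) ^ 2 + (dY x0 y - r / 8) ^ 2 with hq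
  have hqc : Continuous q := by
    have a := (contDiff_dY x0 (n := 2)).continuous
    have b := (contDiff_dZ x0 (n := 2)).continuous
    rw [hq]; fun_prop
  have hnearq : ∀ y, q y ≤ (η * r / 2) ^ 2 → Γ / 32 ≤ V y := by
    intro y hy
    apply hnear
    rw [mem_closedBall, dist_eq_norm]
    apply le_of_sq_le_sq _ (by positivity)
    rw [hPdef, norm_sub_P_sq h0]
    have hy' : (dZ x0 y - s) ^ 2 + (dY x0 y - r / 8) ^ 2 ≤ (η * r / 2) ^ 2 := hy
    linarith [sq_nonneg (dZ x0 y - 2 * s), sq_nonneg (dY x0 y - r / 8)]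
  have hfarq : ∀ y, q y ≤ (r / 8) ^ 2 → ‖y - x0‖ ≤ r / 2 := by
    intro y hy
    apply le_of_sq_le_sq _ (by positivity)
    rw [dYZ_sq h0]
    have hy' : (dZ x0 y - s) ^ 2 + (dY x0 y - r / 8) ^ 2 ≤ (r / 8) ^ 2 := hy
    linarith [sq_nonneg (dZ x0 y - 2 * s), sq_nonneg (dY x0 y - r / 4), sq_nonneg r]
  set ε0 := Γ / 32 with hε0
  set k := κ / r ^ 2 with hk
  have hk0 : 0 < k := by positivity
  set B := - ε0 * exp (-κ / 64) - ε0 * κ * r / 32 - δ with hB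
  set ψ : E2 → ℝ := fun y => ε0 * exp (-k * ((dZ x0 y - s) ^ 2 + (dY x0 y - r / 8) ^ 2)) + (-(K / r)) * dY x0 y + B with hψ
  have hψd : ContDiff ℝ 2 ψ := by
    have a := contDiff_dY x0 (n := 2)
    have b := contDiff_dZ x0 (n := 2)
    rw [hψ]; fun_prop
  have hYx0 : 0 ≤ dY x0 x := dY_nonneg h0 hx
  have hYx1 : dY x0 x ≤ η / 2 * r := (le_abs_self _).trans ((abs_dY_le h0 x).trans hxr)
  have hηr' : η * r ≤ r / 1024 := by
    have := mul_le_mul_of_nonneg_right hη1 hr.le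
    linarith
  have hqx : q x = (r / 8 - dY x0 x) ^ 2 := by simp only [hq, hs]; ring
  have key := hV.compare hc (K := closedBall 0 1 ∩ q ⁻¹' (Icc ((η * r / 2) ^ 2) ((r / 8) ^ 2))) (G := ball 0 1 ∩ q ⁻¹' (Ioo ((η * r / 2) ^ 2) ((r / 8) ^ 2))) (ψ := ψ)
    ((isCompact_closedBall _ _).inter_right (isClosed_Icc.preimage hqc)) (isOpen_ball.inter (isOpen_Ioo.preimage hqc))
    (inter_subset_inter ball_subset_closedBall (preimage_mono Ioo_subset_Icc_self)) inter_subset_left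
    (hVc.mono inter_subset_left) hψd ?_ ?_ x ⟨by simpa using hx, ?_⟩
  · refine le_trans ?_ key
    have e1 : ψ x = ε0 * (exp (-k * q x) - exp (-κ / 64)) - ε0 * κ * r / 32 - δ - K * dY x0 x / r := by
      simp only [hψ, hB, hq]; ring
    have e2 := exp_diff_ge (-k * q x) (-κ / 64)
    have e3 : -k * q x - -κ / 64 ≥ κ * (dY x0 x / r) / 8 := by
      rw [hqx, hk]
      have : -(κ / r ^ 2) * (r / 8 - dY x0 x) ^ 2 - -κ / 64 = κ * ((dY x0 x / r) / 4 - (dY x0 x / r) ^ 2) := by field_simp; ring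
      rw [this]
      have t0 : 0 ≤ dY x0 x / r := by positivity
      have t1 : dY x0 x / r ≤ 1 / 8 := by rw [div_le_iff₀ hr]; linarith
      have : (dY x0 x / r) / 8 ≤ (dY x0 x / r) / 4 - (dY x0 x / r) ^ 2 := by
        have := mul_nonneg t0 (sub_nonneg.2 t1)
        linarith
      have := mul_le_mul_of_nonneg_left this hκ0.le
      linarith
    have e4 : exp (-κ / 64) * (κ * (dY x0 x / r) / 8) ≤ exp (-k * q x) - exp (-κ / 64) :=
      le_trans (by gcongr) e2
    have e5 := mul_le_mul_of_nonneg_left e4 (show 0 ≤ ε0 by positivity)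
    rw [e1]
    have e6 : (exp (-κ / 64) * κ / 256 * Γ - K) * dY x0 x / r - δ - Γ * κ * r / 1024 = ε0 * (exp (-κ / 64) * (κ * (dY x0 x / r) / 8)) - ε0 * κ * r / 32 - δ - K * dY x0 x / r := by
      rw [hε0]; ring
    linarith
  · rintro y ⟨hy1, hy2, hy3⟩
    apply exp_strictSub hc h0 (show 0 < ε0 by positivity) hk0 hψ
    have : 2 * k * (η * r / 2) ^ 2 = 2 * (1 + 1 / c) := by
      rw [hk, hκ]; field_simp; norm_num
    have h4 : 2 * k * (η * r / 2) ^ 2 < 2 * k * q y := by gcongr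
    have : 0 < 1 / c := by positivity
    change 1 + 1 / c < 2 * k * q y
    linarith
  · rintro y ⟨hy1, hy2, hy3⟩ hyG
    rw [mem_closedBall, dist_zero_right] at hy1
    have hyr := hfarq y hy3
    have hV1 := hb1 y hy1 hyr
    have hY0 := dY_nonneg h0 hy1
    have e1 : ψ y = ε0 * (exp (-k * q y) - exp (-κ / 64)) - ε0 * κ * r / 32 - δ - K * dY x0 y / r := by
      simp only [hψ, hB, hq]; ring
    have herr : 0 ≤ ε0 * κ * r / 32 := by positivity
    have hKY : 0 ≤ K * dY x0 y / r := by positivity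
    have hεp : 0 < ε0 := by positivity
    rw [e1]
    rcases hy1.lt_or_eq with hlt | heq
    · rcases hy2.lt_or_eq with hlt2 | heq2
      · rcases hy3.lt_or_eq with hlt3 | heq3
        · exact absurd ⟨by simpa using hlt, hlt2, hlt3⟩ hyG
        · have : -k * q y = -κ / 64 := by rw [heq3, hk]; field_simp; norm_num
          rw [this]; linarith
      · have h5 := hnearq y heq2.ge
        have h6 : exp (-k * q y) ≤ 1 := by
          rw [exp_le_one_iff]
          have : 0 ≤ k * q y := by simp only [hq]; positivity
          linarith
        have := exp_pos (-κ / 64)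
        have := mul_le_mul_of_nonneg_left (show exp (-k * q y) - exp (-κ / 64) ≤ 1 by linarith) hεp.le
        linarith
    · have hc1 := dY_circ h0 heq
      have hY2 : dY x0 y ≤ r ^ 2 / 8 := by
        have := pow_le_pow_left₀ (norm_nonneg _) hyr 2
        linarith
      have h5 : (r / 8) ^ 2 - r ^ 3 / 32 ≤ q y := by
        have : q y ≥ (dY x0 y - r / 8) ^ 2 := by
          simp only [hq]; linarith [sq_nonneg (dZ x0 y - s)]
        have := mul_le_mul_of_nonneg_left hY2 hr.le
        linarith [sq_nonneg (dY x0 y)]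
      have h6 := exp_diff_ge (-κ / 64) (-k * q y)
      have h7 : k * ((r / 8) ^ 2 - r ^ 3 / 32) ≤ k * q y := by gcongr
      have h8 : k * ((r / 8) ^ 2 - r ^ 3 / 32) = κ / 64 - κ * r / 32 := by rw [hk]; field_simp; ring
      have h9 : exp (-k * q y) ≤ 1 := by
          rw [exp_le_one_iff]
          have : 0 ≤ k * q y := by simp only [hq]; positivity
          linarith
      have h10 : exp (-k * q y) - exp (-κ / 64) ≤ κ * r / 32 := by
        have : exp (-k * q y) * (k * q y - κ / 64) ≥ exp (-k * q y) * (-(κ * r / 32)) := by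
          gcongr; linarith
        have : exp (-k * q y) * (κ * r / 32) ≤ 1 * (κ * r / 32) := by gcongr
        linarith
      have h11 := mul_le_mul_of_nonneg_left h10 hεp.le
      have : ε0 * (κ * r / 32) = ε0 * κ * r / 32 := by ring
      linarith
  · rw [mem_preimage, hqx]
    constructor
    · apply pow_le_pow_left₀ (by positivity); linarith
    · apply pow_le_pow_left₀ <;> linarith

lemma Cls.add_dY {c : ℝ} {v : E2 → ℝ} (h : Cls c v) (k m : ℝ) (x0 : E2) : Cls c (fun y => k * v y + m * dY x0 y) := by
  have := (h.smul k).add_affine ((-m * x0 0) • (EuclideanSpace.proj 0 : E2 →L[ℝ] ℝ) + (-m * x0 1) • (EuclideanSpace.proj 1 : E2 →L[ℝ] ℝ)) m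
  refine this.congr (fun y _ => ?_)
  change k * v y + ((-m * x0 0) * y 0 + (-m * x0 1) * y 1 + m) = _
  unfold dY
  ring

lemma dY_P {x0 : E2} (h0 : ‖x0‖ = 1) (s : ℝ) : dY x0 ((1 - s) • x0) = s := by
  have h := E2_norm_sq x0
  rw [h0] at h
  unfold dY
  simp only [PiLp.smul_apply, smul_eq_mul]
  linear_combination (1 - s) * h

lemma stepHalf {c C : ℝ} (hc : 0 < c) (hI : IConst c C) {f : E2 → ℝ} (hf : Cls c f) (hfc : ContinuousOn f (closedBall 0 1))
    {x0 : E2} (h0 : ‖x0‖ = 1) {r δ Γ η κ m W : ℝ} (hr : 0 < r) (hr1 : r ≤ 1) (hδ : 0 ≤ δ) (hΓ : 2 ≤ Γ) (hW : 0 < W)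
    (hη : η = 1 / (1024 * C)) (hκ : κ = 4 * (1 + 1 / c) / η ^ 2)
    (h1 : ∀ x, ‖x‖ ≤ 1 → ‖x - x0‖ ≤ r → m * dY x0 x - W ≤ f x)
    (h2 : ∀ x, ‖x‖ = 1 → ‖x - x0‖ ≤ r → m * dY x0 x - δ * W ≤ f x)
    (h3 : ∀ x, ‖x‖ ≤ 1 → ‖x - x0‖ ≤ r → f x ≤ (m + Γ * (W / r)) * dY x0 x + W) :
    (∀ x, ‖x‖ ≤ 1 → ‖x - x0‖ ≤ η / 2 * r → (m - (5 + 4 / c) * (W / r)) * dY x0 x - δ * W ≤ f x) ∧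
    ((m + Γ * (W / r) / 2) * (r / 8) ≤ f ((1 - r / 8) • x0) → ∀ x, ‖x‖ ≤ 1 → ‖x - x0‖ ≤ η / 2 * r →
      (m + (exp (-κ / 64) * κ / 256 * Γ - (5 + 4 / c)) * (W / r)) * dY x0 x - (δ + Γ * κ * r / 1024) * W ≤ f x) := by
  set V : E2 → ℝ := fun y => W⁻¹ * f y + (-(m * W⁻¹)) * dY x0 y with hVdef
  have hV : Cls c V := hf.add_dY _ _ _
  have hVc : ContinuousOn V (closedBall 0 1) := by
    have := (contDiff_dY x0 (n := 2)).continuous.continuousOn (s := closedBall 0 1)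
    exact (continuousOn_const.mul hfc).add (continuousOn_const.mul this)
  have hfV : ∀ x, f x = W * V x + m * dY x0 x := by
    intro x; simp only [hVdef]; field_simp; ring
  have g1 : ∀ x, ‖x‖ ≤ 1 → ‖x - x0‖ ≤ r → -1 ≤ V x := by
    intro x hx hxr
    have := h1 x hx hxr
    rw [hfV] at this
    nlinarith
  have g2 : ∀ x, ‖x‖ = 1 → ‖x - x0‖ ≤ r → -δ ≤ V x := by
    intro x hx hxr
    have := h2 x hx hxr
    rw [hfV] at this
    nlinarith
  have g3 : ∀ x, ‖x‖ ≤ 1 → ‖x - x0‖ ≤ r → V x ≤ Γ + 1 := by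
    intro x hx hxr
    have a := h3 x hx hxr
    rw [hfV] at a
    have hY : dY x0 x ≤ r := (le_abs_self _).trans ((abs_dY_le h0 x).trans hxr)
    have hY' : Γ * (W / r) * dY x0 x ≤ Γ * (W / r) * r := by gcongr
    have e : Γ * (W / r) * r = Γ * W := by field_simp
    have : W * V x ≤ W * (Γ + 1) := by linarith
    exact le_of_mul_le_mul_left this hW
  have hη0 : η ≤ 1 := by
    rw [hη, div_le_one (by linarith [hI.1])]; linarith [hI.1]
  constructor
  · intro x hx hxr
    have a := barrier1 hc hV hVc h0 hr hδ g1 g2 x hx (hxr.trans (by nlinarith))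
    have := mul_le_mul_of_nonneg_left a hW.le
    rw [hfV]
    have e : W * (-δ - (5 + 4 / c) * dY x0 x / r) = - ((5 + 4 / c) * (W / r)) * dY x0 x - δ * W := by ring
    linarith
  · intro hP x hx hxr
    have a := barrier2 hc hI hV hVc h0 hr hr1 hδ hΓ hη hκ g1 g2 g3 (by
      rw [hfV, dY_P h0] at hP
      have e : (m + Γ * (W / r) / 2) * (r / 8) = W * (Γ / 16) + m * (r / 8) := by field_simp; ring
      rw [e] at hP
      exact le_of_mul_le_mul_left (by linarith) hW) x hx hxr
    have := mul_le_mul_of_nonneg_left a hW.le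
    rw [hfV]
    have e : W * ((exp (-κ / 64) * κ / 256 * Γ - (5 + 4 / c)) * dY x0 x / r - δ - Γ * κ * r / 1024) =
      ((exp (-κ / 64) * κ / 256 * Γ - (5 + 4 / c)) * (W / r)) * dY x0 x - (δ + Γ * κ * r / 1024) * W := by ring
    linarith

lemma stepFull {c C : ℝ} (hc : 0 < c) (hI : IConst c C) {f : E2 → ℝ} (hf : Cls c f) (hfc : ContinuousOn f (closedBall 0 1))
    {x0 : E2} (h0 : ‖x0‖ = 1) {r δ Γ η κ m W θ : ℝ} (hr : 0 < r) (hr1 : r ≤ 1) (hδ : 0 ≤ δ) (hΓ : 2 ≤ Γ) (hW : 0 < W)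
    (hη : η = 1 / (1024 * C)) (hκ : κ = 4 * (1 + 1 / c) / η ^ 2) (hθ : θ = exp (-κ / 64) * κ / 256)
    (hΓ2 : 2 * (5 + 4 / c) ≤ θ / 2 * Γ)
    (hsm : δ + Γ * κ * r / 1024 ≤ (η / 2) ^ 2)
    (h1 : ∀ x, ‖x‖ ≤ 1 → ‖x - x0‖ ≤ r → m * dY x0 x - W ≤ f x)
    (h2 : ∀ x, ‖x‖ = 1 → ‖x - x0‖ ≤ r → m * dY x0 x - δ * W ≤ f x)
    (h2' : ∀ x, ‖x‖ = 1 → ‖x - x0‖ ≤ r → f x ≤ (m + Γ * (W / r)) * dY x0 x + δ * W)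
    (h3 : ∀ x, ‖x‖ ≤ 1 → ‖x - x0‖ ≤ r → f x ≤ (m + Γ * (W / r)) * dY x0 x + W) :
    ∃ m', |m' - m| ≤ (θ * Γ + (5 + 4 / c)) * (W / r) ∧ ∀ x, ‖x‖ ≤ 1 → ‖x - x0‖ ≤ η / 2 * r →
      m' * dY x0 x - (η / 2) ^ 2 * W ≤ f x ∧ f x ≤ (m' + (1 - θ / 2) * Γ * (W / r)) * dY x0 x + (η / 2) ^ 2 * W := by
  have A := stepHalf hc hI hf hfc h0 hr hr1 hδ hΓ hW hη hκ h1 h2 h3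
  have A' := stepHalf hc hI hf.neg hfc.neg h0 (m := -(m + Γ * (W / r))) hr hr1 hδ hΓ hW hη hκ
    (fun x a b => by have := h3 x a b; linarith) (fun x a b => by have := h2' x a b; linarith)
    (fun x a b => by have := h1 x a b; linarith)
  rw [← hθ] at A A'
  have hη0 : 0 < η := by rw [hη]; have := hI.1; positivity
  have hκ0 : 0 < κ := by rw [hκ]; positivity
  have hθ0 : 0 < θ := by rw [hθ]; positivity
  set K := 5 + 4 / c with hK
  have hK0 : 0 < K := by positivity
  have hw : 0 < W / r := by positivity
  have hδW : δ * W ≤ (η / 2) ^ 2 * W := by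
    apply mul_le_mul_of_nonneg_right _ hW.le
    have : 0 ≤ Γ * κ * r / 1024 := by positivity
    linarith
  have hδW2 : (δ + Γ * κ * r / 1024) * W ≤ (η / 2) ^ 2 * W := by
    apply mul_le_mul_of_nonneg_right hsm hW.le
  have hwid : ∀ y, 0 ≤ y → (Γ + 2 * K - θ * Γ) * (W / r) * y ≤ (1 - θ / 2) * Γ * (W / r) * y := by
    intro y hy
    apply mul_le_mul_of_nonneg_right _ hy
    apply mul_le_mul_of_nonneg_right _ hw.le
    linarith
  by_cases hP : (m + Γ * (W / r) / 2) * (r / 8) ≤ f ((1 - r / 8) • x0)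
  · refine ⟨m + (θ * Γ - K) * (W / r), ?_, fun x hx hxr => ⟨?_, ?_⟩⟩
    · rw [add_sub_cancel_left, abs_mul, abs_of_pos hw]
      apply mul_le_mul_of_nonneg_right _ hw.le
      rw [abs_le]; constructor <;> nlinarith
    · have := A.2 hP x hx hxr
      linarith
    · have a := A'.1 x hx hxr
      have := hwid _ (dY_nonneg h0 hx)
      linarith
  · refine ⟨m - K * (W / r), ?_, fun x hx hxr => ⟨?_, ?_⟩⟩
    · rw [sub_sub_cancel_left, abs_neg, abs_mul, abs_of_pos hw, abs_of_pos hK0]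
      apply mul_le_mul_of_nonneg_right _ hw.le
      nlinarith
    · have := A.1 x hx hxr
      linarith
    · push Not at hP
      have a := A'.2 (by linarith) x hx hxr
      have := hwid _ (dY_nonneg h0 hx)
      linarith

lemma exists_alpha {μ θ β : ℝ} (hμ : 0 < μ) (hθ : 0 < θ) (hβ : 0 < β) : ∃ α, 0 < α ∧ α ≤ β ∧ α < 1 ∧ 1 - θ / 2 ≤ μ ^ α := by
  have h : Filter.Tendsto (fun α : ℝ => μ ^ α) (nhdsWithin 0 (Ioi 0)) (nhds 1) := by
    have : ContinuousAt (fun α : ℝ => μ ^ α) 0 := Real.continuousAt_const_rpow hμ.ne'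
    have h2 := this.tendsto
    rw [Real.rpow_zero] at h2
    exact h2.mono_left nhdsWithin_le_nhds
  have h1 := h.eventually (eventually_ge_nhds (show 1 - θ / 2 < 1 by linarith))
  have h2 : ∀ᶠ α : ℝ in nhdsWithin 0 (Ioi 0), α ∈ Ioo (0:ℝ) (min β 1) := Ioo_mem_nhdsGT (lt_min hβ one_pos)
  obtain ⟨α, ha, hb⟩ := (h1.and h2).exists
  exact ⟨α, hb.1, hb.2.le.trans (min_le_left _ _), hb.2.trans_le (min_le_right _ _), ha⟩

lemma exists_r0 {α k e : ℝ} (hα : 0 < α) (he : 0 < e) : ∃ r, 0 < r ∧ r ≤ 1 ∧ r ^ α + k * r ≤ e := by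
  have h : Filter.Tendsto (fun r : ℝ => r ^ α + k * r) (nhdsWithin 0 (Ioi 0)) (nhds 0) := by
    have : ContinuousAt (fun r : ℝ => r ^ α + k * r) 0 :=
      (Real.continuousAt_rpow_const 0 α (Or.inr hα.le)).add (continuousAt_const.mul continuousAt_id)
    have h2 := this.tendsto
    rw [Real.zero_rpow hα.ne'] at h2
    simp only [mul_zero, add_zero] at h2
    exact h2.mono_left nhdsWithin_le_nhds
  have h1 := h.eventually (eventually_le_nhds he)
  have h2 : ∀ᶠ α : ℝ in nhdsWithin 0 (Ioi 0), α ∈ Ioo (0:ℝ) 1 := Ioo_mem_nhdsGT one_pos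
  obtain ⟨r, ha, hb⟩ := (h1.and h2).exists
  exact ⟨r, hb.1, hb.2.le, ha⟩

set_option maxHeartbeats 1600000 in
lemma bdry_iter {c C β : ℝ} (hc : 0 < c) (hI : IConst c C) (hβ : 0 < β) : ∃ α D : ℝ, 0 < α ∧ α ≤ β ∧ α < 1 ∧ 0 < D ∧
    ∀ (v : E2 → ℝ) (x0 : E2), Cls c v → ContinuousOn v (closedBall 0 1) → ‖x0‖ = 1 →
    (∀ x, ‖x‖ = 1 → |v x| ≤ ‖x - x0‖ ^ (1 + α)) → (∀ x, ‖x‖ ≤ 1 → |v x| ≤ ‖x - x0‖) →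
    ∃ m, |m| ≤ D ∧ ∀ x, ‖x‖ ≤ 1 → |v x - m * dY x0 x| ≤ D * ‖x - x0‖ ^ (1 + α) := by
  have hC1 := hI.1
  obtain ⟨η, hη⟩ : ∃ η, η = 1 / (1024 * C) := ⟨_, rfl⟩
  obtain ⟨κ, hκ⟩ : ∃ κ, κ = 4 * (1 + 1 / c) / η ^ 2 := ⟨_, rfl⟩
  obtain ⟨θ, hθ⟩ : ∃ θ, θ = exp (-κ / 64) * κ / 256 := ⟨_, rfl⟩
  obtain ⟨K, hK⟩ : ∃ K, K = 5 + 4 / c := ⟨_, rfl⟩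
  have hη0 : 0 < η := by rw [hη]; positivity
  have hη1 : η ≤ 1 := by
    rw [hη, div_le_one (by linarith)]; linarith
  have hκ0 : 0 < κ := by rw [hκ]; positivity
  have hθ0 : 0 < θ := by rw [hθ]; positivity
  have hK0 : 0 < K := by rw [hK]; positivity
  obtain ⟨Γ, hΓ, hΓ2⟩ : ∃ Γ : ℝ, 2 ≤ Γ ∧ 2 * K ≤ θ / 2 * Γ := by
    refine ⟨max 2 (4 * K / θ), le_max_left _ _, ?_⟩
    have := mul_le_mul_of_nonneg_left (le_max_right 2 (4 * K / θ)) (show 0 ≤ θ / 2 by positivity)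
    refine le_trans (le_of_eq ?_) this
    field_simp; norm_num
  obtain ⟨μ, hμ⟩ : ∃ μ, μ = η / 2 := ⟨_, rfl⟩
  have hμ0 : 0 < μ := by rw [hμ]; positivity
  have hμ1 : μ < 1 := by rw [hμ]; linarith
  obtain ⟨α, hα0, hαβ, hα1, hαμ⟩ := exists_alpha hμ0 hθ0 hβ
  obtain ⟨a, ha⟩ : ∃ a, a = μ ^ α := ⟨_, rfl⟩
  rw [← ha] at hαμ
  have ha0 : 0 < a := by rw [ha]; positivity
  have ha1 : a < 1 := by rw [ha]; exact Real.rpow_lt_one hμ0.le hμ1 hα0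
  have hμa : μ ≤ a := by
    have := Real.rpow_le_rpow_of_exponent_ge hμ0 hμ1.le hα1.le
    rwa [Real.rpow_one, ← ha] at this
  obtain ⟨D1, hD1⟩ : ∃ D1, D1 = θ * Γ + K := ⟨_, rfl⟩
  have hD10 : 0 < D1 := by rw [hD1]; positivity
  have h1a : 0 < 1 - a := by linarith
  obtain ⟨ms, hms⟩ : ∃ ms, ms = Γ / 2 + D1 / (1 - a) := ⟨_, rfl⟩
  have hms0 : 0 < ms := by rw [hms]; positivity
  obtain ⟨r0, hr0, hr01, hr0s⟩ := exists_r0 (k := ms + Γ + Γ * κ / 1024) hα0 (show 0 < μ ^ 2 by positivity)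
  obtain ⟨δ, hδ⟩ : ∃ δ, δ = r0 ^ α + (ms + Γ) * r0 := ⟨_, rfl⟩
  have hδ0 : 0 ≤ δ := by rw [hδ]; positivity
  have hr0α : 0 < r0 ^ α := by positivity
  obtain ⟨D, hD⟩ : ∃ D, D = ms + (Γ + D1 / (1 - a) + 1 / μ) / (a * r0 ^ α) + (1 + ms) / r0 ^ α := ⟨_, rfl⟩
  have hDa : ms ≤ D := by
    rw [hD, add_assoc]; apply le_add_of_nonneg_right; positivity
  have hDb : (Γ + D1 / (1 - a) + 1 / μ) / (a * r0 ^ α) ≤ D := by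
    have : 0 ≤ (1 + ms) / r0 ^ α := by positivity
    rw [hD]; linarith
  have hDc : (1 + ms) / r0 ^ α ≤ D := by
    have : 0 ≤ (Γ + D1 / (1 - a) + 1 / μ) / (a * r0 ^ α) := by positivity
    rw [hD]; linarith
  have hD0 : 0 < D := by linarith
  refine ⟨α, D, hα0, hαβ, hα1, hD0, ?_⟩
  intro v x0 hv hvc h0 hcirc hlin
  -- invariant
  let H : ℕ → ℝ → Prop := fun k m => |m| ≤ Γ / 2 + D1 * ((1 - a ^ k) / (1 - a)) ∧ ∀ x, ‖x‖ ≤ 1 → ‖x - x0‖ ≤ r0 * μ ^ k →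
    m * dY x0 x - r0 * (μ * a) ^ k ≤ v x ∧ v x ≤ (m + Γ * a ^ k) * dY x0 x + r0 * (μ * a) ^ k
  have hHms : ∀ k m, H k m → |m| ≤ ms := by
    intro k m h
    refine h.1.trans ?_
    rw [hms]
    have : (1 - a ^ k) / (1 - a) ≤ 1 / (1 - a) := by
      gcongr
      have : 0 ≤ a ^ k := by positivity
      linarith
    have := mul_le_mul_of_nonneg_left this hD10.le
    rw [mul_one_div] at this
    linarith
  have hbase : H 0 (-(Γ / 2)) := by
    constructor
    · rw [abs_neg, abs_of_nonneg (by linarith)]; simp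
    · intro x hx hxr
      have h1 := abs_le.mp (hlin x hx)
      have hY := dY_nonneg h0 hx
      simp only [pow_zero, mul_one] at *
      constructor <;> nlinarith
  have hstep : ∀ k m, H k m → ∃ m', |m' - m| ≤ D1 * a ^ k ∧ H (k + 1) m' := by
    intro k m h
    have hmk := hHms k m h
    have hμk : 0 < μ ^ k := by positivity
    have hμk1 : μ ^ k ≤ 1 := pow_le_one₀ hμ0.le hμ1.le
    have hak : 0 < a ^ k := by positivity
    have hak1 : a ^ k ≤ 1 := pow_le_one₀ ha0.le ha1.le
    have hr : 0 < r0 * μ ^ k := by positivity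
    have hr1 : r0 * μ ^ k ≤ r0 := by nlinarith
    have hW : 0 < r0 * (μ * a) ^ k := by positivity
    have hWr : r0 * (μ * a) ^ k / (r0 * μ ^ k) = a ^ k := by rw [mul_pow]; field_simp
    have hcb : ∀ M : ℝ, |M| ≤ ms + Γ → ∀ x, ‖x‖ = 1 → ‖x - x0‖ ≤ r0 * μ ^ k → |v x - M * dY x0 x| ≤ δ * (r0 * (μ * a) ^ k) := by
      intro M hM x hx hxr
      have b1 : |v x| ≤ r0 ^ α * (r0 * (μ * a) ^ k) := by
        refine (hcirc x hx).trans ?_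
        have : ‖x - x0‖ ^ (1 + α) ≤ (r0 * μ ^ k) ^ (1 + α) := by gcongr
        refine this.trans (le_of_eq ?_)
        rw [Real.rpow_add hr, Real.rpow_one, Real.mul_rpow hr0.le hμk.le, ha, mul_pow, ← Real.rpow_natCast, ← Real.rpow_natCast,
          ← Real.rpow_mul hμ0.le, ← Real.rpow_mul hμ0.le, mul_comm (k:ℝ) α]
        ring
      have b2 : |M * dY x0 x| ≤ (ms + Γ) * r0 * (r0 * (μ * a) ^ k) := by
        have hY := dY_circ h0 hx
        have hY0 := dY_nonneg h0 hx.le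
        rw [abs_mul, abs_of_nonneg hY0]
        have c1 : ‖x - x0‖ ^ 2 ≤ (r0 * μ ^ k) ^ 2 := by gcongr
        have c2 : dY x0 x ≤ (r0 * μ ^ k) ^ 2 := by
          have : 0 ≤ (r0 * μ ^ k) ^ 2 := by positivity
          linarith
        have c3 : (r0 * μ ^ k) ^ 2 ≤ r0 * (r0 * (μ * a) ^ k) := by
          have : (μ * μ) ^ k ≤ (μ * a) ^ k := by gcongr
          calc (r0 * μ ^ k) ^ 2 = r0 * (r0 * (μ * μ) ^ k) := by rw [mul_pow μ μ]; ring
            _ ≤ _ := by gcongr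
        calc |M| * dY x0 x ≤ (ms + Γ) * (r0 * (r0 * (μ * a) ^ k)) := by gcongr; exact c2.trans c3
          _ = _ := by ring
      have := abs_sub (v x) (M * dY x0 x)
      rw [hδ, add_mul]
      linarith
    have hM : |m + Γ * a ^ k| ≤ ms + Γ := by
      refine (abs_add_le _ _).trans ?_
      rw [abs_of_pos (show 0 < Γ * a ^ k by positivity)]
      have : Γ * a ^ k ≤ Γ * 1 := by gcongr
      linarith
    obtain ⟨m', hm', hm''⟩ := stepFull hc hI hv hvc h0 (r := r0 * μ ^ k) (W := r0 * (μ * a) ^ k) (m := m) (δ := δ) (Γ := Γ) hr (hr1.trans hr01) hδ0 hΓ hW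
      hη hκ hθ (by rw [← hK]; exact hΓ2) (by
        rw [← hμ, hδ]
        have : Γ * κ * (r0 * μ ^ k) / 1024 ≤ Γ * κ * r0 / 1024 := by gcongr
        have e : Γ * κ / 1024 * r0 = Γ * κ * r0 / 1024 := by ring
        rw [add_mul, e] at hr0s
        linarith)
      (fun x hx hxr => (h.2 x hx hxr).1)
      (fun x hx hxr => by
        have := abs_le.mp (hcb m (by linarith) x hx hxr)
        linarith [this.1])
      (fun x hx hxr => by
        rw [hWr]
        have := abs_le.mp (hcb _ hM x hx hxr)
        linarith [this.2])
      (fun x hx hxr => by rw [hWr]; exact (h.2 x hx hxr).2)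
    rw [hWr] at hm' hm''
    rw [← hK, ← hD1] at hm'
    rw [← hμ] at hm''
    refine ⟨m', hm', ?_, ?_⟩
    · have e : (1 - a ^ (k + 1)) / (1 - a) = (1 - a ^ k) / (1 - a) + a ^ k := by
        field_simp; ring
      rw [e, mul_add]
      have h1 := h.1
      have := abs_sub_abs_le_abs_sub m' m
      linarith
    · intro x hx hxr
      have b := hm'' x hx (by rw [pow_succ] at hxr; linarith)
      have hY := dY_nonneg h0 hx
      have e1 : μ ^ 2 * (r0 * (μ * a) ^ k) ≤ r0 * (μ * a) ^ (k + 1) := by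
        calc μ ^ 2 * (r0 * (μ * a) ^ k) = (μ * μ) * (r0 * (μ * a) ^ k) := by ring
          _ ≤ (μ * a) * (r0 * (μ * a) ^ k) := by gcongr
          _ = _ := by ring
      have e2 : (1 - θ / 2) * Γ * a ^ k * dY x0 x ≤ Γ * a ^ (k + 1) * dY x0 x := by
        apply mul_le_mul_of_nonneg_right _ hY
        calc (1 - θ / 2) * Γ * a ^ k ≤ a * Γ * a ^ k := by gcongr
          _ = _ := by ring
      constructor
      · linarith [b.1]
      · linarith [b.2]
  choose! nx hnx1 hnx2 using hstep
  let mm : ℕ → ℝ := fun k => Nat.rec (-(Γ / 2)) (fun k m => nx k m) k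
  have hmm : ∀ k, H k (mm k) := by
    intro k
    induction k with
    | zero => exact hbase
    | succ k ih => exact hnx2 k (mm k) ih
  have hmd : ∀ k, dist (mm k) (mm (k + 1)) ≤ D1 * a ^ k := by
    intro k
    rw [dist_comm, Real.dist_eq]
    exact hnx1 k (mm k) (hmm k)
  obtain ⟨m, hm⟩ := cauchySeq_tendsto_of_complete (cauchySeq_of_le_geometric a D1 ha1 hmd)
  have hmk : ∀ k, |mm k - m| ≤ D1 * a ^ k / (1 - a) := by
    intro k
    have := dist_le_of_le_geometric_of_tendsto a D1 ha1 hmd hm k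
    rwa [Real.dist_eq] at this
  have hmms : |m| ≤ ms := by
    apply le_of_tendsto hm.abs
    exact Filter.Eventually.of_forall fun k => hHms k _ (hmm k)
  refine ⟨m, hmms.trans hDa, ?_⟩
  intro x hx
  have hY0 := dY_nonneg h0 hx
  have hYt : dY x0 x ≤ ‖x - x0‖ := (le_abs_self _).trans (abs_dY_le h0 x)
  have hl := hlin x hx
  obtain ⟨t, ht⟩ : ∃ t, t = ‖x - x0‖ := ⟨_, rfl⟩
  have ht0 : 0 ≤ t := by rw [ht]; positivity
  rw [← ht] at hYt hl ⊢
  rcases ht0.eq_or_lt with h00 | htp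
  · rw [← h00] at hYt hl
    have e1 : v x = 0 := by
      rw [← abs_eq_zero]; exact le_antisymm hl (abs_nonneg _)
    have e2 : dY x0 x = 0 := le_antisymm hYt hY0
    rw [e1, e2, ← h00]; simp
    apply mul_nonneg (by linarith) (by positivity)
  have htα : t ^ (1 + α) = t * t ^ α := by rw [Real.rpow_add htp, Real.rpow_one]
  rcases lt_or_ge r0 t with hlt | hle
  · have b1 : |v x - m * dY x0 x| ≤ (1 + ms) * t := by
      have h1 := abs_sub (v x) (m * dY x0 x)
      rw [abs_mul, abs_of_nonneg hY0] at h1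
      have : |m| * dY x0 x ≤ ms * t := by gcongr
      linarith
    refine b1.trans ?_
    have b2 : r0 ^ α ≤ t ^ α := by gcongr
    calc (1 + ms) * t = (1 + ms) / r0 ^ α * (t * r0 ^ α) := by field_simp
      _ ≤ D * (t * t ^ α) := by gcongr
      _ = _ := by rw [htα]
  · obtain ⟨k, hk1, hk2⟩ := exists_nat_pow_near_of_lt_one (x := t / r0) (y := μ) (by positivity) (by rw [div_le_one hr0]; exact hle) hμ0 hμ1
    have hk1' := hk1
    rw [lt_div_iff₀ hr0] at hk1
    rw [div_le_iff₀ hr0] at hk2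
    have b := (hmm k).2 x hx (by rw [← ht]; linarith)
    have hak : 0 < a ^ k := by positivity
    have hdm := abs_le.mp (hmk k)
    have hW : r0 * (μ * a) ^ k ≤ a ^ k * t * (1 / μ) := by
      rw [mul_one_div, le_div_iff₀ hμ0, mul_pow]
      calc r0 * (μ ^ k * a ^ k) * μ = a ^ k * (μ ^ (k + 1) * r0) := by ring
        _ ≤ a ^ k * t := by gcongr
    have hmY : |(mm k - m) * dY x0 x| ≤ D1 * a ^ k / (1 - a) * t := by
      rw [abs_mul, abs_of_nonneg hY0]
      gcongr
      exact hmk k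
    have hΓY : Γ * a ^ k * dY x0 x ≤ Γ * a ^ k * t := by gcongr
    have hΓY0 : 0 ≤ Γ * a ^ k * dY x0 x := by positivity
    have b3 : |v x - m * dY x0 x| ≤ a ^ k * t * (Γ + D1 / (1 - a) + 1 / μ) := by
      have e : a ^ k * t * (Γ + D1 / (1 - a) + 1 / μ) = Γ * a ^ k * t + D1 * a ^ k / (1 - a) * t + a ^ k * t * (1 / μ) := by ring
      rw [e]
      rw [abs_le] at hmY ⊢
      constructor <;> linarith
    have b4 : a ^ k * a ≤ t ^ α / r0 ^ α := by
      rw [← Real.div_rpow ht0 hr0.le]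
      have : (μ ^ (k + 1)) ^ α ≤ (t / r0) ^ α := by gcongr
      refine le_trans (le_of_eq ?_) this
      rw [← pow_succ, ha, ← Real.rpow_natCast, ← Real.rpow_natCast, ← Real.rpow_mul hμ0.le, ← Real.rpow_mul hμ0.le, mul_comm]
    refine b3.trans ?_
    have hQ : 0 < Γ + D1 / (1 - a) + 1 / μ := by positivity
    calc a ^ k * t * (Γ + D1 / (1 - a) + 1 / μ) = (a ^ k * a) * (t * (Γ + D1 / (1 - a) + 1 / μ) / a) := by field_simp
      _ ≤ (t ^ α / r0 ^ α) * (t * (Γ + D1 / (1 - a) + 1 / μ) / a) := by gcongr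
      _ = (Γ + D1 / (1 - a) + 1 / μ) / (a * r0 ^ α) * (t * t ^ α) := by field_simp
      _ ≤ D * (t * t ^ α) := by gcongr
      _ = _ := by rw [htα]

/-- closed-disc gradient -/
def pg (u : E2 → ℝ) : E2 → E2 →L[ℝ] ℝ := fderivWithin ℝ u (closedBall 0 1)

lemma udiff : UniqueDiffOn ℝ (closedBall (0:E2) 1) := by
  apply uniqueDiffOn_convex (convex_closedBall _ _)
  exact ⟨0, mem_interior.mpr ⟨ball 0 1, ball_subset_closedBall, isOpen_ball, by simp⟩⟩

lemma pg_ball (u : E2 → ℝ) {x : E2} (hx : x ∈ ball (0:E2) 1) : pg u x = fderiv ℝ u x :=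
  fderivWithin_of_mem_nhds (Filter.mem_of_superset (isOpen_ball.mem_nhds hx) ball_subset_closedBall)

lemma pg_cont {u : E2 → ℝ} (hu : ContDiffOn ℝ 2 u (closedBall (0 : E2) 1)) : ContinuousOn (pg u) (closedBall 0 1) :=
  hu.continuousOn_fderivWithin udiff (by norm_num)

lemma diffAt_fderiv {u : E2 → ℝ} (hu : ContDiffOn ℝ 2 u (closedBall (0 : E2) 1)) {x : E2} (hx : x ∈ ball (0:E2) 1) :
    DifferentiableAt ℝ (fderiv ℝ u) x := by
  have h1 : ContDiffAt ℝ 2 u x := (hu.contDiffAt (Filter.mem_of_superset (isOpen_ball.mem_nhds hx) ball_subset_closedBall))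
  have h2 : ContDiffAt ℝ 1 (fderiv ℝ u) x := h1.fderiv_right (by norm_num)
  exact h2.differentiableAt (by norm_num)

lemma radial_tendsto {X : Type*} [TopologicalSpace X] {f : E2 → X} (hf : ContinuousOn f (closedBall (0 : E2) 1)) {x : E2} (hx : ‖x‖ ≤ 1) :
    Filter.Tendsto (fun t : ℝ => f (t • x)) (nhdsWithin 1 (Iio 1)) (nhds (f x)) := by
  have h1 : ContinuousWithinAt f (closedBall 0 1) x := hf x (by simpa using hx)
  apply Filter.Tendsto.comp h1
  rw [tendsto_nhdsWithin_iff]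
  constructor
  · have : Continuous (fun t : ℝ => t • x) := by fun_prop
    have := (this.tendsto 1)
    rw [one_smul] at this
    exact this.mono_left nhdsWithin_le_nhds
  · have : ∀ᶠ t : ℝ in nhdsWithin 1 (Iio 1), t ∈ Ioo (0:ℝ) 1 := Ioo_mem_nhdsLT one_pos
    filter_upwards [this] with t ht
    rw [mem_closedBall, dist_zero_right, norm_smul, Real.norm_of_nonneg ht.1.le]
    nlinarith [ht.1, ht.2, norm_nonneg x]

lemma radial_mem {x : E2} (hx : ‖x‖ ≤ 1) : ∀ᶠ t : ℝ in nhdsWithin 1 (Iio 1), t • x ∈ ball (0:E2) 1 := by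
  have : ∀ᶠ t : ℝ in nhdsWithin 1 (Iio 1), t ∈ Ioo (0:ℝ) 1 := Ioo_mem_nhdsLT one_pos
  filter_upwards [this] with t ht
  rw [mem_ball, dist_zero_right, norm_smul, Real.norm_of_nonneg ht.1.le]
  nlinarith [ht.1, ht.2, norm_nonneg x]

lemma pg_bound {u : E2 → ℝ} (hu : ContDiffOn ℝ 2 u (closedBall (0 : E2) 1)) {K : ℝ}
    (hK : ∀ x ∈ ball (0:E2) 1, ‖fderiv ℝ u x‖ ≤ K) {x : E2} (hx : ‖x‖ ≤ 1) : ‖pg u x‖ ≤ K := by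
  apply le_of_tendsto (radial_tendsto (pg_cont hu) hx).norm
  filter_upwards [radial_mem hx] with t ht
  rw [pg_ball u ht]; exact hK _ ht

lemma pg_lip {u : E2 → ℝ} (hu : ContDiffOn ℝ 2 u (closedBall (0 : E2) 1)) {K : ℝ}
    (hK : ∀ x ∈ ball (0:E2) 1, ‖fderiv ℝ (fderiv ℝ u) x‖ ≤ K) {x y : E2} (hx : ‖x‖ ≤ 1) (hy : ‖y‖ ≤ 1) :
    ‖pg u x - pg u y‖ ≤ K * ‖x - y‖ := by
  have h1 := ((radial_tendsto (pg_cont hu) hx).sub (radial_tendsto (pg_cont hu) hy)).norm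
  have h2 := ((radial_tendsto continuousOn_id hx).sub (radial_tendsto continuousOn_id hy)).norm.const_mul K
  apply le_of_tendsto_of_tendsto h1 h2
  filter_upwards [radial_mem hx, radial_mem hy] with t htx hty
  simp only [pg_ball u htx, pg_ball u hty, id]
  exact (convex_ball (0:E2) 1).norm_image_sub_le_of_norm_fderiv_le (fun z hz => diffAt_fderiv hu hz) hK hty htx

lemma onCircle_deriv {u g : E2 → ℝ} (hu : ContDiffOn ℝ 2 u (closedBall (0 : E2) 1)) (hug : ∀ x ∈ sphere (0 : E2) 1, u x = g x) (t : ℝ) :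
    HasDerivAt (onCircle g) (pg u (circPt t) (tauPt t)) t := by
  have e : onCircle g = u ∘ circPt := by
    ext t; exact (hug _ (by simp [norm_circPt])).symm
  rw [e]
  have hm : ∀ s, circPt s ∈ closedBall (0:E2) 1 := fun s => by simp [norm_circPt]
  have h1 : HasFDerivWithinAt u (pg u (circPt t)) (closedBall 0 1) (circPt t) :=
    (hu.differentiableOn (by norm_num) _ (hm t)).hasFDerivWithinAt
  exact h1.comp_hasDerivAt t (hasDerivAt_circPt t) (Filter.Eventually.of_forall hm)

lemma exists_circPt_near {x : E2} (hx : ‖x‖ = 1) (t0 : ℝ) : ∃ t, x = circPt t ∧ |t - t0| ≤ π := by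
  obtain ⟨t, ht⟩ := exists_circPt hx
  refine ⟨t - round ((t - t0) / (2 * π)) * (2 * π), ?_, ?_⟩
  · rw [ht, circPt_eq, circPt_eq, cos_sub_int_mul_two_pi, sin_sub_int_mul_two_pi]
  · have h := abs_sub_round ((t - t0) / (2 * π))
    have e : t - round ((t - t0) / (2 * π)) * (2 * π) - t0 = ((t - t0) / (2 * π) - round ((t - t0) / (2 * π))) * (2 * π) := by
      have := pi_pos; field_simp; ring
    rw [e, abs_mul, abs_of_pos (show 0 < 2 * π by positivity)]
    nlinarith [pi_pos]

lemma chord_sq (t t0 : ℝ) : ‖circPt t - circPt t0‖ ^ 2 = 2 - 2 * cos (t - t0) := by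
  rw [E2_norm_sq, cos_sub]
  simp only [PiLp.sub_apply, circPt_zero', circPt_one']
  nlinarith [sin_sq_add_cos_sq t, sin_sq_add_cos_sq t0]

lemma chord_le (t t0 : ℝ) : ‖circPt t - circPt t0‖ ≤ |t - t0| := by
  apply le_of_sq_le_sq _ (abs_nonneg _)
  rw [chord_sq, sq_abs]
  have := one_sub_sq_div_two_le_cos (x := t - t0)
  linarith

lemma chord_ge {t t0 : ℝ} (h : |t - t0| ≤ π) : |t - t0| ≤ 2 * ‖circPt t - circPt t0‖ := by
  apply le_of_sq_le_sq _ (by positivity)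
  rw [mul_pow, chord_sq, sq_abs]
  have h1 := cos_le_one_sub_mul_cos_sq h
  have h2 : 1 / 8 ≤ 2 / π ^ 2 := by
    rw [div_le_div_iff₀ (by norm_num) (by positivity)]
    have := pi_lt_four; have := pi_pos
    nlinarith
  have h3 := mul_le_mul_of_nonneg_right h2 (sq_nonneg (t - t0))
  linarith

structure Setup (c α K G : ℝ) (u g : E2 → ℝ) : Prop where
  hu : ContDiffOn ℝ 2 u (closedBall (0 : E2) 1)
  hug : ∀ x ∈ sphere (0 : E2) 1, u x = g x
  hp : ∀ x ∈ ball (0:E2) 1, ∀ y ∈ ball (0:E2) 1, Cone c (fderiv ℝ (fderiv ℝ u) x - fderiv ℝ (fderiv ℝ u) y)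
  h1 : ∀ x ∈ ball (0:E2) 1, ‖fderiv ℝ u x‖ ≤ K
  h2 : ∀ x ∈ ball (0:E2) 1, ‖fderiv ℝ (fderiv ℝ u) x‖ ≤ K
  g2 : ContDiff ℝ 2 (onCircle g)
  b1 : ∀ t, |deriv (onCircle g) t| ≤ G
  b2 : ∀ t, |deriv (deriv (onCircle g)) t| ≤ G
  b3 : ∀ s t, |deriv (deriv (onCircle g)) s - deriv (deriv (onCircle g)) t| ≤ G * |s - t| ^ α

lemma Setup.K0 {c α K G : ℝ} {u g : E2 → ℝ} (h : Setup c α K G u g) : 0 ≤ K :=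
  (norm_nonneg _).trans (h.h1 0 (by simp))

lemma Setup.G0 {c α K G : ℝ} {u g : E2 → ℝ} (h : Setup c α K G u g) : 0 ≤ G :=
  (abs_nonneg _).trans (h.b1 0)

lemma rot_circPt (t : ℝ) : rot (circPt t) = tauPt t := by
  simp [rot, tauPt]

lemma one_sub_cos_le {α x : ℝ} (hα : 0 < α) (hα1 : α < 1) : 1 - cos x ≤ 2 * |x| ^ α := by
  rcases le_total |x| 1 with h | h
  · have h1 := one_sub_sq_div_two_le_cos (x := x)
    have h2 : |x| ^ (2:ℝ) ≤ |x| ^ α := by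
      rcases eq_or_lt_of_le (abs_nonneg x) with h0 | h0
      · rw [← h0, zero_rpow (by norm_num), zero_rpow hα.ne']
      · exact rpow_le_rpow_of_exponent_ge h0 h (by linarith)
    rw [rpow_two, sq_abs] at h2
    nlinarith [sq_nonneg x]
  · have h1 := neg_one_le_cos x
    have h2 := one_le_rpow h hα.le
    linarith

lemma Setup.taylor {c α K G : ℝ} {u g : E2 → ℝ} (h : Setup c α K G u g) (hα : 0 < α) (hα1 : α < 1) (t t0 : ℝ) :
    |deriv (onCircle g) t - deriv (onCircle g) t0 - deriv (deriv (onCircle g)) t0 * sin (t - t0)| ≤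
      3 * G * (|t - t0| ^ α * |t - t0|) := by
  have hG := h.G0
  have hd : ∀ s, HasDerivAt (fun s => deriv (onCircle g) s - deriv (deriv (onCircle g)) t0 * sin (s - t0))
      (deriv (deriv (onCircle g)) s - deriv (deriv (onCircle g)) t0 * cos (s - t0)) s := by
    intro s
    have h1 : DifferentiableAt ℝ (deriv (onCircle g)) s := by
      have : ContDiff ℝ (1+1) (onCircle g) := by convert h.g2 using 1; norm_num
      exact ((contDiff_succ_iff_deriv.mp this).2.2.differentiable (by norm_num)) s
    have h2 : HasDerivAt (fun s => sin (s - t0)) (cos (s - t0)) s := by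
      have := (hasDerivAt_sin (s - t0)).comp s ((hasDerivAt_id s).sub_const t0)
      exact this.congr_deriv (by ring)
    exact h1.hasDerivAt.sub (h2.const_mul _)
  have := Convex.norm_image_sub_le_of_norm_hasDerivWithin_le (s := uIcc t0 t) (C := 3 * G * |t - t0| ^ α)
    (fun s _ => (hd s).hasDerivWithinAt) (fun s hs => ?_) (convex_uIcc t0 t) left_mem_uIcc right_mem_uIcc
  · simp only [sub_self, sin_zero, mul_zero, sub_zero, Real.norm_eq_abs] at this
    calc _ = _ := by congr 1; ring
      _ ≤ _ := this
      _ = _ := by ring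
  · have hs' : |s - t0| ≤ |t - t0| := abs_sub_left_of_mem_uIcc hs
    have e1 := h.b3 s t0
    have e2 := one_sub_cos_le (x := s - t0) hα hα1
    have e3 := h.b2 t0
    have e4 : |s - t0| ^ α ≤ |t - t0| ^ α := rpow_le_rpow (abs_nonneg _) hs' hα.le
    have e5 : 0 ≤ 1 - cos (s - t0) := by linarith [cos_le_one (s - t0)]
    rw [Real.norm_eq_abs]
    calc _ = |(deriv (deriv (onCircle g)) s - deriv (deriv (onCircle g)) t0) + deriv (deriv (onCircle g)) t0 * (1 - cos (s - t0))| := by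
          congr 1; ring
      _ ≤ G * |s - t0| ^ α + G * (2 * |s - t0| ^ α) := by
          refine (abs_add_le _ _).trans (add_le_add e1 ?_)
          rw [abs_mul, abs_of_nonneg e5]
          exact mul_le_mul e3 e2 e5 hG
      _ = 3 * G * |s - t0| ^ α := by ring
      _ ≤ _ := mul_le_mul_of_nonneg_left e4 (by positivity)

lemma dZ_circ (t0 t : ℝ) : dZ (circPt t0) (circPt t) = sin (t - t0) := by
  simp only [dZ, circPt_zero', circPt_one', sin_sub]; ring

lemma tau_decomp (t t0 : ℝ) : tauPt t0 = cos (t - t0) • tauPt t + sin (t - t0) • circPt t := by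
  rw [circPt_eq, tauPt, tauPt, cos_sub, sin_sub]
  have := sin_sq_add_cos_sq t
  simp only [smul_add, smul_smul]
  have e : ∀ a b a1 b1 a2 b2 : ℝ, a = a1 + a2 → b = b1 + b2 →
     a • ee0 + b • ee1 = a1 • ee0 + b1 • ee1 + (a2 • ee0 + b2 • ee1) := by
    intros a b a1 b1 a2 b2 h1 h2; rw [h1, h2]; module
  apply e
  · linear_combination (sin t0) * this
  · linear_combination (-cos t0) * this

lemma Setup.circ_est {c α K G : ℝ} {u g : E2 → ℝ} (h : Setup c α K G u g) (hα : 0 < α) (hα1 : α < 1) (t0 : ℝ) {x : E2} (hx : ‖x‖ = 1) :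
    |pg u x (tauPt t0) - pg u (circPt t0) (tauPt t0) -
      (deriv (deriv (onCircle g)) t0 + pg u (circPt t0) (circPt t0)) * dZ (circPt t0) x| ≤ 44 * (G + K) * ‖x - circPt t0‖ ^ (1 + α) := by
  have hG := h.G0
  have hK := h.K0
  obtain ⟨t, rfl, ht⟩ := exists_circPt_near hx t0
  have hn : ∀ s, ‖circPt s‖ ≤ 1 := fun s => (norm_circPt s).le
  have e1 : ∀ s, pg u (circPt s) (tauPt s) = deriv (onCircle g) s := fun s => (onCircle_deriv h.hu h.hug s).deriv.symm
  have e2 : pg u (circPt t) (tauPt t0) = cos (t - t0) * deriv (onCircle g) t + sin (t - t0) * pg u (circPt t) (circPt t) := by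
    conv_lhs => rw [tau_decomp t t0]
    rw [map_add, map_smul, map_smul, e1]; rfl
  rw [dZ_circ, e2, e1]
  have hN : |pg u (circPt t) (circPt t) - pg u (circPt t0) (circPt t0)| ≤ 2 * K * |t - t0| := by
    have a1 := pg_lip h.hu h.h2 (hn t) (hn t0)
    have a2 := pg_bound h.hu h.h1 (hn t0)
    have a3 := chord_le t t0
    have a4 : |(pg u (circPt t) - pg u (circPt t0)) (circPt t)| ≤ K * |t - t0| := by
      have := (pg u (circPt t) - pg u (circPt t0)).le_opNorm (circPt t)
      rw [norm_circPt, mul_one, Real.norm_eq_abs] at this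
      exact this.trans (a1.trans (mul_le_mul_of_nonneg_left a3 hK))
    have a5 : |(pg u (circPt t0)) (circPt t - circPt t0)| ≤ K * |t - t0| := by
      have := (pg u (circPt t0)).le_opNorm (circPt t - circPt t0)
      rw [Real.norm_eq_abs] at this
      exact this.trans (mul_le_mul a2 a3 (norm_nonneg _) hK)
    rw [sub_apply] at a4
    rw [map_sub] at a5
    calc _ = |(pg u (circPt t) (circPt t) - pg u (circPt t0) (circPt t)) + (pg u (circPt t0) (circPt t) - pg u (circPt t0) (circPt t0))| := by congr 1; ring
      _ ≤ _ := abs_add_le _ _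
      _ ≤ _ := by linarith
  obtain ⟨φ, hφ⟩ : ∃ φ, φ = t - t0 := ⟨_, rfl⟩
  have hT := h.taylor hα hα1 t t0
  have hc : |1 - cos φ| ≤ φ ^ 2 / 2 := by
    rw [abs_of_nonneg (by linarith [cos_le_one φ])]
    linarith [one_sub_sq_div_two_le_cos (x := φ)]
  have hs : |sin φ| ≤ |φ| := abs_sin_le_abs
  have hP : |φ| ^ (1 + α) = |φ| ^ α * |φ| := by
    rcases eq_or_lt_of_le (abs_nonneg φ) with h0 | h0
    · rw [← h0, zero_rpow (by linarith), mul_zero]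
    · rw [add_comm, rpow_add h0, rpow_one]
  have hQ : φ ^ 2 ≤ 4 * |φ| ^ (1 + α) := by
    rcases eq_or_lt_of_le (abs_nonneg φ) with h0 | h0
    · rw [← sq_abs, ← h0]; simp; positivity
    · have : |φ| ^ (1 - α) ≤ 4 := by
        have b1 : |φ| ≤ 4 := by rw [hφ]; linarith [pi_lt_four]
        calc _ ≤ (4:ℝ) ^ (1 - α) := rpow_le_rpow (abs_nonneg _) b1 (by linarith)
          _ ≤ (4:ℝ) ^ (1:ℝ) := rpow_le_rpow_of_exponent_le (by norm_num) (by linarith)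
          _ = 4 := rpow_one _
      have e : φ ^ 2 = |φ| ^ (1 - α) * |φ| ^ (1 + α) := by
        rw [← rpow_add h0, ← sq_abs, ← rpow_two]; congr 1; ring
      rw [e]; exact mul_le_mul_of_nonneg_right this (by positivity)
  have hR : |φ| ^ (1 + α) ≤ 4 * ‖circPt t - circPt t0‖ ^ (1 + α) := by
    have b := chord_ge ht
    rw [← hφ] at b
    calc _ ≤ (2 * ‖circPt t - circPt t0‖) ^ (1 + α) := rpow_le_rpow (abs_nonneg _) b (by linarith)
      _ = 2 ^ (1 + α) * ‖circPt t - circPt t0‖ ^ (1 + α) := mul_rpow (by norm_num) (norm_nonneg _)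
      _ ≤ 4 * ‖circPt t - circPt t0‖ ^ (1 + α) := by
        apply mul_le_mul_of_nonneg_right _ (by positivity)
        calc (2:ℝ) ^ (1 + α) ≤ 2 ^ (2:ℝ) := rpow_le_rpow_of_exponent_le (by norm_num) (by linarith)
          _ = 4 := by norm_num
  rw [← hφ] at hT hN ⊢
  rw [← hP] at hT
  have f1 : |(1 - cos φ) * deriv (onCircle g) t| ≤ φ ^ 2 / 2 * G := by
    rw [abs_mul]; exact mul_le_mul hc (h.b1 t) (abs_nonneg _) (by positivity)
  have f2 : |sin φ * (pg u (circPt t) (circPt t) - pg u (circPt t0) (circPt t0))| ≤ |φ| * (2 * K * |φ|) := by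
    rw [abs_mul]; exact mul_le_mul hs hN (abs_nonneg _) (by positivity)
  have f3 : |φ| * (2 * K * |φ|) = 2 * K * φ ^ 2 := by rw [← sq_abs]; ring
  have f4 := mul_le_mul_of_nonneg_left hQ (show 0 ≤ G / 2 + 2 * K by positivity)
  have f5 := mul_le_mul_of_nonneg_left hR (show 0 ≤ 5 * G + 8 * K by positivity)
  have f6 := mul_nonneg (show 0 ≤ 6 * G + 3 * K by positivity) (show 0 ≤ ‖circPt t - circPt t0‖ ^ (1 + α) by positivity)
  calc _ = |(deriv (onCircle g) t - deriv (onCircle g) t0 - deriv (deriv (onCircle g)) t0 * sin φ) -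
        (1 - cos φ) * deriv (onCircle g) t + sin φ * (pg u (circPt t) (circPt t) - pg u (circPt t0) (circPt t0))| := by congr 1; ring
    _ ≤ _ := abs_add_le _ _
    _ ≤ _ := add_le_add_left (abs_sub _ _) _
    _ ≤ _ := by linarith

lemma Setup.disc_est {c α K G : ℝ} {u g : E2 → ℝ} (h : Setup c α K G u g) (t0 : ℝ) {x : E2} (hx : ‖x‖ ≤ 1) :
    |pg u x (tauPt t0) - pg u (circPt t0) (tauPt t0) -
      (deriv (deriv (onCircle g)) t0 + pg u (circPt t0) (circPt t0)) * dZ (circPt t0) x| ≤ 44 * (G + K) * ‖x - circPt t0‖ := by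
  have hG := h.G0
  have hK := h.K0
  have hn : ‖circPt t0‖ ≤ 1 := (norm_circPt t0).le
  have a1 := pg_lip h.hu h.h2 hx hn
  have a2 := pg_bound h.hu h.h1 hn
  have a3 : |(pg u x - pg u (circPt t0)) (tauPt t0)| ≤ K * ‖x - circPt t0‖ := by
    have := (pg u x - pg u (circPt t0)).le_opNorm (tauPt t0)
    rw [norm_tauPt, mul_one, Real.norm_eq_abs] at this
    exact this.trans a1
  rw [sub_apply] at a3
  have a4 : |pg u (circPt t0) (circPt t0)| ≤ K := by
    have := (pg u (circPt t0)).le_opNorm (circPt t0)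
    rw [norm_circPt, mul_one, Real.norm_eq_abs] at this
    exact this.trans a2
  have a5 := abs_dZ_le (norm_circPt t0) x
  have a6 : |(deriv (deriv (onCircle g)) t0 + pg u (circPt t0) (circPt t0)) * dZ (circPt t0) x| ≤ (G + K) * ‖x - circPt t0‖ := by
    rw [abs_mul]
    exact mul_le_mul ((abs_add_le _ _).trans (add_le_add (h.b2 t0) a4)) a5 (abs_nonneg _) (by positivity)
  have a7 := mul_nonneg (add_nonneg hG hK) (norm_nonneg (x - circPt t0))
  have a8 := mul_nonneg hG (norm_nonneg (x - circPt t0))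
  have a9 := abs_sub (pg u x (tauPt t0) - pg u (circPt t0) (tauPt t0)) ((deriv (deriv (onCircle g)) t0 + pg u (circPt t0) (circPt t0)) * dZ (circPt t0) x)
  linarith

/-- linear parts of dY, dZ -/
def clmA (a b : ℝ) : E2 →L[ℝ] ℝ := a • EuclideanSpace.proj 0 + b • EuclideanSpace.proj 1

lemma clmA_apply (a b : ℝ) (x : E2) : clmA a b x = a * x 0 + b * x 1 := by simp [clmA]

lemma Setup.cls {c α K G : ℝ} {u g : E2 → ℝ} (h : Setup c α K G u g) {e : E2} (he : ‖e‖ = 1) :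
    Cls c (fun x => pg u x e) := by
  refine (Cls_deriv (h.hu.mono ball_subset_closedBall) h.hp e he).congr ?_
  intro y hy
  rw [pg_ball u hy]

/-- boundary C^{1,α} for tangential derivative -/
def BConst (c α D : ℝ) : Prop := ∀ (K G : ℝ) (u g : E2 → ℝ), Setup c α K G u g → ∀ x0 : E2, ‖x0‖ = 1 →
  ∃ (L : E2 →L[ℝ] ℝ) (b : ℝ), ∀ x, ‖x‖ ≤ 1 → |pg u x (rot x0) - (L x + b)| ≤ D * (G + K) * ‖x - x0‖ ^ (1 + α)

lemma bdry_final {c C β : ℝ} (hc : 0 < c) (hI : IConst c C) (hβ : 0 < β) :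
    ∃ α D : ℝ, 0 < α ∧ α ≤ β ∧ α < 1 ∧ 0 < D ∧ BConst c α D := by
  obtain ⟨α, D, hα, hαβ, hα1, hD, H⟩ := bdry_iter hc hI hβ
  refine ⟨α, 44 * D, hα, hαβ, hα1, by positivity, ?_⟩
  intro K G u g h x0 hx0
  have hG := h.G0
  have hK := h.K0
  obtain ⟨t0, rfl⟩ := exists_circPt hx0
  rw [rot_circPt]
  have E1 := fun x => h.circ_est hα hα1 t0 (x := x)
  have E2' := fun x => h.disc_est t0 (x := x)
  obtain ⟨κ, hκ⟩ : ∃ κ, κ = deriv (deriv (onCircle g)) t0 + pg u (circPt t0) (circPt t0) := ⟨_, rfl⟩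
  obtain ⟨q, hq⟩ : ∃ q, q = pg u (circPt t0) (tauPt t0) := ⟨_, rfl⟩
  rw [← hκ, ← hq] at E1 E2'
  have ha : ∀ (k m : ℝ) (x : E2), k * dZ (circPt t0) x + m * dY (circPt t0) x =
      clmA (-k * (circPt t0) 1 - m * (circPt t0) 0) (k * (circPt t0) 0 - m * (circPt t0) 1) x + m := by
    intro k m x
    rw [clmA_apply, dZ, dY]; ring
  rcases eq_or_lt_of_le (show 0 ≤ 44 * (G + K) by positivity) with hA | hA
  · refine ⟨clmA (-κ * (circPt t0) 1 - 0 * (circPt t0) 0) (κ * (circPt t0) 0 - 0 * (circPt t0) 1), 0 + q, fun x hx => ?_⟩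
    have h1 := E2' x hx
    rw [← add_assoc, ← ha]
    rw [← hA, zero_mul] at h1
    have h2 : 44 * D * (G + K) = 0 := by rw [show 44 * D * (G + K) = D * (44 * (G + K)) by ring, ← hA, mul_zero]
    rw [h2, zero_mul, zero_mul]
    calc _ = _ := by congr 1; ring
      _ ≤ _ := h1
  · obtain ⟨A, hAe⟩ : ∃ A, A = 44 * (G + K) := ⟨_, rfl⟩
    rw [← hAe] at hA E1 E2'
    have hv : Cls c (fun x => A⁻¹ * (pg u x (tauPt t0) + (clmA (-(-κ) * (circPt t0) 1 - 0 * (circPt t0) 0) ((-κ) * (circPt t0) 0 - 0 * (circPt t0) 1) x + (-q)))) :=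
      ((h.cls (norm_tauPt t0)).add_affine _ _).smul _
    have hv2 : Cls c (fun x => A⁻¹ * (pg u x (tauPt t0) - q - κ * dZ (circPt t0) x)) := by
      refine hv.congr ?_
      intro y _
      have := ha (-κ) 0 y
      rw [add_zero] at this
      simp only
      rw [← this]; ring
    have hcont : ContinuousOn (fun x => A⁻¹ * (pg u x (tauPt t0) - q - κ * dZ (circPt t0) x)) (closedBall 0 1) := by
      have c1 : ContinuousOn (fun x => pg u x (tauPt t0)) (closedBall 0 1) := (pg_cont h.hu).clm_apply continuousOn_const
      have c2 : Continuous (dZ (circPt t0)) := (contDiff_dZ (n := 0) _).continuous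
      exact ((c1.sub continuousOn_const).sub (c2.continuousOn.const_smul κ)).const_smul A⁻¹
    have key : ∀ a b : ℝ, |a| ≤ A * b → |A⁻¹ * a| ≤ b := by
      intro a b hab
      rw [abs_mul, abs_of_pos (inv_pos.mpr hA), inv_mul_le_iff₀ hA]; exact hab
    obtain ⟨m, hm, hm2⟩ := H _ (circPt t0) hv2 hcont (norm_circPt t0) (fun x hx => key _ _ (E1 x hx)) (fun x hx => key _ _ (E2' x hx))
    refine ⟨clmA (-κ * (circPt t0) 1 - (A * m) * (circPt t0) 0) (κ * (circPt t0) 0 - (A * m) * (circPt t0) 1), A * m + q, fun x hx => ?_⟩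
    rw [← add_assoc, ← ha]
    have h1 := mul_le_mul_of_nonneg_left (hm2 x hx) hA.le
    calc _ = |A * (A⁻¹ * (pg u x (tauPt t0) - q - κ * dZ (circPt t0) x) - m * dY (circPt t0) x)| := by
          congr 1; field_simp; ring
      _ = A * |A⁻¹ * (pg u x (tauPt t0) - q - κ * dZ (circPt t0) x) - m * dY (circPt t0) x| := by rw [abs_mul, abs_of_pos hA]
      _ ≤ _ := h1
      _ = _ := by rw [hAe]; ring

lemma bil_norm_le (B : Bil) : ‖B‖ ≤ |B ee0 ee0| + |B ee0 ee1| + |B ee1 ee0| + |B ee1 ee1| := by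
  refine B.opNorm_le_bound (by positivity) (fun x => ?_)
  have h1 : B x = x 0 • B ee0 + x 1 • B ee1 := by
    conv_lhs => rw [E2_decomp x]
    simp
  have hx := E2_norm_sq x
  have h0 : |x 0| ≤ ‖x‖ := abs_le_of_sq_le_sq (by nlinarith [sq_nonneg (x 1)]) (norm_nonneg _)
  have h2 : |x 1| ≤ ‖x‖ := abs_le_of_sq_le_sq (by nlinarith [sq_nonneg (x 0)]) (norm_nonneg _)
  rw [h1]
  refine (norm_add_le _ _).trans ?_
  rw [norm_smul, norm_smul, Real.norm_eq_abs, Real.norm_eq_abs]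
  have e0 := mul_le_mul h0 (clm_norm_le (B ee0)) (norm_nonneg _) (norm_nonneg _)
  have e1 := mul_le_mul h2 (clm_norm_le (B ee1)) (norm_nonneg _) (norm_nonneg _)
  linarith

lemma norm_rot {e : E2} (he : ‖e‖ = 1) : ‖rot e‖ = 1 := by
  have h := E2_norm_sq e
  have h2 := E2_norm_sq (rot e)
  simp only [rot_zero', rot_one'] at h2
  rw [he] at h
  have : ‖rot e‖ ^ 2 = 1 := by rw [h2]; linarith
  have h3 := norm_nonneg (rot e)
  nlinarith

lemma cone_norm {c : ℝ} (hc : 0 < c) {N : Bil} (hN : Cone c N) {e : E2} (he : ‖e‖ = 1) {ε : ℝ}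
    (hε : ‖(ContinuousLinearMap.apply ℝ ℝ e).comp N‖ ≤ ε) : ‖N‖ ≤ 8 / c * ε := by
  have hε0 : 0 ≤ ε := (norm_nonneg _).trans hε
  have a0 : |N ee0 e| ≤ ε := (abs_apply_ee_le ((ContinuousLinearMap.apply ℝ ℝ e).comp N)).1.trans hε
  have a1 : |N ee1 e| ≤ ε := (abs_apply_ee_le ((ContinuousLinearMap.apply ℝ ℝ e).comp N)).2.trans hε
  rw [clm_decomp] at a0 a1
  have hn := E2_norm_sq e
  rw [he] at hn
  unfold Cone at hN
  have hb := bil_norm_le N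
  obtain ⟨a, ha⟩ : ∃ a, a = N ee0 ee0 := ⟨_, rfl⟩
  obtain ⟨b, hb'⟩ : ∃ a, a = N ee0 ee1 := ⟨_, rfl⟩
  obtain ⟨b2, hb2⟩ : ∃ a, a = N ee1 ee0 := ⟨_, rfl⟩
  obtain ⟨d, hd⟩ : ∃ a, a = N ee1 ee1 := ⟨_, rfl⟩
  rw [← ha, ← hb', ← hb2, ← hd] at hN hb
  rw [← ha, ← hb'] at a0
  rw [← hb2, ← hd] at a1
  obtain ⟨x, hx⟩ : ∃ a, a = e 0 := ⟨_, rfl⟩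
  obtain ⟨y, hy⟩ : ∃ a, a = e 1 := ⟨_, rfl⟩
  rw [← hx, ← hy] at hn a0 a1
  have p0 : (x * a + y * b) ^ 2 ≤ ε ^ 2 := sq_le_sq' (abs_le.mp a0).1 (abs_le.mp a0).2
  have p1 : (x * b2 + y * d) ^ 2 ≤ ε ^ 2 := sq_le_sq' (abs_le.mp a1).1 (abs_le.mp a1).2
  have hn' : x ^ 2 + y ^ 2 = 1 := by linarith
  have hdet : b * b2 - a * d = (-y * a + x * b) * (x * b2 + y * d) - (x * a + y * b) * (-y * b2 + x * d) := by
    linear_combination (-(b * b2 - a * d)) * hn'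
  have hhs : a ^ 2 + b ^ 2 + b2 ^ 2 + d ^ 2 = (x * a + y * b) ^ 2 + (-y * a + x * b) ^ 2 + (x * b2 + y * d) ^ 2 + (-y * b2 + x * d) ^ 2 := by
    linear_combination (-(a ^ 2 + b ^ 2 + b2 ^ 2 + d ^ 2)) * hn'
  have amgm : ∀ p q : ℝ, 2 * c * (p * q) ≤ c ^ 2 * p ^ 2 + q ^ 2 := fun p q => by nlinarith [sq_nonneg (c * p - q)]
  have m1 := amgm (-y * a + x * b) (x * b2 + y * d)
  have m2 := amgm (-(-y * b2 + x * d)) (x * a + y * b)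
  have hN2 := mul_le_mul_of_nonneg_left hN (show 0 ≤ 2 * c by positivity)
  have key : c ^ 2 * (a ^ 2 + b ^ 2 + b2 ^ 2 + d ^ 2) ≤ 2 * ε ^ 2 := by
    have z1 := mul_nonneg (sq_nonneg c) (sq_nonneg (x * a + y * b))
    have z2 := mul_nonneg (sq_nonneg c) (sq_nonneg (x * b2 + y * d))
    have e1 : 2 * c * (b * b2 - a * d) ≤ c ^ 2 * (a ^ 2 + b ^ 2 + b2 ^ 2 + d ^ 2) + (x * a + y * b) ^ 2 + (x * b2 + y * d) ^ 2 := by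
      rw [hdet, hhs]; linarith
    linarith
  have ent : ∀ z : ℝ, z ^ 2 ≤ a ^ 2 + b ^ 2 + b2 ^ 2 + d ^ 2 → |z| ≤ 2 / c * ε := by
    intro z hz
    have h1 : (c * |z|) ^ 2 ≤ (2 * ε) ^ 2 := by
      rw [mul_pow, sq_abs]
      have := mul_le_mul_of_nonneg_left hz (sq_nonneg c)
      linarith [sq_nonneg ε]
    have h2 := le_of_sq_le_sq h1 (by positivity)
    rw [div_mul_eq_mul_div, le_div_iff₀ hc]; linarith
  have sa := sq_nonneg a
  have sb := sq_nonneg b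
  have sb2 := sq_nonneg b2
  have sd := sq_nonneg d
  have f1 := ent a (by linarith)
  have f2 := ent b (by linarith)
  have f3 := ent b2 (by linarith)
  have f4 := ent d (by linarith)
  calc _ ≤ _ := hb
    _ ≤ 4 * (2 / c * ε) := by linarith
    _ = _ := by ring

lemma Setup.hasD {c α K G : ℝ} {u g : E2 → ℝ} (h : Setup c α K G u g) (e : E2) {y : E2} (hy : y ∈ ball (0:E2) 1) :
    HasFDerivAt (fun x => pg u x e) ((ContinuousLinearMap.apply ℝ ℝ e).comp (fderiv ℝ (fderiv ℝ u) y)) y := by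
  have h1 : HasFDerivAt (fun x => fderiv ℝ u x e) ((ContinuousLinearMap.apply ℝ ℝ e).comp (fderiv ℝ (fderiv ℝ u) y)) y :=
    (ContinuousLinearMap.apply ℝ ℝ e).hasFDerivAt.comp y (diffAt_fderiv h.hu hy).hasFDerivAt
  refine h1.congr_of_eventuallyEq ?_
  filter_upwards [isOpen_ball.mem_nhds hy] with z hz
  rw [pg_ball u hz]

set_option maxHeartbeats 1600000 in
lemma Setup.ray {c α K G C D : ℝ} {u g : E2 → ℝ} (h : Setup c α K G u g) (hI : IConst c C) (hB : BConst c α D)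
    (hα : 0 < α) (hα1 : α < 1) (hαc : α ≤ c / (2 * π)) (hD : 0 < D) {x0 : E2} (hx0 : ‖x0‖ = 1) :
    ∃ L : E2 →L[ℝ] ℝ, ∀ s, 0 ≤ s → s < 1 →
      ‖(ContinuousLinearMap.apply ℝ ℝ (rot x0)).comp (fderiv ℝ (fderiv ℝ u) (s • x0)) - L‖ ≤ 8 * C * D * (G + K) * (1 - s) ^ α ∧
      ∀ y ∈ ball (s • x0) ((1 - s) / 8), ∀ y' ∈ ball (s • x0) ((1 - s) / 8),
      ‖(ContinuousLinearMap.apply ℝ ℝ (rot x0)).comp (fderiv ℝ (fderiv ℝ u) y - fderiv ℝ (fderiv ℝ u) y')‖ ≤ 16 * C * D * (G + K) * ‖y - y'‖ ^ α := by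
  have hG := h.G0
  have hK := h.K0
  have hC : 1 ≤ C := hI.1
  obtain ⟨L, b, hL⟩ := hB K G u g h x0 hx0
  refine ⟨L, fun s hs0 hs1 => ?_⟩
  obtain ⟨d, hd⟩ : ∃ d, d = 1 - s := ⟨_, rfl⟩
  have hd0 : 0 < d := by linarith
  rw [← hd]
  have hns : ‖s • x0‖ = s := by rw [norm_smul, hx0, mul_one, Real.norm_of_nonneg hs0]
  have hv : Cls c (fun x => pg u x (rot x0) + ((-L) x + (-b))) := (h.cls (norm_rot hx0)).add_affine _ _
  have hR : 0 < d / 2 := by positivity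
  have hxR : ‖s • x0‖ + d / 2 < 1 := by rw [hns]; linarith
  have hT : 0 ≤ G + K := by positivity
  have hS : ∀ y ∈ closedBall (s • x0) (d / 2), |pg u y (rot x0) + ((-L) y + (-b))| ≤ D * (G + K) * (4 * (d * d ^ α)) := by
    intro y hy
    have hy' : ‖y - s • x0‖ ≤ d / 2 := by simpa [dist_eq_norm] using hy
    have hy1 : ‖y‖ ≤ 1 := by
      calc ‖y‖ = ‖(y - s • x0) + s • x0‖ := by congr 1; abel
        _ ≤ _ := norm_add_le _ _
        _ ≤ _ := by linarith
    have hy2 : ‖y - x0‖ ≤ 2 * d := by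
      have e : ‖s • x0 - x0‖ = d := by
        rw [show s • x0 - x0 = (s - 1) • x0 by module, norm_smul, hx0, mul_one, Real.norm_eq_abs, abs_of_nonpos (by linarith)]
        linarith
      calc ‖y - x0‖ = ‖(y - s • x0) + (s • x0 - x0)‖ := by congr 1; abel
        _ ≤ _ := norm_add_le _ _
        _ ≤ _ := by linarith
    have h1 := hL y hy1
    calc _ = |pg u y (rot x0) - (L y + b)| := by congr 1; rw [neg_apply]; ring
      _ ≤ _ := h1
      _ ≤ _ := by
        apply mul_le_mul_of_nonneg_left _ (by positivity)
        calc _ ≤ (2 * d) ^ (1 + α) := rpow_le_rpow (norm_nonneg _) hy2 (by linarith)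
          _ = 2 ^ (1 + α) * (d * d ^ α) := by rw [mul_rpow (by norm_num) hd0.le, rpow_add hd0, rpow_one]
          _ ≤ 4 * (d * d ^ α) := by
            apply mul_le_mul_of_nonneg_right _ (by positivity)
            calc (2:ℝ) ^ (1 + α) ≤ 2 ^ (2:ℝ) := rpow_le_rpow_of_exponent_le (by norm_num) (by linarith)
              _ = 4 := by norm_num
  have hder : ∀ y, ‖y‖ < 1 → HasFDerivAt (fun x => pg u x (rot x0) + ((-L) x + (-b)))
      ((ContinuousLinearMap.apply ℝ ℝ (rot x0)).comp (fderiv ℝ (fderiv ℝ u) y) + (-L)) y := by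
    intro y hy
    exact (h.hasD (rot x0) (by simpa using hy)).add ((-L).hasFDerivAt.add_const (-b))
  have hconst : C * (D * (G + K) * (4 * (d * d ^ α))) / (d / 2) = 8 * C * D * (G + K) * d ^ α := by
    field_simp; ring
  constructor
  · have := hv.grad_le hI hR hxR hS (y := s • x0) (mem_ball_self (by positivity)) (hder _ (by rw [hns]; exact hs1))
    rw [hconst, ← sub_eq_add_neg] at this
    exact this
  · intro y hy y' hy'
    have e8 : d / 8 = d / 2 / 4 := by ring
    rw [e8] at hy hy'
    have hlt : ∀ z ∈ ball (s • x0) (d / 2 / 4), ‖z‖ < 1 := by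
      intro z hz
      have hz' : ‖z - s • x0‖ < d / 2 / 4 := by simpa [dist_eq_norm] using hz
      calc ‖z‖ = ‖(z - s • x0) + s • x0‖ := by congr 1; abel
        _ ≤ _ := norm_add_le _ _
        _ < _ := by linarith
    have := hv.grad_holder hI hR hxR hS hy hy' (hder _ (hlt y hy)) (hder _ (hlt y' hy'))
    rw [hconst, add_sub_add_right_eq_sub, ← ContinuousLinearMap.comp_sub] at this
    refine this.trans ?_
    have hr : ‖y - y'‖ ≤ d / 4 := by
      have a1 : ‖y - s • x0‖ < d / 2 / 4 := by simpa [dist_eq_norm] using hy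
      have a2 : ‖y' - s • x0‖ < d / 2 / 4 := by simpa [dist_eq_norm] using hy'
      calc ‖y - y'‖ = ‖(y - s • x0) - (y' - s • x0)‖ := by congr 1; abel
        _ ≤ _ := norm_sub_le _ _
        _ ≤ _ := by linarith
    have hq0 : 0 ≤ ‖y - y'‖ / (d / 2) := by positivity
    have hq1 : ‖y - y'‖ / (d / 2) ≤ 1 := by rw [div_le_one hR]; linarith
    have hq : (‖y - y'‖ / (d / 2)) ^ (c / (2 * π)) ≤ (‖y - y'‖ / (d / 2)) ^ α := by
      rcases eq_or_lt_of_le hq0 with h0 | h0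
      · rw [← h0, zero_rpow hα.ne', zero_rpow (by linarith)]
      · exact rpow_le_rpow_of_exponent_ge h0 hq1 hαc
    have hq2 : d ^ α * (‖y - y'‖ / (d / 2)) ^ α ≤ 2 * ‖y - y'‖ ^ α := by
      rw [← mul_rpow hd0.le hq0]
      have : d * (‖y - y'‖ / (d / 2)) = 2 * ‖y - y'‖ := by field_simp
      rw [this, mul_rpow (by norm_num) (norm_nonneg _)]
      apply mul_le_mul_of_nonneg_right _ (by positivity)
      calc (2:ℝ) ^ α ≤ 2 ^ (1:ℝ) := rpow_le_rpow_of_exponent_le (by norm_num) hα1.le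
        _ = 2 := rpow_one _
    have hP : 0 ≤ 8 * C * D * (G + K) := by positivity
    calc _ ≤ 8 * C * D * (G + K) * d ^ α * (‖y - y'‖ / (d / 2)) ^ α := mul_le_mul_of_nonneg_left hq (by positivity)
      _ = 8 * C * D * (G + K) * (d ^ α * (‖y - y'‖ / (d / 2)) ^ α) := by ring
      _ ≤ 8 * C * D * (G + K) * (2 * ‖y - y'‖ ^ α) := mul_le_mul_of_nonneg_left hq2 hP
      _ = _ := by ring

lemma exists_unit (x : E2) : ∃ x0 : E2, ‖x0‖ = 1 ∧ x = ‖x‖ • x0 := by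
  rcases eq_or_ne x 0 with h | h
  · exact ⟨ee0, norm_ee0, by rw [h]; simp⟩
  · have hn : 0 < ‖x‖ := norm_pos_iff.mpr h
    refine ⟨‖x‖⁻¹ • x, ?_, ?_⟩
    · rw [norm_smul, norm_inv, norm_norm]; field_simp
    · rw [smul_smul, mul_inv_cancel₀ hn.ne', one_smul]

lemma mul_rpow_le {k r α : ℝ} (hk : 1 ≤ k) (hr : 0 ≤ r) (hα1 : α ≤ 1) : (k * r) ^ α ≤ k * r ^ α := by
  rw [mul_rpow (by linarith) hr]
  apply mul_le_mul_of_nonneg_right _ (by positivity)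
  calc k ^ α ≤ k ^ (1:ℝ) := rpow_le_rpow_of_exponent_le hk hα1
    _ = k := rpow_one _

/-- the global Hölder estimate in terms of the boundary data and the C² norm -/
def HConst (c α E : ℝ) : Prop := ∀ (K G : ℝ) (u g : E2 → ℝ), Setup c α K G u g → ∀ x ∈ ball (0:E2) 1, ∀ y ∈ ball (0:E2) 1,
  ‖fderiv ℝ (fderiv ℝ u) x - fderiv ℝ (fderiv ℝ u) y‖ ≤ E * (G + K) * ‖x - y‖ ^ α

set_option maxHeartbeats 1600000 in
lemma holder_final {c C : ℝ} (hc : 0 < c) (hI : IConst c C) :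
    ∃ α E : ℝ, 0 < α ∧ α < 1 ∧ 0 < E ∧ HConst c α E := by
  obtain ⟨α, D, hα, hαc, hα1, hD, hB⟩ := bdry_final hc hI (show 0 < c / (2 * π) by positivity)
  have hC : 1 ≤ C := hI.1
  have hC0 : 0 < C := by linarith
  obtain ⟨Q, hQ⟩ : ∃ Q, Q = 8 / c * (16 * C * D) := ⟨_, rfl⟩
  have hQ0 : 0 < Q := by rw [hQ]; positivity
  refine ⟨α, 51 * Q + 32, hα, hα1, by positivity, ?_⟩
  intro K G u g h x hx y hy
  have hG := h.G0
  have hK := h.K0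
  have hT : 0 ≤ G + K := by positivity
  have local_est : ∀ z ∈ ball (0:E2) 1, ∀ y ∈ ball z ((1 - ‖z‖) / 8), ∀ y' ∈ ball z ((1 - ‖z‖) / 8),
      ‖fderiv ℝ (fderiv ℝ u) y - fderiv ℝ (fderiv ℝ u) y'‖ ≤ Q * (G + K) * ‖y - y'‖ ^ α := by
    intro z hz y hy y' hy'
    have hz1 : ‖z‖ < 1 := by simpa using hz
    obtain ⟨x0, hx0, e0⟩ := exists_unit z
    obtain ⟨L, hL⟩ := h.ray hI hB hα hα1 hαc hD hx0
    have h2 := (hL ‖z‖ (norm_nonneg _) hz1).2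
    rw [← e0] at h2
    have hin : ∀ w ∈ ball z ((1 - ‖z‖) / 8), w ∈ ball (0:E2) 1 := by
      intro w hw
      have hw' : ‖w - z‖ < (1 - ‖z‖) / 8 := by simpa [dist_eq_norm] using hw
      rw [mem_ball, dist_zero_right]
      calc ‖w‖ = ‖(w - z) + z‖ := by congr 1; abel
        _ ≤ _ := norm_add_le _ _
        _ < _ := by linarith
    have := cone_norm hc (h.hp y (hin y hy) y' (hin y' hy')) (norm_rot hx0) (h2 y hy y' hy')
    refine this.trans (le_of_eq ?_)
    rw [hQ]; ring
  have ray_est : ∀ z ∈ ball (0:E2) 1, ∀ τ r : ℝ, 0 ≤ r → 0 ≤ τ → τ ≤ 1 → 1 - τ * ‖z‖ ≤ 25 * r →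
      ‖fderiv ℝ (fderiv ℝ u) z - fderiv ℝ (fderiv ℝ u) (τ • z)‖ ≤ 25 * Q * (G + K) * r ^ α := by
    intro z hz τ r hr0 hτ hτ1 hr
    have hz1 : ‖z‖ < 1 := by simpa using hz
    have hzn := norm_nonneg z
    have hτz : τ * ‖z‖ ≤ ‖z‖ := by nlinarith
    obtain ⟨x0, hx0, e0⟩ := exists_unit z
    obtain ⟨L, hL⟩ := h.ray hI hB hα hα1 hαc hD hx0
    have h1 := (hL ‖z‖ (norm_nonneg _) hz1).1
    have h2 := (hL (τ * ‖z‖) (by positivity) (by linarith)).1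
    rw [← smul_smul, ← e0] at h2
    rw [← e0] at h1
    have hz2 : τ • z ∈ ball (0:E2) 1 := by
      rw [mem_ball, dist_zero_right, norm_smul, Real.norm_of_nonneg hτ]; linarith
    have b : ∀ d : ℝ, 0 ≤ d → d ≤ 25 * r → 8 * C * D * (G + K) * d ^ α ≤ 8 * C * D * (G + K) * (25 * r ^ α) := by
      intro d hd hdr
      apply mul_le_mul_of_nonneg_left _ (by positivity)
      exact (rpow_le_rpow hd hdr hα.le).trans (mul_rpow_le (by norm_num) hr0 hα1.le)
    have b1 := h1.trans (b _ (by linarith) (by linarith))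
    have b2 := h2.trans (b _ (by linarith) (by linarith))
    have b3 : ‖(ContinuousLinearMap.apply ℝ ℝ (rot x0)).comp (fderiv ℝ (fderiv ℝ u) z - fderiv ℝ (fderiv ℝ u) (τ • z))‖ ≤
        8 * C * D * (G + K) * (25 * r ^ α) + 8 * C * D * (G + K) * (25 * r ^ α) := by
      rw [ContinuousLinearMap.comp_sub, ← sub_sub_sub_cancel_right _ _ L]
      exact (norm_sub_le _ _).trans (add_le_add b1 b2)
    have := cone_norm hc (h.hp z hz _ hz2) (norm_rot hx0) b3
    refine this.trans (le_of_eq ?_)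
    rw [hQ]; ring
  have hx1 : ‖x‖ < 1 := by simpa using hx
  have hy1 : ‖y‖ < 1 := by simpa using hy
  obtain ⟨r, hr⟩ : ∃ r, r = ‖x - y‖ := ⟨_, rfl⟩
  rw [← hr]
  have hr0 : 0 ≤ r := by rw [hr]; positivity
  have hP0 : 0 ≤ r ^ α := by positivity
  have hA := mul_nonneg hT hP0
  have hQA := mul_nonneg hQ0.le hA
  rcases le_total (1 / 16) r with h16 | h16
  · have a1 := h.h2 x hx
    have a2 := h.h2 y hy
    have a3 : 1 ≤ 16 * r ^ α := by
      calc (1:ℝ) = 1 ^ α := (one_rpow _).symm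
        _ ≤ (16 * r) ^ α := rpow_le_rpow (by norm_num) (by linarith) hα.le
        _ ≤ _ := mul_rpow_le (by norm_num) hr0 hα1.le
    have a4 := mul_le_mul_of_nonneg_left a3 hT
    have a5 := norm_sub_le (fderiv ℝ (fderiv ℝ u) x) (fderiv ℝ (fderiv ℝ u) y)
    have a6 : (51 * Q + 32) * (G + K) * r ^ α = 51 * (Q * ((G + K) * r ^ α)) + 32 * ((G + K) * r ^ α) := by ring
    rw [a6]
    linarith
  have fin : ∀ k : ℝ, k ≤ 51 → k * (Q * ((G + K) * r ^ α)) ≤ (51 * Q + 32) * (G + K) * r ^ α := by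
    intro k hk
    have a7 := mul_le_mul_of_nonneg_right hk hQA
    have a6 : (51 * Q + 32) * (G + K) * r ^ α = 51 * (Q * ((G + K) * r ^ α)) + 32 * ((G + K) * r ^ α) := by ring
    rw [a6]; linarith
  rcases lt_or_ge r ((1 - ‖x‖) / 8) with hs | hs
  · have := local_est x hx x (mem_ball_self (by linarith)) y (by rw [mem_ball, dist_comm, dist_eq_norm, ← hr]; exact hs)
    rw [← hr] at this
    refine this.trans ?_
    have f := fin 1 (by norm_num)
    calc _ = _ := by ring
      _ ≤ _ := f
  · have hr00 : 0 < r := by linarith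
    have hxy : ‖x‖ ≤ r + ‖y‖ := by
      calc ‖x‖ = ‖(x - y) + y‖ := by congr 1; abel
        _ ≤ _ := norm_add_le _ _
        _ = _ := by rw [hr]
    obtain ⟨τ, hτ⟩ : ∃ τ, τ = 1 - 16 * r := ⟨_, rfl⟩
    have hτ0 : 0 ≤ τ := by linarith
    have hτ1 : τ ≤ 1 := by linarith
    have hxn := norm_nonneg x
    have hyn := norm_nonneg y
    have rx : 16 * r * ‖x‖ ≤ 16 * r := by nlinarith
    have ry : 16 * r * ‖y‖ ≤ 16 * r := by nlinarith
    have ex : τ * ‖x‖ = ‖x‖ - 16 * r * ‖x‖ := by rw [hτ]; ring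
    have ey : τ * ‖y‖ = ‖y‖ - 16 * r * ‖y‖ := by rw [hτ]; ring
    have c1 := ray_est x hx τ r hr0 hτ0 hτ1 (by linarith)
    have c2 := ray_est y hy τ r hr0 hτ0 hτ1 (by linarith)
    have hnx : ‖τ • x‖ = τ * ‖x‖ := by rw [norm_smul, Real.norm_of_nonneg hτ0]
    have hnle : τ * ‖x‖ ≤ τ := by nlinarith
    have hxx : τ • x ∈ ball (0:E2) 1 := by
      rw [mem_ball, dist_zero_right, hnx]; linarith
    have hdd : ‖τ • x - τ • y‖ ≤ r := by
      rw [← smul_sub, norm_smul, Real.norm_of_nonneg hτ0, ← hr]; nlinarith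
    have c3 := local_est (τ • x) hxx (τ • x) (mem_ball_self (by rw [hnx]; linarith)) (τ • y)
      (by rw [mem_ball, dist_comm, dist_eq_norm, hnx]; linarith)
    have c4 : Q * (G + K) * ‖τ • x - τ • y‖ ^ α ≤ Q * (G + K) * r ^ α :=
      mul_le_mul_of_nonneg_left (rpow_le_rpow (norm_nonneg _) hdd hα.le) (by positivity)
    replace c2 := (norm_sub_rev (fderiv ℝ (fderiv ℝ u) (τ • y)) (fderiv ℝ (fderiv ℝ u) y)).trans_le c2
    have c5 : ‖fderiv ℝ (fderiv ℝ u) x - fderiv ℝ (fderiv ℝ u) y‖ ≤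
        ‖fderiv ℝ (fderiv ℝ u) x - fderiv ℝ (fderiv ℝ u) (τ • x)‖ + ‖fderiv ℝ (fderiv ℝ u) (τ • x) - fderiv ℝ (fderiv ℝ u) (τ • y)‖
         + ‖fderiv ℝ (fderiv ℝ u) (τ • y) - fderiv ℝ (fderiv ℝ u) y‖ := by
      have := norm_add₃_le (a := fderiv ℝ (fderiv ℝ u) x - fderiv ℝ (fderiv ℝ u) (τ • x)) (b := fderiv ℝ (fderiv ℝ u) (τ • x) - fderiv ℝ (fderiv ℝ u) (τ • y)) (c := fderiv ℝ (fderiv ℝ u) (τ • y) - fderiv ℝ (fderiv ℝ u) y)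
      rw [sub_add_sub_cancel, sub_add_sub_cancel] at this
      exact this
    refine le_trans ?_ (fin 51 le_rfl)
    have e1 : 25 * Q * (G + K) * r ^ α = 25 * (Q * ((G + K) * r ^ α)) := by ring
    have e2 : Q * (G + K) * r ^ α = Q * ((G + K) * r ^ α) := by ring
    rw [e1] at c1 c2
    rw [e2] at c4
    linarith

lemma Cls.minp {c : ℝ} (hc : 0 < c) {v : E2 → ℝ} (h : Cls c v) (hv : ContinuousOn v (closedBall 0 1)) {S : ℝ}
    (hb : ∀ x, ‖x‖ = 1 → -S ≤ v x) {x : E2} (hx : ‖x‖ ≤ 1) : -S ≤ v x := by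
  refine le_of_eps zero_le_one (fun ε hε => ?_)
  have hψ : ContDiff ℝ 2 (fun y : E2 => ε * (y 0) ^ 2 - (S + ε)) := by fun_prop
  have key := h.compare hc (isCompact_closedBall 0 1) isOpen_ball ball_subset_closedBall subset_rfl hv hψ ?_ ?_ x (by simpa using hx)
  · simp only at key
    have := mul_nonneg hε.le (sq_nonneg (x 0))
    linarith
  · intro y _
    refine ⟨ee0, norm_ee0, 2 * ε, 0, le_rfl, by positivity, fun w => ?_⟩
    have h2 : fderiv ℝ (fderiv ℝ (fun y : E2 => ε * (y 0) ^ 2 - (S + ε))) y w w = 2 * ε * (w 0) ^ 2 := by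
      refine hess_line hψ y w (φ := fun t => ε * (y 0 + t * w 0) ^ 2 - (S + ε)) (φ' := fun t => 2 * ε * w 0 * (y 0 + t * w 0)) ?_ ?_ ?_
      · intro t; simp
      · intro t
        have a : HasDerivAt (fun t : ℝ => y 0 + t * w 0) (w 0) t := by
          simpa using ((hasDerivAt_id t).mul_const (w 0)).const_add (y 0)
        exact (((a.pow 2).const_mul ε).sub_const (S + ε)).congr_deriv (by push_cast; ring)
      · have a : HasDerivAt (fun t : ℝ => y 0 + t * w 0) (w 0) 0 := by
          simpa using ((hasDerivAt_id (0:ℝ)).mul_const (w 0)).const_add (y 0)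
        exact (a.const_mul (2 * ε * w 0)).congr_deriv (by ring)
    rw [h2]
    simp
  · intro y hy hy2
    have h1 : ‖y‖ ≤ 1 := by simpa using hy
    have h2 : 1 ≤ ‖y‖ := by simpa using hy2
    have h3 : ‖y‖ = 1 := le_antisymm h1 h2
    have h4 := E2_norm_sq y
    rw [h3] at h4
    have h5 := hb y h3
    have h6 : (y 0) ^ 2 ≤ 1 := by nlinarith [sq_nonneg (y 1)]
    have := mul_le_mul_of_nonneg_left h6 hε.le
    linarith

lemma Cls.maxp {c : ℝ} (hc : 0 < c) {v : E2 → ℝ} (h : Cls c v) (hv : ContinuousOn v (closedBall 0 1)) {S : ℝ}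
    (hb : ∀ x, ‖x‖ = 1 → |v x| ≤ S) {x : E2} (hx : ‖x‖ ≤ 1) : |v x| ≤ S := by
  have h1 := h.minp hc hv (fun x hx => (abs_le.mp (hb x hx)).1) hx
  have h2 := h.neg.minp hc hv.neg (S := S) (fun x hx => by have := (abs_le.mp (hb x hx)).2; linarith) hx
  exact abs_le.mpr ⟨h1, by linarith⟩

lemma exists_delta {E α : ℝ} (hE : 0 < E) (hα : 0 < α) : ∃ δ : ℝ, 0 < δ ∧ δ ≤ 1 / 4 ∧ E * (2 * δ) ^ α ≤ 1 / 2 := by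
  have h : Filter.Tendsto (fun δ : ℝ => E * (2 * δ) ^ α) (nhdsWithin 0 (Ioi 0)) (nhds 0) := by
    have : ContinuousAt (fun δ : ℝ => E * (2 * δ) ^ α) 0 := by
      apply ContinuousAt.mul continuousAt_const
      apply ContinuousAt.rpow_const (by fun_prop) (Or.inr hα.le)
    have h2 := this.tendsto
    simp only [mul_zero, zero_rpow hα.ne'] at h2
    exact h2.mono_left nhdsWithin_le_nhds
  have h1 : ∀ᶠ δ : ℝ in nhdsWithin 0 (Ioi 0), E * (2 * δ) ^ α < 1 / 2 := h.eventually (gt_mem_nhds (by norm_num))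
  have h2 : ∀ᶠ δ : ℝ in nhdsWithin 0 (Ioi 0), δ ∈ Ioo (0:ℝ) (1 / 4) := Ioo_mem_nhdsGT (by norm_num)
  obtain ⟨δ, a, b⟩ := (h1.and h2).exists
  exact ⟨δ, b.1, b.2.le, a.le⟩

set_option maxHeartbeats 1600000 in
lemma Setup.improve {c C α E δ K G : ℝ} {u g : E2 → ℝ} (h : Setup c α K G u g) (hc : 0 < c) (hc1 : c ≤ 1) (hI : IConst c C) (hα : 0 < α)
    (hE : HConst c α E) (hE0 : 0 < E) (hδ : 0 < δ) (hδ4 : δ ≤ 1 / 4) (hEδ : E * (2 * δ) ^ α ≤ 1 / 2)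
    (hcone : ∀ x ∈ ball (0:E2) 1, Cone c (fderiv ℝ (fderiv ℝ u) x)) (hS : ∀ x, ‖x‖ ≤ 1 → |u x| ≤ G) :
    ∀ x ∈ ball (0:E2) 1, ‖fderiv ℝ u x‖ ≤ (1 + 32 * C ^ 2 / (c * δ ^ 2)) * G + K / 2 ∧
      ‖fderiv ℝ (fderiv ℝ u) x‖ ≤ (1 + 32 * C ^ 2 / (c * δ ^ 2)) * G + K / 2 := by
  intro x hx
  have hG := h.G0
  have hK := h.K0
  have hC : 1 ≤ C := hI.1
  have hx1 : ‖x‖ < 1 := by simpa using hx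
  have hxn := norm_nonneg x
  have hcls : Cls c u := Cls_self (h.hu.mono ball_subset_closedBall) hcone
  obtain ⟨x', hx'⟩ : ∃ x', x' = (1 - 2 * δ) • x := ⟨_, rfl⟩
  have hn' : ‖x'‖ = (1 - 2 * δ) * ‖x‖ := by rw [hx', norm_smul, Real.norm_of_nonneg (by linarith)]
  have hn2 : ‖x'‖ ≤ 1 - 2 * δ := by rw [hn']; nlinarith
  have hdist : ‖x - x'‖ ≤ 2 * δ := by
    rw [hx', show x - (1 - 2 * δ) • x = (2 * δ) • x by module, norm_smul, Real.norm_of_nonneg (by linarith)]; nlinarith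
  have hball : ∀ y ∈ closedBall x' δ, ‖y‖ < 1 := by
    intro y hy
    have hy' : ‖y - x'‖ ≤ δ := by simpa [dist_eq_norm] using hy
    calc ‖y‖ = ‖(y - x') + x'‖ := by congr 1; abel
      _ ≤ _ := norm_add_le _ _
      _ < _ := by linarith
  have hx'b : x' ∈ ball (0:E2) 1 := by rw [mem_ball, dist_zero_right]; linarith
  have g1 : ∀ y ∈ ball x' (δ / 2), ‖fderiv ℝ u y‖ ≤ C * G / δ := by
    intro y hy
    have hyb : ‖y‖ < 1 := hball y (ball_subset_closedBall (ball_subset_ball (by linarith) hy))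
    have hd : DifferentiableAt ℝ u y := by
      have := (h.hu.contDiffAt (Filter.mem_of_superset (isOpen_ball.mem_nhds (show y ∈ ball (0:E2) 1 by simpa using hyb)) ball_subset_closedBall))
      exact this.differentiableAt (by norm_num)
    exact hcls.grad_le hI hδ (by linarith) (fun z hz => hS z (hball z hz).le) hy hd.hasFDerivAt
  have g2 : ‖(ContinuousLinearMap.apply ℝ ℝ ee0).comp (fderiv ℝ (fderiv ℝ u) x')‖ ≤ C * (C * G / δ) / (δ / 4) := by
    refine (h.cls norm_ee0).grad_le hI (R := δ / 4) (by positivity) (by linarith) ?_ (mem_ball_self (by positivity)) (h.hasD ee0 hx'b)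
    intro y hy
    have hy2 : y ∈ ball x' (δ / 2) := closedBall_subset_ball (by linarith) hy
    have hy3 : y ∈ ball (0:E2) 1 := by
      have := hball y (ball_subset_closedBall (ball_subset_ball (by linarith) hy2))
      simpa using this
    show |pg u y ee0| ≤ _
    rw [pg_ball u hy3]
    exact ((abs_apply_ee_le _).1).trans (g1 y hy2)
  have g3 := cone_norm hc (hcone x' hx'b) norm_ee0 g2
  have e3 : 8 / c * (C * (C * G / δ) / (δ / 4)) = 32 * C ^ 2 / (c * δ ^ 2) * G := by field_simp; ring
  rw [e3] at g3
  have hH := hE K G u g h x hx x' hx'b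
  have hH2 : E * (G + K) * ‖x - x'‖ ^ α ≤ (G + K) * (1 / 2) := by
    calc _ ≤ E * (G + K) * (2 * δ) ^ α := mul_le_mul_of_nonneg_left (rpow_le_rpow (norm_nonneg _) hdist hα.le) (by positivity)
      _ = (G + K) * (E * (2 * δ) ^ α) := by ring
      _ ≤ _ := mul_le_mul_of_nonneg_left hEδ (by positivity)
  constructor
  · have l1 := pg_lip h.hu h.h2 hx1.le (show ‖x'‖ ≤ 1 by linarith)
    rw [pg_ball u hx, pg_ball u hx'b] at l1
    have l2 := g1 x' (mem_ball_self (by positivity))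
    have l3 : K * ‖x - x'‖ ≤ K * (1 / 2) := mul_le_mul_of_nonneg_left (by linarith) hK
    have l4 : C * G / δ ≤ 32 * C ^ 2 / (c * δ ^ 2) * G := by
      rw [div_mul_eq_mul_div, div_le_div_iff₀ hδ (by positivity)]
      have m1 : c * δ ≤ 1 := by nlinarith
      have m2 : 0 ≤ C * G * δ := by positivity
      have m3 : C * G * δ * (c * δ) ≤ C * G * δ * 1 := mul_le_mul_of_nonneg_left m1 m2
      have m4 : C * G * δ * 1 ≤ C * G * δ * (32 * C) := mul_le_mul_of_nonneg_left (by linarith) m2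
      calc C * G * (c * δ ^ 2) = C * G * δ * (c * δ) := by ring
        _ ≤ _ := m3.trans m4
        _ = _ := by ring
    have l5 := norm_le_norm_add_norm_sub' (fderiv ℝ u x) (fderiv ℝ u x')
    linarith
  · have l5 := norm_le_norm_add_norm_sub' (fderiv ℝ (fderiv ℝ u) x) (fderiv ℝ (fderiv ℝ u) x')
    linarith

lemma exists_K {u : E2 → ℝ} (hu : ContDiffOn ℝ 2 u (closedBall (0 : E2) 1)) :
    ∃ K, ∀ x ∈ ball (0:E2) 1, ‖fderiv ℝ u x‖ ≤ K ∧ ‖fderiv ℝ (fderiv ℝ u) x‖ ≤ K := by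
  obtain ⟨K1, h1⟩ := (isCompact_closedBall (0:E2) 1).exists_bound_of_continuousOn (pg_cont hu)
  have hc : ContDiffOn ℝ 1 (pg u) (closedBall 0 1) := hu.fderivWithin udiff (by norm_num)
  obtain ⟨K2, h2⟩ := (isCompact_closedBall (0:E2) 1).exists_bound_of_continuousOn (hc.continuousOn_fderivWithin udiff (by norm_num))
  refine ⟨max K1 K2, fun x hx => ⟨?_, ?_⟩⟩
  · have := h1 x (ball_subset_closedBall hx)
    rw [pg_ball u hx] at this
    exact this.trans (le_max_left _ _)
  · have := h2 x (ball_subset_closedBall hx)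
    rw [fderivWithin_of_mem_nhds (Filter.mem_of_superset (isOpen_ball.mem_nhds hx) ball_subset_closedBall)] at this
    have e : fderiv ℝ (pg u) x = fderiv ℝ (fderiv ℝ u) x := by
      apply Filter.EventuallyEq.fderiv_eq
      filter_upwards [isOpen_ball.mem_nhds hx] with z hz
      exact pg_ball u hz
    rw [e] at this
    exact this.trans (le_max_right _ _)

lemma hess_apply {u : E2 → ℝ} (hu : ContDiffOn ℝ 2 u (closedBall (0 : E2) 1)) {x : E2} (hx : x ∈ ball (0:E2) 1) (i j : Fin 2) :
    hess u x i j = fderiv ℝ (fderiv ℝ u) x (EuclideanSpace.single i 1) (EuclideanSpace.single j 1) := by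
  have h1 : HasFDerivAt (fun y => fderiv ℝ u y (EuclideanSpace.single j 1)) ((ContinuousLinearMap.apply ℝ ℝ (EuclideanSpace.single j (1:ℝ))).comp (fderiv ℝ (fderiv ℝ u) x)) x :=
    (ContinuousLinearMap.apply ℝ ℝ (EuclideanSpace.single j (1:ℝ))).hasFDerivAt.comp x (diffAt_fderiv hu hx).hasFDerivAt
  simp only [hess, Matrix.of_apply]
  rw [h1.fderiv]; rfl

lemma hess_herm {u : E2 → ℝ} (hu : ContDiffOn ℝ 2 u (closedBall (0 : E2) 1)) {x : E2} (hx : x ∈ ball (0:E2) 1) :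
    (hess u x).IsHermitian := by
  have h1 : ContDiffAt ℝ 2 u x := (hu.contDiffAt (Filter.mem_of_superset (isOpen_ball.mem_nhds hx) ball_subset_closedBall))
  have h2 : IsSymmSndFDerivAt ℝ u x := h1.isSymmSndFDerivAt (by simp)
  ext i j
  rw [Matrix.conjTranspose_apply, hess_apply hu hx, hess_apply hu hx, star_trivial]
  exact h2 _ _

lemma matNorm_le {A : Mat2} {B : Bil} (h : ∀ i j, A i j = B (EuclideanSpace.single i 1) (EuclideanSpace.single j 1)) :
    matNorm A ≤ 4 * ‖B‖ := by
  have : ∀ i j, |A i j| ≤ ‖B‖ := by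
    intro i j
    rw [h, ← Real.norm_eq_abs]
    refine (B.le_opNorm₂ _ _).trans ?_
    simp
  simp only [matNorm, Fin.sum_univ_two]
  linarith [this 0 0, this 0 1, this 1 0, this 1 1]

lemma apriori {c C α E : ℝ} (hc : 0 < c) (hc1 : c ≤ 1) (hI : IConst c C) (hα : 0 < α) (hE0 : 0 < E) (hE : HConst c α E) :
    ∃ A : ℝ, 0 < A ∧ ∀ (K G : ℝ) (u g : E2 → ℝ), Setup c α K G u g → (∀ x ∈ ball (0:E2) 1, Cone c (fderiv ℝ (fderiv ℝ u) x)) →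
      (∀ t, |onCircle g t| ≤ G) → (∀ x, ‖x‖ ≤ 1 → |u x| ≤ G) ∧ Setup c α (A * G) G u g := by
  obtain ⟨δ, hδ, hδ4, hEδ⟩ := exists_delta hE0 hα
  have hC : 1 ≤ C := hI.1
  obtain ⟨A, hA⟩ : ∃ A, A = 1 + 32 * C ^ 2 / (c * δ ^ 2) := ⟨_, rfl⟩
  have hA0 : 0 < A := by rw [hA]; positivity
  refine ⟨2 * A, by positivity, ?_⟩
  intro K G u g h hcone hgG
  have hS : ∀ x, ‖x‖ ≤ 1 → |u x| ≤ G := by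
    intro x hx
    refine (Cls_self (h.hu.mono ball_subset_closedBall) hcone).maxp hc h.hu.continuousOn ?_ hx
    intro y hy
    rw [h.hug y (by simpa using hy)]
    obtain ⟨t, rfl⟩ := exists_circPt hy
    exact hgG t
  refine ⟨hS, ?_⟩
  obtain ⟨K', hK'⟩ : ∃ K', IsLUB ((fun x => max ‖fderiv ℝ u x‖ ‖fderiv ℝ (fderiv ℝ u) x‖) '' ball (0:E2) 1) K' := by
    apply Real.exists_isLUB
    · exact ⟨_, mem_image_of_mem _ (show (0:E2) ∈ ball (0:E2) 1 by simp)⟩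
    · refine ⟨K, ?_⟩
      rintro _ ⟨x, hx, rfl⟩
      exact max_le (h.h1 x hx) (h.h2 x hx)
  have hb : ∀ x ∈ ball (0:E2) 1, max ‖fderiv ℝ u x‖ ‖fderiv ℝ (fderiv ℝ u) x‖ ≤ K' := fun x hx => hK'.1 (mem_image_of_mem _ hx)
  have hs : Setup c α K' G u g :=
    ⟨h.hu, h.hug, h.hp, fun x hx => (le_max_left _ _).trans (hb x hx), fun x hx => (le_max_right _ _).trans (hb x hx), h.g2, h.b1, h.b2, h.b3⟩
  have imp := hs.improve hc hc1 hI hα hE hE0 hδ hδ4 hEδ hcone hS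
  rw [← hA] at imp
  have hle : K' ≤ A * G + K' / 2 := by
    apply hK'.2
    rintro _ ⟨x, hx, rfl⟩
    exact max_le (imp x hx).1 (imp x hx).2
  have hle2 : K' ≤ 2 * A * G := by linarith
  exact ⟨h.hu, h.hug, h.hp, fun x hx => (hs.h1 x hx).trans hle2, fun x hx => (hs.h2 x hx).trans hle2, h.g2, h.b1, h.b2, h.b3⟩

lemma onCircle_per (g : E2 → ℝ) : Function.Periodic (onCircle g) (2 * π) := by
  intro t
  simp only [onCircle, circPt_eq, cos_add_two_pi, sin_add_two_pi]

lemma per_deriv {f : ℝ → ℝ} {T : ℝ} (h : Function.Periodic f T) : Function.Periodic (deriv f) T := by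
  intro t
  rw [← deriv_comp_add_const]
  congr 1
  ext s; exact h s

lemma per_bdd {f : ℝ → ℝ} (h : Function.Periodic f (2 * π)) (hf : Continuous f) : BddAbove (range fun t => |f t|) := by
  have := (Function.Periodic.compact_of_continuous (f := fun t => |f t|) (c := 2 * π) (fun t => by simp only [h t]) (by positivity) hf.abs)
  exact this.bddAbove

lemma norm_data {α : ℝ} {g : E2 → ℝ} (hg : MemHolderCircle α g) :
    (∀ t, |onCircle g t| ≤ holderNormCircle α g) ∧ (∀ t, |deriv (onCircle g) t| ≤ holderNormCircle α g) ∧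
    (∀ t, |deriv (deriv (onCircle g)) t| ≤ holderNormCircle α g) ∧
    (∀ s t, |deriv (deriv (onCircle g)) s - deriv (deriv (onCircle g)) t| ≤ holderNormCircle α g * |s - t| ^ α) := by
  obtain ⟨h2, H, hH⟩ := hg
  have hd1 : ContDiff ℝ 1 (deriv (onCircle g)) := by
    have : ContDiff ℝ (1+1) (onCircle g) := by convert h2 using 1; norm_num
    exact (contDiff_succ_iff_deriv.mp this).2.2
  have hd2 : Continuous (deriv (deriv (onCircle g))) := hd1.continuous_deriv (by norm_num)
  have p0 := onCircle_per g
  have B0 := per_bdd p0 h2.continuous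
  have B1 := per_bdd (per_deriv p0) hd1.continuous
  have B2 := per_bdd (per_deriv (per_deriv p0)) hd2
  have hpos : ∀ p : ℝ × ℝ, p.1 ≠ p.2 → 0 < |p.1 - p.2| ^ α := fun p hp => rpow_pos_of_pos (abs_pos.mpr (sub_ne_zero.mpr hp)) _
  have B3 : BddAbove (range fun p : ℝ × ℝ => if p.1 ≠ p.2 then
        |deriv (deriv (onCircle g)) p.1 - deriv (deriv (onCircle g)) p.2| / |p.1 - p.2| ^ α else 0) := by
    refine ⟨max H 0, ?_⟩
    rintro _ ⟨p, rfl⟩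
    simp only
    split_ifs with hp
    · rw [div_le_iff₀ (hpos p hp)]
      exact (hH _ _).trans (mul_le_mul_of_nonneg_right (le_max_left _ _) (hpos p hp).le)
    · exact le_max_right _ _
  have l0 := fun t => le_ciSup B0 t
  have l1 := fun t => le_ciSup B1 t
  have l2 := fun t => le_ciSup B2 t
  have l3 := fun p => le_ciSup B3 p
  unfold holderNormCircle
  obtain ⟨S0, e0⟩ : ∃ a, a = (⨆ t : ℝ, |onCircle g t|) := ⟨_, rfl⟩
  obtain ⟨S1, e1⟩ : ∃ a, a = (⨆ t : ℝ, |deriv (onCircle g) t|) := ⟨_, rfl⟩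
  obtain ⟨S2, e2⟩ : ∃ a, a = (⨆ t : ℝ, |deriv (deriv (onCircle g)) t|) := ⟨_, rfl⟩
  obtain ⟨S3, e3⟩ : ∃ a, a = (⨆ p : ℝ × ℝ, if p.1 ≠ p.2 then
        |deriv (deriv (onCircle g)) p.1 - deriv (deriv (onCircle g)) p.2| / |p.1 - p.2| ^ α else 0) := ⟨_, rfl⟩
  rw [← e0] at l0
  rw [← e1] at l1
  rw [← e2] at l2
  rw [← e3] at l3
  rw [← e0, ← e1, ← e2, ← e3]
  have z0 := (abs_nonneg _).trans (l0 0)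
  have z1 := (abs_nonneg _).trans (l1 0)
  have z2 := (abs_nonneg _).trans (l2 0)
  have z3 : 0 ≤ S3 := by simpa using l3 (0, 0)
  refine ⟨fun t => ?_, fun t => ?_, fun t => ?_, fun s t => ?_⟩
  · linarith [l0 t]
  · linarith [l1 t]
  · linarith [l2 t]
  · rcases eq_or_ne s t with hst | hst
    · rw [hst, sub_self, abs_zero]; positivity
    · have := l3 (s, t)
      rw [if_pos hst, div_le_iff₀ (hpos (s, t) hst)] at this
      refine this.trans (mul_le_mul_of_nonneg_right (by linarith) (hpos (s, t) hst).le)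

/-- Global a priori `C^{2,ᾱ}` estimate: there are universal constants `ᾱ ∈ (0,1)` and `C > 0`
depending only on `lam, Lam` such that for any `C¹` uniformly elliptic `F` with `F(0) = 0`,
any boundary datum `g ∈ C^{2,ᾱ}(∂B₁)`, and any classical solution `u ∈ C²(B̄₁)` of
`F(D²u) = 0` in `B₁` with `u = g` on `∂B₁`, one has `u ∈ C^{2,ᾱ}(B̄₁)` with
`‖u‖_{C^{2,ᾱ}(B̄₁)} ≤ C ‖g‖_{C^{2,ᾱ}(∂B₁)}`. -/
theorem global_apriori_C2alpha (lam Lam : ℝ) (hlam : 0 < lam) (hLam : lam ≤ Lam) :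
    ∃ α C : ℝ, α ∈ Set.Ioo (0 : ℝ) 1 ∧ 0 < C ∧
      ∀ (F : Mat2 → ℝ) (u g : E2 → ℝ),
        ContDiff ℝ 1 (fun A : Fin 2 → Fin 2 → ℝ => F (Matrix.of A)) →
        UniformlyElliptic lam Lam F → F 0 = 0 →
        ContDiffOn ℝ 2 u (closedBall (0 : E2) 1) →
        (∀ x ∈ ball (0 : E2) 1, F (hess u x) = 0) →
        (∀ x ∈ sphere (0 : E2) 1, u x = g x) →
        MemHolderCircle α g →
        (∀ x ∈ ball (0 : E2) 1,
          |u x| ≤ C * holderNormCircle α g ∧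
          ‖fderiv ℝ u x‖ ≤ C * holderNormCircle α g ∧
          matNorm (hess u x) ≤ C * holderNormCircle α g) ∧
        (∀ x ∈ ball (0 : E2) 1, ∀ y ∈ ball (0 : E2) 1,
          matNorm (hess u x - hess u y) ≤ C * holderNormCircle α g * ‖x - y‖ ^ α) := by
  have hL0 : 0 < Lam := by linarith
  obtain ⟨c, hcdef⟩ : ∃ c, c = lam / (2 * Lam) := ⟨_, rfl⟩
  have hc : 0 < c := by rw [hcdef]; positivity
  have hc1 : c ≤ 1 := by rw [hcdef, div_le_one (by positivity)]; linarith
  obtain ⟨C, hI⟩ : ∃ C, IConst c C := lemmaI hc hc1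
  obtain ⟨α, E, hα, hα1, hE0, hE⟩ := holder_final hc hI
  obtain ⟨A, hA0, hA⟩ := apriori hc hc1 hI hα hE0 hE
  refine ⟨α, 1 + 4 * A + 4 * (E * (1 + A)), ⟨hα, hα1⟩, by positivity, ?_⟩
  intro F u g _ hF hF0 hu heq hug hg
  obtain ⟨G, hG⟩ : ∃ G, G = holderNormCircle α g := ⟨_, rfl⟩
  obtain ⟨n0, n1, n2, n3⟩ := norm_data hg
  rw [← hG] at n0 n1 n2 n3 ⊢
  obtain ⟨K, hK⟩ := exists_K hu
  have hp : ∀ x ∈ ball (0:E2) 1, ∀ y ∈ ball (0:E2) 1, Cone c (fderiv ℝ (fderiv ℝ u) x - fderiv ℝ (fderiv ℝ u) y) := by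
    intro x hx y hy
    have := cone_of_elliptic hlam hLam hF (hess_herm hu hx) (hess_herm hu hy) ((heq x hx).trans (heq y hy).symm)
    simp only [Matrix.sub_apply, hess_apply hu hx, hess_apply hu hy, ← hcdef] at this
    exact this
  have hcone : ∀ x ∈ ball (0:E2) 1, Cone c (fderiv ℝ (fderiv ℝ u) x) := by
    intro x hx
    have := cone_of_elliptic hlam hLam hF (hess_herm hu hx) (Matrix.isHermitian_zero) ((heq x hx).trans hF0.symm)
    simp only [sub_zero, hess_apply hu hx, ← hcdef] at this
    exact this
  have hs : Setup c α K G u g := ⟨hu, hug, hp, fun x hx => (hK x hx).1, fun x hx => (hK x hx).2, hg.1, n1, n2, n3⟩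
  have hG0 := hs.G0
  obtain ⟨hS, hs2⟩ := hA K G u g hs hcone n0
  have q1 := mul_nonneg hA0.le hG0
  have q2 := mul_nonneg (show 0 ≤ E * (1 + A) by positivity) hG0
  refine ⟨fun x hx => ⟨?_, ?_, ?_⟩, fun x hx y hy => ?_⟩
  · have := hS x (by have : ‖x‖ < 1 := by simpa using hx
                     exact this.le)
    linarith
  · have := hs2.h1 x hx
    linarith
  · have h1 := hs2.h2 x hx
    have h2 := matNorm_le (fun i j => hess_apply hu hx i j)
    linarith
  · have h1 := hE _ _ u g hs2 x hx y hy
    have h2 : matNorm (hess u x - hess u y) ≤ 4 * ‖fderiv ℝ (fderiv ℝ u) x - fderiv ℝ (fderiv ℝ u) y‖ := by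
      apply matNorm_le
      intro i j
      rw [Matrix.sub_apply, hess_apply hu hx, hess_apply hu hy]; rfl
    refine h2.trans ?_
    calc _ ≤ 4 * (E * (G + A * G) * ‖x - y‖ ^ α) := mul_le_mul_of_nonneg_left h1 (by norm_num)
      _ = (4 * (E * (1 + A)) * G) * ‖x - y‖ ^ α := by ring
      _ ≤ _ := mul_le_mul_of_nonneg_right (by linarith) (by positivity)
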